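/- Let W be a vector space over ℂ and let V be a maximal quasi compatible subspace of ℰ(W) (maximal with respect to inclusion among quasi compatible subspaces). Then V contains 1_W, V is closed, and (V, Y_ℰ, 1_W) carries the structure of a nonlocal vertex algebra with W as a faithful quasi module where Y_W(ψ(x), x₀) = ψ(x₀). Furthermore, for all a(x), b(x) ∈ V, α ∈ ℂˣ and n ∈ ℤ one has R_α a(x) = a(αx) ∈ V and a(x)_{(α,n)} b(x) ∈ V. -/

import Mathlib

noncomputable section

open Classical

namespace NVA

/-! ### The space ℰ(W) = Hom(W, W((x))), coefficient-indexed by modes: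
`a w n` is the mode `a_n` applied to `w`, where `a(x)w = ∑ (a_n w) x^{-n-1}`.
Lower truncation of `a(x)w` in powers of `x` means `a_n w = 0` for `n` large. -/

variable (W : Type*) [AddCommGroup W] [Module ℂ W]

/-- `ℰ(W) = Hom(W, W((x)))` as a submodule of `Hom(W, W[[x^{±1}]])`. -/
def EWsub : Submodule ℂ (W →ₗ[ℂ] (ℤ → W)) where
  carrier := {a | ∀ w : W, ∃ N : ℤ, ∀ n : ℤ, N ≤ n → a w n = 0}
  add_mem' := by
    intro a b ha hb w
    obtain ⟨N, hN⟩ := ha w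
    obtain ⟨M, hM⟩ := hb w
    refine ⟨max N M, fun n hn => ?_⟩
    simp only [LinearMap.add_apply, Pi.add_apply,
      hN n (le_trans (le_max_left _ _) hn), hM n (le_trans (le_max_right _ _) hn), add_zero]
  zero_mem' := by intro w; exact ⟨0, fun n _ => rfl⟩
  smul_mem' := by
    intro c a ha w
    obtain ⟨N, hN⟩ := ha w
    exact ⟨N, fun n hn => by
      simp only [LinearMap.smul_apply, Pi.smul_apply, hN n hn, smul_zero]⟩

/-- The type `ℰ(W)`. -/
abbrev EW := ↥(EWsub W)

variable {W}

/-- The mode function of an element of `ℰ(W)`. -/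
def mf (a : EW W) : W → ℤ → W := fun w n => (a : W →ₗ[ℂ] (ℤ → W)) w n

/-- The identity operator `1_W`, as an element of `ℰ(W)`. -/
def oneE : EW W :=
  ⟨{ toFun := fun w n => if n = -1 then w else 0
     map_add' := by
       intro w w'; funext n; by_cases h : n = -1 <;> simp [h]
     map_smul' := by
       intro c w; funext n; by_cases h : n = -1 <;> simp [h] },
   fun w => ⟨0, fun n hn => if_neg (by omega)⟩⟩

/-- The generalized binomial coefficient `C(m, j)` for `m ∈ ℤ`, as a complex number. -/
def binom (m : ℤ) (j : ℕ) : ℂ :=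
  (∏ i ∈ Finset.range j, ((m : ℂ) - (i : ℂ))) / (j.factorial : ℂ)

/-- The coefficient of `x₁^m x₂^t` in `a(x₁) b(x₂) w`. -/
def Fab (a b : EW W) (w : W) (m t : ℤ) : W := mf a (mf b w (-t - 1)) (-m - 1)

/-- Multiplication of a two-variable family by a polynomial `p(x₁,x₂)`. -/
def mulPoly (p : MvPolynomial (Fin 2) ℂ) (F : ℤ → ℤ → W) : ℤ → ℤ → W :=
  fun m t => ∑ d ∈ p.support, MvPolynomial.coeff d p • F (m - d 0) (t - d 1)

/-- A two-variable family lies in `W((x₁,x₂))` (jointly lower truncated). -/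
def IsLaurent2 (F : ℤ → ℤ → W) : Prop :=
  ∃ N : ℤ, ∀ m t : ℤ, (m < N ∨ t < N) → F m t = 0

/-- Quasi compatibility of an ordered pair `(a(x), b(x))` in `ℰ(W)`:
`p(x₁,x₂) a(x₁) b(x₂) ∈ Hom(W, W((x₁,x₂)))` for some nonzero polynomial `p`. -/
def QCPair (a b : EW W) : Prop :=
  ∃ p : MvPolynomial (Fin 2) ℂ, p ≠ 0 ∧ ∀ w, IsLaurent2 (mulPoly p (Fab a b w))

/-! ### Sequences -/

/-- The coefficient of `x₁^{k 1} ⋯ x_r^{k r}` in `ψ₁(x₁) ⋯ ψ_r(x_r) w`. -/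
def seqCoeff : {r : ℕ} → (Fin r → EW W) → W → (Fin r → ℤ) → W
  | 0, _, w, _ => w
  | _ + 1, ψ, w, k => mf (ψ 0) (seqCoeff (Fin.tail ψ) w (Fin.tail k)) (-(k 0) - 1)

/-- The polynomial `∏_{1 ≤ i < j ≤ r} p(x_i, x_j)`. -/
def pairPoly (p : MvPolynomial (Fin 2) ℂ) (r : ℕ) : MvPolynomial (Fin r) ℂ :=
  ∏ ij ∈ Finset.univ.filter (fun ij : Fin r × Fin r => ij.1 < ij.2),
    MvPolynomial.rename ![ij.1, ij.2] p

/-- Multiplication of an `r`-variable family by a polynomial in `r` variables. -/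
def mulPolyN {r : ℕ} (P : MvPolynomial (Fin r) ℂ) (F : (Fin r → ℤ) → W) :
    (Fin r → ℤ) → W :=
  fun k => ∑ d ∈ P.support, MvPolynomial.coeff d P • F (fun i => k i - d i)

/-- An `r`-variable family lies in `W((x₁,…,x_r))`. -/
def IsLaurentN {r : ℕ} (F : (Fin r → ℤ) → W) : Prop :=
  ∃ N : ℤ, ∀ k : Fin r → ℤ, (∃ i, k i < N) → F k = 0

/-- Quasi compatibility of an ordered sequence in `ℰ(W)`. -/
def QCSeq {r : ℕ} (ψ : Fin r → EW W) : Prop :=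
  ∃ p : MvPolynomial (Fin 2) ℂ, p ≠ 0 ∧
    ∀ w, IsLaurentN (mulPolyN (pairPoly p r) (seqCoeff ψ w))

/-- Quasi compatibility of a subset of `ℰ(W)`. -/
def QCSet (S : Set (EW W)) : Prop :=
  ∀ (r : ℕ) (ψ : Fin r → EW W), (∀ i, ψ i ∈ S) → QCSeq ψ

/-! ### The vertex operation `Y_ℰ^{(α)}` -/

/-- `ℂ((x))`. -/
abbrev LC : Type := LaurentSeries ℂ

/-- An iterated Laurent series field, e.g. `ℂ((x))((x₀))` (outer variable the second one). -/
abbrev K2 : Type := HahnSeries ℤ LC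

/-- The outer variable of `K2`. -/
def xOuter : K2 := HahnSeries.single 1 1

/-- The inner variable of `K2`. -/
def xInner : K2 := HahnSeries.single 0 (HahnSeries.single 1 1)

/-- `α` times the inner variable of `K2`. -/
def xInnerC (c : ℂ) : K2 := HahnSeries.single 0 (HahnSeries.single 1 c)

/-- The polynomial `p(x₀ + α x, x)` as an element of `ℂ((x))((x₀))`
(outer variable `x₀`). -/
def qK (p : MvPolynomial (Fin 2) ℂ) (α : ℂ) : K2 :=
  MvPolynomial.aeval ![xOuter + xInnerC α, xInner] p

/-- The expansion `ι_{x,x₀} (p(x₀ + α x, x)^{-1}) ∈ ℂ((x))((x₀))`. -/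
def qInv (p : MvPolynomial (Fin 2) ℂ) (α : ℂ) : K2 := (qK p α)⁻¹

/-- The coefficient of `x₀^j x^t` in `(p(x₁,x) a(x₁) b(x) w)|_{x₁ = αx + x₀}`,
expanding via `(αx+x₀)^m = ∑_{j≥0} C(m,j) α^{m-j} x^{m-j} x₀^j`. -/
def substYE (α : ℂ) (p : MvPolynomial (Fin 2) ℂ) (a b : EW W) (w : W)
    (j : ℕ) (t : ℤ) : W :=
  ∑ᶠ m : ℤ, (binom m j * α ^ (m - (j : ℤ))) • mulPoly p (Fab a b w) m (t - m + j)

/-- The coefficient of `x₀^J x^T` in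
`ι_{x,x₀}(p(x₀+αx,x)^{-1}) ⬝ (p(x₁,x)a(x₁)b(x)w)|_{x₁ = αx+x₀}`. -/
def fullYE (α : ℂ) (p : MvPolynomial (Fin 2) ℂ) (a b : EW W) (w : W)
    (J T : ℤ) : W :=
  ∑ᶠ s : ℤ × ℤ, (((qInv p α).coeff s.1).coeff s.2) •
    (if 0 ≤ J - s.1 then substYE α p a b w (J - s.1).toNat (T - s.2) else 0)

/-- The raw mode family of `Y_ℰ^{(α)}(a(x), x₀) b(x)`; `rawYE α a b n w m` is the mode
`m` of the element `a(x)_{(α,n)} b(x)` applied to `w`.  (Defined using a choice of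
polynomial from quasi compatibility; by the general theory the value does not depend
on the choice.) -/
def rawYE (α : ℂ) (a b : EW W) (n : ℤ) (w : W) (m : ℤ) : W :=
  if h : QCPair a b then fullYE α h.choose a b w (-n - 1) (-m - 1) else 0

/-- `a(x)_{(α,n)} b(x)`, as an element of `ℰ(W)` whenever the raw family is realized
by one (which is the case for any quasi compatible pair). -/
def YEa (α : ℂˣ) (a b : EW W) (n : ℤ) : EW W :=
  if h : ∃ c : EW W, ∀ w m, mf c w m = rawYE (α : ℂ) a b n w m then h.choose else 0

/-- `a(x)_n b(x) = a(x)_{(1,n)} b(x)`. -/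
def YE (a b : EW W) (n : ℤ) : EW W := YEa 1 a b n

end NVA

namespace NVA

variable {W : Type*} [AddCommGroup W] [Module ℂ W]

/-- Submodules of `ℰ(W)` are `ℂ`-vector spaces (registered explicitly to assist
instance resolution). -/
noncomputable instance (V : Submodule ℂ (EW W)) : AddCommGroup ↥V :=
  @Submodule.addCommGroup ℂ (EW W) _ inferInstance inferInstance V

noncomputable instance (V : Submodule ℂ (EW W)) : Module ℂ ↥V :=
  @Submodule.module ℂ (EW W) _ inferInstance inferInstance V

/-! ### Derivative and scaling operators on ℰ(W) -/

/-- `D = d/dx` on `ℰ(W)`: `(Da)_m = -m • a_{m-1}`. -/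
def Dop (a : EW W) : EW W :=
  ⟨{ toFun := fun w m => (-m : ℂ) • mf a w (m - 1)
     map_add' := by intro w w'; funext m; simp [mf, map_add]
     map_smul' := by
       intro c w; funext m
       simp only [mf, map_smul, Pi.smul_apply, RingHom.id_apply]
       exact smul_comm _ _ _ },
   by
     intro w
     obtain ⟨N, hN⟩ := a.2 w
     exact ⟨N + 1, fun m hm => by
       have : (a : W →ₗ[ℂ] (ℤ → W)) w (m - 1) = 0 := hN _ (by omega)
       simp [mf, this]⟩⟩

/-- `R_α : a(x) ↦ a(αx)`, on modes `(R_α a)_m = α^{-m-1} a_m`. -/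
def RaE (α : ℂˣ) (a : EW W) : EW W :=
  ⟨{ toFun := fun w m => ((α : ℂ) ^ (-m - 1 : ℤ)) • mf a w m
     map_add' := by intro w w'; funext m; simp [mf, map_add]
     map_smul' := by
       intro c w; funext m
       simp only [mf, map_smul, Pi.smul_apply, RingHom.id_apply]
       exact smul_comm _ _ _ },
   by
     intro w
     obtain ⟨N, hN⟩ := a.2 w
     exact ⟨N, fun m hm => by simp [mf, hN m hm]⟩⟩

/-! ### Nonlocal vertex algebras, modules and quasi modules -/

/-- The coefficient of `x₀^a x₂^b` in `Y₁(u, x₀+x₂) (Y₂(v,x₂) w)`, where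
`(x₀+x₂)^m` is expanded in nonnegative powers of `x₂`. -/
def prodCE {V : Type*} (Yo Yi : V → W → ℤ → W) (u v : V) (w : W) (a b : ℤ) : W :=
  ∑ᶠ m : ℤ, if a ≤ m then
    binom m (m - a).toNat • Yo u (Yi v w (-(b - (m - a)) - 1)) (-m - 1) else 0

/-- The coefficient of `x₀^a x₂^b` in `Y₂(Y₁(u,x₀)v, x₂) w`. -/
def assocCE {V : Type*} (Y1 : V → V → ℤ → V) (Y2 : V → W → ℤ → W)
    (u v : V) (w : W) (a b : ℤ) : W :=
  Y2 (Y1 u v (-a - 1)) w (-b - 1)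

/-- Multiplication of a two-variable family (in `x₀, x₂`) by `f(x₀+x₂, x₂)` for a
polynomial `f`, expanding `(x₀+x₂)^d` in nonnegative powers of `x₂`. -/
def mulSubPoly (f : MvPolynomial (Fin 2) ℂ) (A : ℤ → ℤ → W) (a b : ℤ) : W :=
  ∑ d ∈ f.support, ∑ i ∈ Finset.range (d 0 + 1),
    (MvPolynomial.coeff d f * ((d 0).choose i : ℂ)) •
      A (a - ((d 0 : ℤ) - i)) (b - i - (d 1 : ℤ))

/-- A nonlocal vertex algebra structure on a ℂ-vector space `V`:
a linear map `Y : V → ℰ(V) = Hom(V, V((x)))` and a vacuum vector `1` such that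
`Y(1,x)v = v`, `Y(v,x)1 ∈ V[[x]]` with constant term `v`, and weak associativity
holds. -/
structure NLVA (V : Type*) [AddCommGroup V] [Module ℂ V] where
  Y : V →ₗ[ℂ] EW V
  one : V
  vac : ∀ (v : V) (n : ℤ), mf (Y one) v n = if n = -1 then v else 0
  creation0 : ∀ (v : V) (n : ℤ), 0 ≤ n → mf (Y v) one n = 0
  creation1 : ∀ v : V, mf (Y v) one (-1) = v
  wassoc : ∀ u v w : V, ∃ l : ℕ, ∀ a b : ℤ,
    mulSubPoly (MvPolynomial.X 0 ^ l)
      (prodCE (fun x => mf (Y x)) (fun x => mf (Y x)) u v w) a b =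
    mulSubPoly (MvPolynomial.X 0 ^ l)
      (assocCE (fun x y n => mf (Y x) y n) (fun x => mf (Y x)) u v w) a b

/-- The mode maps of a nonlocal vertex algebra: `Yf A u v n = u_n v`. -/
def Yf {V : Type*} [AddCommGroup V] [Module ℂ V] (A : NLVA V) : V → V → ℤ → V :=
  fun u v n => mf (A.Y u) v n

/-- Mode maps of a linear map `V → ℰ(W)`. -/
def YWf {V : Type*} [AddCommGroup V] [Module ℂ V] (YW : V →ₗ[ℂ] EW W) :
    V → W → ℤ → W := fun v w n => mf (YW v) w n

/-- `(W, Y_W)` is a quasi module for the nonlocal vertex algebra `A` on `V`. -/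
def IsQuasiModule {V : Type*} [AddCommGroup V] [Module ℂ V] (A : NLVA V)
    (YW : V →ₗ[ℂ] EW W) : Prop :=
  (∀ (w : W) (n : ℤ), mf (YW A.one) w n = if n = -1 then w else 0) ∧
  ∀ (u v : V) (w : W), ∃ f : MvPolynomial (Fin 2) ℂ, f ≠ 0 ∧ ∀ a b : ℤ,
    mulSubPoly f (prodCE (YWf YW) (YWf YW) u v w) a b =
    mulSubPoly f (assocCE (Yf A) (YWf YW) u v w) a b

/-- `(W, Y_W)` is a module for the nonlocal vertex algebra `A` on `V`. -/
def IsModule {V : Type*} [AddCommGroup V] [Module ℂ V] (A : NLVA V)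
    (YW : V →ₗ[ℂ] EW W) : Prop :=
  (∀ (w : W) (n : ℤ), mf (YW A.one) w n = if n = -1 then w else 0) ∧
  ∀ (u v : V) (w : W), ∃ l : ℕ, ∀ a b : ℤ,
    mulSubPoly (MvPolynomial.X 0 ^ l) (prodCE (YWf YW) (YWf YW) u v w) a b =
    mulSubPoly (MvPolynomial.X 0 ^ l) (assocCE (Yf A) (YWf YW) u v w) a b

end NVA

namespace NVA

/-! ### Formal families in several variables -/

/-- Formal doubly infinite series in the variables `σ` with coefficients in `W`. -/
abbrev Fam (σ W : Type*) : Type _ := (σ → ℤ) → W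

section Families

variable {σ : Type*} {W : Type*} [AddCommGroup W] [Module ℂ W]

/-- Multiplication by a monomial. -/
def shiftHom (σ W : Type*) [AddCommGroup W] [Module ℂ W] :
    Multiplicative (σ →₀ ℕ) →* Module.End ℂ (Fam σ W) where
  toFun d :=
    { toFun := fun F k => F (fun v => k v - (Multiplicative.toAdd d v : ℤ))
      map_add' := fun _ _ => rfl
      map_smul' := fun _ _ => rfl }
  map_one' := by
    ext F k
    simp
  map_mul' d e := by
    ext F k
    simp only [toAdd_mul, Finsupp.add_apply, Nat.cast_add, LinearMap.coe_mk, AddHom.coe_mk,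
      Module.End.mul_apply]
    congr 1
    funext v
    ring

/-- The action of polynomials on formal families by multiplication. -/
def act : MvPolynomial σ ℂ →ₐ[ℂ] Module.End ℂ (Fam σ W) :=
  AddMonoidAlgebra.lift ℂ _ _ (shiftHom σ W)

theorem act_apply (P : MvPolynomial σ ℂ) (F : Fam σ W) (k : σ → ℤ) :
    act P F k = ∑ d ∈ P.support, P.coeff d • F (fun v => k v - d v) := by
  have : (act P : Module.End ℂ (Fam σ W)) =
      (AddMonoidAlgebra.coeff P).sum fun d c => c • shiftHom σ W (Multiplicative.ofAdd d) :=
    AddMonoidAlgebra.lift_apply _ _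
  rw [this, MvPolynomial.sum_def]
  simp only [LinearMap.sum_apply, Finset.sum_apply, LinearMap.smul_apply, Pi.smul_apply]
  rfl

@[simp] theorem act_mul (P Q : MvPolynomial σ ℂ) (F : Fam σ W) :
    act (P * Q) F = act P (act Q F) := by
  rw [map_mul]; rfl

theorem act_comm (P Q : MvPolynomial σ ℂ) (F : Fam σ W) :
    act P (act Q F) = act Q (act P F) := by
  rw [← act_mul, mul_comm, act_mul]

theorem act_monomial (d : σ →₀ ℕ) (c : ℂ) (F : Fam σ W) (k : σ → ℤ) :
    act (MvPolynomial.monomial d c) F k = c • F (fun v => k v - d v) := by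
  have : (act (MvPolynomial.monomial d c) : Module.End ℂ (Fam σ W)) =
      c • shiftHom σ W (Multiplicative.ofAdd d) :=
    AddMonoidAlgebra.lift_single _ _ _
  rw [this]
  rfl

@[simp] theorem act_C (c : ℂ) (F : Fam σ W) :
    act (MvPolynomial.C c) F = c • F := by
  funext k
  rw [MvPolynomial.C_apply, act_monomial]
  simp

theorem act_X (v : σ) (F : Fam σ W) (k : σ → ℤ) :
    act (MvPolynomial.X v) F k = F (fun x => k x - if v = x then 1 else 0) := by
  rw [MvPolynomial.X, act_monomial, one_smul]
  congr 1
  funext x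
  rw [Finsupp.single_apply]
  push_cast
  rfl

theorem act_X_pow (v : σ) (n : ℕ) (F : Fam σ W) (k : σ → ℤ) :
    act (MvPolynomial.X v ^ n) F k = F (fun x => k x - if v = x then n else 0) := by
  rw [MvPolynomial.X_pow_eq_monomial, act_monomial, one_smul]
  congr 1
  funext x
  rw [Finsupp.single_apply]

/-- `W((x_v : v ∈ σ))` inside all formal families. -/
def Lau (σ W : Type*) [AddCommGroup W] [Module ℂ W] : Submodule ℂ (Fam σ W) where
  carrier := {F | ∃ N : ℤ, ∀ k : σ → ℤ, (∃ i, k i < N) → F k = 0}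
  add_mem' := by
    rintro F G ⟨N, hN⟩ ⟨M, hM⟩
    refine ⟨min N M, fun k ⟨i, hi⟩ => ?_⟩
    rw [Pi.add_apply, hN k ⟨i, hi.trans_le (min_le_left _ _)⟩,
      hM k ⟨i, hi.trans_le (min_le_right _ _)⟩, add_zero]
  zero_mem' := ⟨0, fun _ _ => rfl⟩
  smul_mem' := by
    rintro c F ⟨N, hN⟩
    exact ⟨N, fun k hk => by rw [Pi.smul_apply, hN k hk, smul_zero]⟩

theorem act_mem_Lau (P : MvPolynomial σ ℂ) {F : Fam σ W} (hF : F ∈ Lau σ W) :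
    act P F ∈ Lau σ W := by
  obtain ⟨N, hN⟩ := hF
  refine ⟨N, fun k ⟨i, hi⟩ => ?_⟩
  rw [act_apply]
  refine Finset.sum_eq_zero fun d _ => ?_
  rw [hN _ ⟨i, by omega⟩, smul_zero]

/-- `act P F` only depends on the values of `F` on a set closed under lowering exponents
by those of `P`. -/
theorem act_congr {P : MvPolynomial σ ℂ} {F G : Fam σ W} {Z : Set (σ → ℤ)}
    (hZ : ∀ k ∈ Z, ∀ d ∈ P.support, (fun v => k v - (d v : ℤ)) ∈ Z)
    (h : ∀ k ∈ Z, F k = G k) : ∀ k ∈ Z, act P F k = act P G k := by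
  intro k hk
  rw [act_apply, act_apply]
  exact Finset.sum_congr rfl fun d hd => by rw [h _ (hZ k hk d hd)]

/-- Cancellation of a polynomial on families with well-founded support. -/
theorem eq_zero_of_act_eq_zero {P : MvPolynomial σ ℂ} {F : Fam σ W}
    (r : (σ → ℤ) → (σ → ℤ) → Prop) (hwf : Set.WellFoundedOn {k | F k ≠ 0} r)
    (e : σ →₀ ℕ) (he : e ∈ P.support)
    (hlt : ∀ k, ∀ d ∈ P.support, d ≠ e → r (fun v => k v + e v - d v) k)
    (Z : Set (σ → ℤ)) (hZ : ∀ k ∈ Z, ∀ d ∈ P.support, (fun v => k v + e v - (d v : ℤ)) ∈ Z)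
    (h : ∀ k ∈ Z, act P F (fun v => k v + e v) = 0) : ∀ k ∈ Z, F k = 0 := by
  by_contra! hne
  obtain ⟨k0, hk0, hk0'⟩ := hne
  have hwf' : Set.WellFoundedOn {k | k ∈ Z ∧ F k ≠ 0} r := hwf.subset fun k hk => hk.2
  obtain ⟨⟨k, hk⟩, -, hmin⟩ := hwf'.has_min Set.univ ⟨⟨k0, hk0, hk0'⟩, trivial⟩
  apply hk.2
  have h1 := h k hk.1
  rw [act_apply, Finset.sum_eq_single e] at h1
  · simpa [MvPolynomial.mem_support_iff.1 he] using h1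
  · intro d hd hde
    by_contra hF
    refine hmin ⟨_, hZ k hk.1 d hd, fun h0 => hF ?_⟩ trivial (hlt k d hd hde)
    rw [h0, smul_zero]
  · exact fun hc => absurd he hc

end Families

/-! ### Substitution operators -/

section Substitution

variable {σ : Type*} {W : Type*} [AddCommGroup W] [Module ℂ W]

/-- Replace the exponent of `x_u` by `m`, keeping the total degree in `x_u, x_y`. -/
def slide (u y : σ) (k : σ → ℤ) (m : ℤ) : σ → ℤ :=
  fun v => if v = u then m else if v = y then k y + k u - m else k v

/-- The families to which the substitution operator with kernel `κ` can be applied. -/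
def Adm (κ : ℤ → ℤ → ℂ) (u y : σ) (W : Type*) [AddCommGroup W] [Module ℂ W] :
    Submodule ℂ (Fam σ W) where
  carrier := {F | ∀ k, (fun m => κ m (k u) • F (slide u y k m)).support.Finite}
  add_mem' := by
    intro F G hF hG k
    refine ((hF k).union (hG k)).subset fun m hm => ?_
    by_contra hc
    simp only [Set.mem_union, Function.mem_support, not_or, not_not] at hc
    exact hm (by simp only [Pi.add_apply, smul_add, hc.1, hc.2, add_zero])
  zero_mem' := by
    intro k
    simp
  smul_mem' := by
    intro c F hF k
    refine (hF k).subset fun m hm h0 => hm ?_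
    simp only [Pi.smul_apply, smul_comm _ c, h0, smul_zero]

/-- The substitution operator with kernel `κ`. -/
def subst (κ : ℤ → ℤ → ℂ) (u y : σ) (F : Fam σ W) : Fam σ W :=
  fun k => ∑ᶠ m : ℤ, κ m (k u) • F (slide u y k m)

variable {κ : ℤ → ℤ → ℂ} {u y : σ}

theorem subst_add {F G : Fam σ W} (hF : F ∈ Adm κ u y W) (hG : G ∈ Adm κ u y W) :
    subst κ u y (F + G) = subst κ u y F + subst κ u y G := by
  funext k
  simp only [subst, Pi.add_apply, smul_add]
  exact finsum_add_distrib (hF k) (hG k)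

theorem subst_smul (c : ℂ) (F : Fam σ W) :
    subst κ u y (c • F) = c • subst κ u y F := by
  funext k
  simp only [subst, Pi.smul_apply, smul_comm _ c]
  exact (smul_finsum c _).symm

theorem subst_congr {F G : Fam σ W} {Z : Set (σ → ℤ)} (hZ : ∀ k ∈ Z, ∀ m, slide u y k m ∈ Z)
    (h : ∀ k ∈ Z, F k = G k) : ∀ k ∈ Z, subst κ u y F k = subst κ u y G k := by
  intro k hk
  simp only [subst]
  exact finsum_congr fun m => by rw [h _ (hZ k hk m)]

/-- The polynomial substitution `x_u ↦ x_u + α x_y`. -/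
def polySubst (α : ℂ) (u y : σ) : MvPolynomial σ ℂ →ₐ[ℂ] MvPolynomial σ ℂ :=
  MvPolynomial.aeval fun v =>
    if v = u then MvPolynomial.X u + MvPolynomial.C α * MvPolynomial.X y else MvPolynomial.X v

theorem polySubst_X_self (α : ℂ) (u y : σ) :
    polySubst α u y (MvPolynomial.X u) =
      MvPolynomial.X u + MvPolynomial.C α * MvPolynomial.X y := by
  simp [polySubst]

theorem polySubst_X_of_ne (α : ℂ) {u v : σ} (y : σ) (h : v ≠ u) :
    polySubst α u y (MvPolynomial.X v) = MvPolynomial.X v := by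
  simp [polySubst, h]

theorem polySubst_injective (α : ℂ) {u y : σ} (h : u ≠ y) :
    Function.Injective (polySubst α u y) := by
  refine Function.LeftInverse.injective (g := polySubst (-α) u y) fun P => ?_
  have : (polySubst (-α) u y).comp (polySubst α u y) = AlgHom.id ℂ _ := by
    ext v : 1
    by_cases hv : v = u
    · subst hv
      have hC : polySubst (-α) v y (MvPolynomial.C α) = MvPolynomial.C α :=
        (polySubst (-α) v y).commutes α
      simp [polySubst_X_self, polySubst_X_of_ne _ _ h.symm, map_add, map_mul, hC]
    · simp [polySubst_X_of_ne _ _ hv]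
  exact DFunLike.congr_fun this P

theorem act_X_mem_Adm {α : ℂ} (huy : u ≠ y)
    (hκ : ∀ m j, κ (m + 1) j = α * κ m j + κ m (j - 1)) (v : σ) {F : Fam σ W}
    (hF : F ∈ Adm κ u y W) :
    act (MvPolynomial.X v) F ∈ Adm κ u y W ∧
      subst κ u y (act (MvPolynomial.X v) F) =
        act (polySubst α u y (MvPolynomial.X v)) (subst κ u y F) := by
  by_cases hv : v = u
  · subst hv
    have key : ∀ (k : σ → ℤ) (m : ℤ),
        κ (m + 1) (k v) • act (MvPolynomial.X v) F (slide v y k (m + 1)) =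
        α • (κ m (k v) • F (slide v y (fun x => k x - if y = x then 1 else 0) m)) +
          κ m (k v - 1) • F (slide v y (fun x => k x - if v = x then 1 else 0) m) := by
      intro k m
      rw [hκ, add_smul, mul_smul, act_X]
      congr 4 <;>
      · funext x
        simp only [slide]
        split_ifs <;> grind
    have fin1 : ∀ k : σ → ℤ, (fun m => κ m (k v) •
        F (slide v y (fun x => k x - if y = x then 1 else 0) m)).support.Finite := by
      intro k
      have := hF (fun x => k x - if y = x then 1 else 0)
      simpa [huy.symm] using this
    have fin2 : ∀ k : σ → ℤ, (fun m => κ m (k v - 1) •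
        F (slide v y (fun x => k x - if v = x then 1 else 0) m)).support.Finite := by
      intro k
      have := hF (fun x => k x - if v = x then 1 else 0)
      simpa using this
    have fin1' : ∀ k : σ → ℤ, (fun m => α • (κ m (k v) •
        F (slide v y (fun x => k x - if y = x then 1 else 0) m))).support.Finite := by
      intro k
      refine (fin1 k).subset fun m hm h0 => hm ?_
      simp only [h0, smul_zero]
    constructor
    · intro k
      refine (((fin1' k).union (fin2 k)).image (· + 1)).subset fun m hm => ?_
      refine ⟨m - 1, ?_, by simp⟩
      by_contra hc
      simp only [Set.mem_union, Function.mem_support, not_or, not_not] at hc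
      have := key k (m - 1)
      rw [hc.1, hc.2, sub_add_cancel, add_zero] at this
      exact hm this
    · funext k
      rw [polySubst_X_self, map_add, LinearMap.add_apply, act_mul, act_C]
      simp only [subst, Pi.add_apply, Pi.smul_apply, act_X]
      rw [← finsum_comp_equiv (Equiv.addRight (1 : ℤ))]
      simp only [Equiv.coe_addRight]
      simp only [act_X] at key
      rw [finsum_congr (key k), finsum_add_distrib (fin1' k) (fin2 k), ← smul_finsum]
      rw [add_comm]
      simp [huy.symm]
  · rw [polySubst_X_of_ne _ _ hv]
    have key : ∀ (k : σ → ℤ) (m : ℤ), κ m (k u) • act (MvPolynomial.X v) F (slide u y k m) =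
        κ m (k u) • F (slide u y (fun x => k x - if v = x then 1 else 0) m) := by
      intro k m
      rw [act_X]
      congr 2
      funext x
      simp only [slide]
      split_ifs <;> grind
    constructor
    · intro k
      simp only [key]
      have := hF (fun x => k x - if v = x then 1 else 0)
      simpa [hv] using this
    · funext k
      rw [act_X]
      simp only [subst, if_neg hv, sub_zero]
      exact finsum_congr fun m => key k m

theorem act_mem_Adm {α : ℂ} (huy : u ≠ y)
    (hκ : ∀ m j, κ (m + 1) j = α * κ m j + κ m (j - 1)) (P : MvPolynomial σ ℂ) {F : Fam σ W}
    (hF : F ∈ Adm κ u y W) :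
    act P F ∈ Adm κ u y W ∧
      subst κ u y (act P F) = act (polySubst α u y P) (subst κ u y F) := by
  induction P using MvPolynomial.induction_on generalizing F with
  | C c =>
    rw [act_C, ← MvPolynomial.algebraMap_eq, AlgHom.commutes, MvPolynomial.algebraMap_eq, act_C,
      subst_smul]
    exact ⟨Submodule.smul_mem _ _ hF, rfl⟩
  | add P Q hP hQ =>
    obtain ⟨hP1, hP2⟩ := hP hF
    obtain ⟨hQ1, hQ2⟩ := hQ hF
    rw [map_add, map_add, map_add, LinearMap.add_apply, LinearMap.add_apply]
    exact ⟨Submodule.add_mem _ hP1 hQ1, by rw [subst_add hP1 hQ1, hP2, hQ2]⟩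
  | mul_X P v hP =>
    obtain ⟨hX1, hX2⟩ := act_X_mem_Adm huy hκ v hF
    obtain ⟨hP1, hP2⟩ := hP hX1
    rw [act_mul, map_mul, act_mul]
    exact ⟨hP1, by rw [hP2, hX2]⟩

end Substitution

/-! ### Binomial kernels -/

theorem binom_eq_choose (m : ℤ) (j : ℕ) : binom m j = Ring.choose (m : ℂ) j := by
  rw [Ring.choose_eq_smul, ← Polynomial.aeval_eq_smeval, Polynomial.aeval_def,
    Polynomial.eval₂_eq_eval_map, descPochhammer_map, descPochhammer_eval_eq_prod_range,
    binom, div_eq_inv_mul, smul_eq_mul]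

theorem binom_zero (m : ℤ) : binom m 0 = 1 := by simp [binom]

theorem binom_succ (m : ℤ) (j : ℕ) : binom (m + 1) (j + 1) = binom m (j + 1) + binom m j := by
  simp only [binom_eq_choose, Int.cast_add, Int.cast_one, Ring.choose_succ_succ]
  ring

theorem binom_natCast (n j : ℕ) : binom n j = n.choose j := by
  rw [binom_eq_choose, Int.cast_natCast, Ring.choose_natCast]

theorem binom_mul_binom (m : ℤ) (k i : ℕ) :
    binom m (k + i) * binom (k + i : ℕ) i = binom m k * binom (m - k) i := by
  rw [binom_natCast]
  simp only [binom_eq_choose]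
  have := Ring.choose_smul_choose (m : ℂ) (Nat.le_add_right k i)
  rw [nsmul_eq_mul, Nat.add_sub_cancel_left] at this
  push_cast
  rw [← this, mul_comm, Nat.choose_symm_add]

theorem binom_add (m n : ℤ) (k : ℕ) :
    binom (m + n) k = ∑ i ∈ Finset.range (k + 1), binom m i * binom n (k - i) := by
  simp only [binom_eq_choose, Int.cast_add]
  rw [Ring.add_choose_eq k (Commute.all _ _), Finset.Nat.sum_antidiagonal_eq_sum_range_succ
    (fun i j => Ring.choose (m : ℂ) i * Ring.choose (n : ℂ) j)]

/-- The coefficient of `x₀^j` (up to a power of `x`) in the expansion of `(αx + x₀)^m` in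
nonnegative powers of `x₀`. -/
def kerIn (α : ℂ) (m j : ℤ) : ℂ := if 0 ≤ j then binom m j.toNat * α ^ (m - j) else 0

/-- The coefficient of `x₀^j` (up to a power of `x`) in the expansion of `(x₀ + x)^m` in
nonnegative powers of `x`. -/
def kerOut (m j : ℤ) : ℂ := if j ≤ m then binom m (m - j).toNat else 0

theorem kerIn_of_neg (α : ℂ) (m : ℤ) {j : ℤ} (h : j < 0) : kerIn α m j = 0 :=
  if_neg (by omega)

theorem kerIn_zero (α : ℂ) (m : ℤ) : kerIn α m 0 = α ^ m := by
  simp [kerIn, binom_zero]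

theorem kerOut_of_lt {m j : ℤ} (h : m < j) : kerOut m j = 0 := if_neg (by omega)

theorem kerIn_succ {α : ℂ} (hα : α ≠ 0) (m j : ℤ) :
    kerIn α (m + 1) j = α * kerIn α m j + kerIn α m (j - 1) := by
  rcases lt_trichotomy j 0 with h | h | h
  · rw [kerIn_of_neg _ _ h, kerIn_of_neg _ _ h, kerIn_of_neg _ _ (by omega)]
    ring
  · subst h
    rw [kerIn_zero, kerIn_zero, kerIn_of_neg _ _ (by omega), zpow_add_one₀ hα]
    ring
  · obtain ⟨n, rfl⟩ : ∃ n : ℕ, j = n + 1 := ⟨(j - 1).toNat, by omega⟩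
    have e1 : ((n : ℤ) + 1).toNat = n + 1 := by omega
    simp only [kerIn, if_pos h.le, add_sub_cancel_right, e1, Int.toNat_natCast,
      if_pos (Int.natCast_nonneg n), binom_succ]
    have e2 : m + 1 - ((n : ℤ) + 1) = (m - ((n : ℤ) + 1)) + 1 := by ring
    have e3 : m - (n : ℤ) = (m - ((n : ℤ) + 1)) + 1 := by ring
    rw [e2, e3, zpow_add_one₀ hα]
    ring

theorem kerOut_succ (m j : ℤ) : kerOut (m + 1) j = 1 * kerOut m j + kerOut m (j - 1) := by
  rcases lt_trichotomy (m + 1) j with h | h | h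
  · rw [kerOut_of_lt h, kerOut_of_lt (by omega), kerOut_of_lt (by omega)]
    ring
  · subst h
    simp [kerOut, binom_zero]
  · obtain ⟨n, hn⟩ : ∃ n : ℕ, m - j = n := ⟨(m - j).toNat, by omega⟩
    have e1 : (m + 1 - j).toNat = n + 1 := by omega
    have e2 : (m - j).toNat = n := by omega
    have e3 : (m - (j - 1)).toNat = n + 1 := by omega
    simp only [kerOut, if_pos (show j ≤ m + 1 by omega), if_pos (show j ≤ m by omega),
      if_pos (show j - 1 ≤ m by omega), e1, e2, e3, binom_succ]
    ring

theorem binom_eq_zero {m j : ℕ} (h : m < j) : binom m j = 0 := by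
  rw [binom_natCast, Nat.choose_eq_zero_of_lt h, Nat.cast_zero]

/-- The two expansions agree for nonnegative powers. -/
theorem kerIn_eq_kerOut {m : ℤ} (hm : 0 ≤ m) (j : ℤ) : kerIn 1 m j = kerOut m j := by
  lift m to ℕ using hm
  simp only [kerIn, kerOut, one_zpow, mul_one]
  split_ifs with h1 h2 h2
  · lift j to ℕ using h1
    have h3 : ((m : ℤ) - j).toNat = m - j := by omega
    rw [h3, Int.toNat_natCast, binom_natCast, binom_natCast, Nat.choose_symm (by omega)]
  · exact binom_eq_zero (by omega)
  · exact (binom_eq_zero (by omega)).symm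
  · rfl

/-- The coefficientwise form of `(x₂ + x₁)^n (x₂ + (x₁ + x₀))^m =
(x₂ + x₁)^n ((x₂ + x₁) + x₀)^m`. -/
theorem sum_kerOut_mul_kerIn (m n j k : ℤ) :
    ∑ i ∈ Finset.Icc 0 (j + k), kerOut i j * kerIn 1 m i * kerIn 1 n (j + k - i) =
      kerIn 1 m j * kerIn 1 (m + n - j) k := by
  rcases lt_or_ge j 0 with hj | hj
  · rw [kerIn_of_neg _ _ hj, zero_mul]
    refine Finset.sum_eq_zero fun i hi => ?_
    rw [Finset.mem_Icc] at hi
    rw [← kerIn_eq_kerOut hi.1, kerIn_of_neg _ _ hj]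
    ring
  rcases lt_or_ge k 0 with hk | hk
  · rw [kerIn_of_neg _ _ hk, mul_zero]
    refine Finset.sum_eq_zero fun i hi => ?_
    rw [Finset.mem_Icc] at hi
    rw [kerOut_of_lt (by omega)]
    ring
  lift j to ℕ using hj
  lift k to ℕ using hk
  have : ∑ i ∈ Finset.Icc (0 : ℤ) (j + k), kerOut i j * kerIn 1 m i * kerIn 1 n (j + k - i) =
      ∑ i ∈ Finset.range (k + 1),
        kerOut (j + i) j * kerIn 1 m (j + i) * kerIn 1 n (k - i) := by
    refine (Finset.sum_of_injOn (fun i : ℕ => (j : ℤ) + i) ?_ ?_ ?_ ?_).symm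
    · intro a _ b _ h
      simpa using h
    · intro a ha
      simp only [Finset.coe_range, Set.mem_Iio, Finset.coe_Icc, Set.mem_Icc] at ha ⊢
      omega
    · intro i hi hi'
      rw [Finset.mem_Icc] at hi
      rw [kerOut_of_lt]
      · ring
      · by_contra h
        exact hi' ⟨(i - j).toNat, by
          simp only [Finset.coe_range, Set.mem_Iio]
          omega, by
          simp only
          omega⟩
    · intro i _
      congr 2
      ring
  rw [this]
  have h2 : kerIn 1 (m + n - j) k = binom ((m - j) + n) k := by
    simp only [kerIn, if_pos (Int.natCast_nonneg k), one_zpow, mul_one, Int.toNat_natCast]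
    congr 1
    ring
  rw [h2, binom_add, Finset.mul_sum]
  refine Finset.sum_congr rfl fun i hi => ?_
  rw [Finset.mem_range] at hi
  have h3 : kerIn 1 m j = binom m j := by
    simp [kerIn]
  have h4 : kerIn 1 m (j + i) = binom m (j + i) := by
    simp only [kerIn, one_zpow, mul_one]
    rw [if_pos (by omega)]
    rfl
  have h5 : kerIn 1 n (k - i) = binom n (k - i) := by
    simp only [kerIn, one_zpow, mul_one]
    rw [if_pos (by omega)]
    congr 1
    omega
  have h6 : kerOut (j + i) j = binom (j + i : ℕ) i := by
    simp only [kerOut]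
    rw [if_pos (by omega)]
    push_cast
    congr 1
    omega
  rw [h3, h4, h5, h6, mul_comm (binom _ i), binom_mul_binom, mul_assoc]

section Admissible

variable {σ : Type*} {W : Type*} [AddCommGroup W] [Module ℂ W] {u y : σ}

theorem Lau_le_Adm (κ : ℤ → ℤ → ℂ) (h : u ≠ y) : Lau σ W ≤ Adm κ u y W := by
  rintro F ⟨N, hN⟩ k
  refine (Set.finite_Icc N (k y + k u - N)).subset fun m hm => ?_
  by_contra hc
  rw [Set.mem_Icc, not_and_or, not_le, not_le] at hc
  refine hm ?_
  change _ • _ = _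
  rw [hN, smul_zero]
  rcases hc with hc | hc
  · exact ⟨u, by simpa [slide] using hc⟩
  · exact ⟨y, by
      simp only [slide, if_neg h.symm, if_true]
      omega⟩

theorem mem_Adm_kerOut {F : Fam σ W}
    (hF : ∀ k : σ → ℤ, ∃ N, ∀ m < N, ∀ n,
      F (fun v => if v = u then n else if v = y then m else k v) = 0) :
    F ∈ Adm kerOut u y W := by
  intro k
  obtain ⟨N, hN⟩ := hF k
  refine (Set.finite_Icc (k u) (k y + k u - N)).subset fun m hm => ?_
  by_contra hc
  rw [Set.mem_Icc, not_and_or, not_le, not_le] at hc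
  refine hm ?_
  change _ • _ = _
  rcases hc with hc | hc
  · rw [kerOut_of_lt hc, zero_smul]
  · exact (congrArg _ (hN _ (by omega) m)).trans (smul_zero _)

theorem subst_kerIn_of_neg (α : ℂ) (F : Fam σ W) {k : σ → ℤ} (h : k u < 0) :
    subst (kerIn α) u y F k = 0 := by
  simp [subst, kerIn_of_neg _ _ h]

end Admissible

/-! ### Two-variable families as a vector space over `ℂ((x))((x₀))` -/

section TwoVariables

variable {W : Type*} [AddCommGroup W] [Module ℂ W]

/-- `W((x))` as a module over `ℂ((x))`. -/
abbrev InnerMod (W : Type*) [AddCommGroup W] [Module ℂ W] : Type _ := HahnModule ℤ ℂ W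

/-- `W((x))((x₀))` as a module over `ℂ((x))((x₀))`. -/
abbrev OuterMod (W : Type*) [AddCommGroup W] [Module ℂ W] : Type _ := HahnModule ℤ LC (InnerMod W)

theorem outer_add_smul (x y : K2) (z : OuterMod W) : (x + y) • z = x • z + y • z :=
  add_smul x y z

theorem outer_mul_smul (x y : K2) (z : OuterMod W) : (x * y) • z = x • y • z :=
  @mul_smul (HahnSeries ℤ LC) (HahnModule ℤ LC (HahnModule ℤ ℂ W)) _
    HahnModule.instModule.toMulAction.toSemigroupAction x y z

theorem outer_zero_smul (z : OuterMod W) : (0 : K2) • z = 0 := by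
  have h := outer_add_smul 0 0 z
  have h0 : (0 + 0 : K2) = 0 := @add_zero K2 _ 0
  rw [h0] at h
  exact left_eq_add.1 h

theorem outer_one_smul (z : OuterMod W) : (1 : K2) • z = z :=
  HahnModule.one_smul'

theorem K2_inv_mul_cancel {q : K2} (h : q ≠ 0) : q⁻¹ * q = 1 :=
  @inv_mul_cancel₀ K2 _ q h

/-- The coefficients of an element of `W((x))`. -/
def innerCoeff (t : ℤ) : InnerMod W →+ W where
  toFun y := ((HahnModule.of ℂ).symm y).coeff t
  map_zero' := rfl
  map_add' _ _ := rfl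

/-- The coefficients of an element of `W((x))((x₀))`. -/
def outerCoeff : OuterMod W →+ Fam (Fin 2) W where
  toFun y k := innerCoeff (k 1) (((HahnModule.of LC).symm y).coeff (k 0))
  map_zero' := rfl
  map_add' _ _ := rfl

theorem innerCoeff_smul (x : LC) (y : InnerMod W) (a : ℤ) :
    (fun s => x.coeff s • innerCoeff (a - s) y).support.Finite ∧
    innerCoeff a (x • y) = ∑ᶠ s : ℤ, x.coeff s • innerCoeff (a - s) y := by
  have h : innerCoeff a (x • y) = ∑ ij ∈ Finset.VAddAntidiagonal a
      (Set.VAddAntidiagonal.finite_of_isPWO x.isPWO_support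
        ((HahnModule.of ℂ).symm y).isPWO_support a),
      x.coeff ij.1 • innerCoeff ij.2 y := HahnModule.coeff_smul x y a
  have hsub : (fun s => x.coeff s • innerCoeff (a - s) y).support ⊆
      ((Finset.VAddAntidiagonal a
      (Set.VAddAntidiagonal.finite_of_isPWO x.isPWO_support
        ((HahnModule.of ℂ).symm y).isPWO_support a)).image Prod.fst : Finset ℤ) := by
    intro s hs
    rw [Function.mem_support] at hs
    rw [Finset.mem_coe, Finset.mem_image]
    refine ⟨(s, a - s), ?_, rfl⟩
    rw [Finset.mem_vaddAntidiagonal]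
    refine ⟨fun h0 => hs ?_, fun h0 => hs ?_, by simp⟩
    · simp only at h0
      rw [h0, zero_smul]
    · have h0' : innerCoeff (a - s) y = 0 := h0
      rw [h0', smul_zero]
  refine ⟨(Finset.finite_toSet _).subset hsub, ?_⟩
  rw [finsum_eq_sum_of_support_subset _ hsub, h, Finset.sum_image]
  · refine Finset.sum_congr rfl fun ij hij => ?_
    rw [Finset.mem_vaddAntidiagonal] at hij
    rw [← hij.2.2, vadd_eq_add, add_sub_cancel_left]
  · intro i hi j hj hij
    rw [Finset.mem_coe, Finset.mem_vaddAntidiagonal] at hi hj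
    have h1 := hi.2.2
    have h2 := hj.2.2
    rw [vadd_eq_add] at h1 h2
    exact Prod.ext hij (by omega)

theorem outerCoeff_smul_aux (x : K2) (y : OuterMod W) (a : ℤ) :
    (fun s => x.coeff s • ((HahnModule.of LC).symm y).coeff (a - s)).support.Finite ∧
    ((HahnModule.of LC).symm (x • y)).coeff a =
      ∑ᶠ s : ℤ, x.coeff s • ((HahnModule.of LC).symm y).coeff (a - s) := by
  have h := HahnModule.coeff_smul x y a
  have hsub : (fun s => x.coeff s • ((HahnModule.of LC).symm y).coeff (a - s)).support ⊆
      ((Finset.VAddAntidiagonal a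
      (Set.VAddAntidiagonal.finite_of_isPWO x.isPWO_support
        ((HahnModule.of LC).symm y).isPWO_support a)).image Prod.fst : Finset ℤ) := by
    intro s hs
    rw [Function.mem_support] at hs
    rw [Finset.mem_coe, Finset.mem_image]
    refine ⟨(s, a - s), ?_, rfl⟩
    rw [Finset.mem_vaddAntidiagonal]
    refine ⟨fun h0 => hs ?_, fun h0 => hs ?_, by simp⟩
    · simp only at h0
      rw [h0]
      exact HahnModule.zero_smul'
    · simp only at h0
      rw [h0, smul_zero]
  refine ⟨(Finset.finite_toSet _).subset hsub, ?_⟩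
  rw [finsum_eq_sum_of_support_subset _ hsub, h, Finset.sum_image]
  · refine Finset.sum_congr rfl fun ij hij => ?_
    rw [Finset.mem_vaddAntidiagonal] at hij
    rw [← hij.2.2, vadd_eq_add, add_sub_cancel_left]
  · intro i hi j hj hij
    rw [Finset.mem_coe, Finset.mem_vaddAntidiagonal] at hi hj
    have h1 := hi.2.2
    have h2 := hj.2.2
    rw [vadd_eq_add] at h1 h2
    exact Prod.ext hij (by omega)

theorem outerCoeff_smul (x : K2) (y : OuterMod W) (J T : ℤ) :
    outerCoeff (x • y) ![J, T] =
      ∑ᶠ s : ℤ × ℤ, (x.coeff s.1).coeff s.2 • outerCoeff y ![J - s.1, T - s.2] := by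
  obtain ⟨hfin, h⟩ := outerCoeff_smul_aux x y J
  have h1 : outerCoeff (x • y) ![J, T] =
      innerCoeff T (((HahnModule.of LC).symm (x • y)).coeff J) := rfl
  rw [h1, h, AddMonoidHom.map_finsum _ hfin, finsum_curry]
  · exact finsum_congr fun s => (innerCoeff_smul _ _ _).2
  · refine (hfin.biUnion (t := fun s => (fun t => (s, t)) '' (fun t => (x.coeff s).coeff t •
        innerCoeff (T - t) (((HahnModule.of LC).symm y).coeff (J - s))).support)
      fun s _ => (innerCoeff_smul _ _ _).1.image _).subset ?_
    rintro ⟨s, t⟩ hst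
    rw [Function.mem_support] at hst
    rw [Set.mem_iUnion₂]
    refine ⟨s, fun h0 => hst ?_, t, hst, rfl⟩
    simp only at h0
    by_cases hx : x.coeff s = 0
    · simp [hx]
    · have : ((HahnModule.of LC).symm y).coeff (J - s) = 0 := by
        have h3 := congrArg (fun z => (x.coeff s)⁻¹ • z) h0
        simpa [inv_smul_smul₀ hx] using h3
      change (x.coeff s).coeff t •
        innerCoeff (T - t) (((HahnModule.of LC).symm y).coeff (J - s)) = 0
      rw [this, map_zero, smul_zero]

theorem outerCoeff_single_smul (i j : ℤ) (c : ℂ) (y : OuterMod W) (k : Fin 2 → ℤ) :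
    outerCoeff ((HahnSeries.single i (HahnSeries.single j c) : K2) • y) k =
      c • outerCoeff y ![k 0 - i, k 1 - j] := by
  have h1 := HahnModule.coeff_single_smul_vadd (R := LC) (x := y) (r := HahnSeries.single j c)
    (a := k 0 - i) (b := i)
  rw [vadd_eq_add, add_sub_cancel] at h1
  have h2 := HahnModule.coeff_single_smul_vadd (R := ℂ)
    (x := ((HahnModule.of LC).symm y).coeff (k 0 - i)) (r := c) (a := k 1 - j) (b := j)
  rw [vadd_eq_add, add_sub_cancel] at h2
  change innerCoeff (k 1) (((HahnModule.of LC).symm _).coeff (k 0)) = _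
  rw [h1]
  exact h2

theorem algebraMap_LC (c : ℂ) : algebraMap ℂ LC c = HahnSeries.single 0 c := by
  rw [HahnSeries.algebraMap_apply', PowerSeries.algebraMap_apply]
  exact HahnSeries.ofPowerSeries_C _

theorem qK_C (α c : ℂ) :
    qK (MvPolynomial.C c) α = (HahnSeries.single 0 (HahnSeries.single 0 c) : K2) := by
  refine (MvPolynomial.aeval_C (S₁ := K2) ![xOuter + xInnerC α, xInner] c).trans ?_
  refine (HahnSeries.algebraMap_apply' (Γ := ℤ) (R := LC) (S := ℂ) (x:=c)).trans ?_
  have : (algebraMap ℂ (PowerSeries LC)) c = PowerSeries.C (algebraMap ℂ LC c) := by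
    rw [PowerSeries.algebraMap_apply]
  rw [this, algebraMap_LC]
  exact HahnSeries.ofPowerSeries_C _

theorem outerCoeff_aeval_smul (α : ℂ) (p : MvPolynomial (Fin 2) ℂ) (y : OuterMod W) :
    outerCoeff (qK p α • y) = act (polySubst α 0 1 p) (outerCoeff y) := by
  have hX0 : ∀ (F : Fam (Fin 2) W) (k : Fin 2 → ℤ),
      act (MvPolynomial.X 0) F k = F ![k 0 - 1, k 1 - 0] := by
    intro F k
    rw [act_X]
    congr 1
    funext x
    fin_cases x <;> simp
  have hX1 : ∀ (F : Fam (Fin 2) W) (k : Fin 2 → ℤ),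
      act (MvPolynomial.X 1) F k = F ![k 0 - 0, k 1 - 1] := by
    intro F k
    rw [act_X]
    congr 1
    funext x
    fin_cases x <;> simp
  have hC : ∀ (c : ℂ) (y : OuterMod W),
      outerCoeff ((HahnSeries.single 0 (HahnSeries.single 0 c) : K2) • y) = c • outerCoeff y := by
    intro c y
    funext k
    rw [outerCoeff_single_smul, Pi.smul_apply]
    congr 2
    have : (![k 0 - 0, k 1 - 0] : Fin 2 → ℤ) = k := by
      funext x
      fin_cases x <;> simp
    rw [this]
  have hO : ∀ y : OuterMod W, outerCoeff (xOuter • y) = act (MvPolynomial.X 0) (outerCoeff y) := by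
    intro y
    funext k
    have : xOuter = HahnSeries.single 1 (HahnSeries.single 0 1) := rfl
    rw [this, outerCoeff_single_smul, hX0, one_smul]
  have hI : ∀ (c : ℂ) (y : OuterMod W), outerCoeff (xInnerC c • y) =
      act (MvPolynomial.C c * MvPolynomial.X 1) (outerCoeff y) := by
    intro c y
    funext k
    rw [xInnerC, outerCoeff_single_smul, act_mul, act_C, Pi.smul_apply, hX1]
  induction p using MvPolynomial.induction_on generalizing y with
  | C c =>
    have h2 : polySubst α (0 : Fin 2) 1 (MvPolynomial.C c) = MvPolynomial.C c :=
      (polySubst α 0 1).commutes c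
    rw [qK_C, hC, h2, act_C]
  | add p q hp hq =>
    have : qK (p + q) α = qK p α + qK q α := map_add _ _ _
    rw [this, outer_add_smul, map_add, hp, hq, map_add, map_add, LinearMap.add_apply]
  | mul_X p v hp =>
    have : qK (p * MvPolynomial.X v) α = qK p α * qK (MvPolynomial.X v) α := map_mul _ _ _
    rw [this, outer_mul_smul, hp, map_mul, act_mul]
    congr 1
    fin_cases v
    · have : qK (MvPolynomial.X 0) α = xOuter + xInnerC α := by simp [qK]
      simp only [Fin.zero_eta]
      rw [this, outer_add_smul, map_add, hO, hI, polySubst_X_self, map_add, LinearMap.add_apply]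
    · have : qK (MvPolynomial.X 1) α = xInnerC 1 := by simp [qK]; rfl
      simp only [Fin.mk_one]
      rw [this, hI, polySubst_X_of_ne _ _ (by decide), map_one, one_mul]

variable (W) in
/-- Families that come from `W((x))((x₀))`. -/
def IterLau : Submodule ℂ (Fam (Fin 2) W) where
  carrier := {F | (∃ N : ℤ, ∀ k : Fin 2 → ℤ, k 0 < N → F k = 0) ∧
    ∀ j : ℤ, ∃ M : ℤ, ∀ k : Fin 2 → ℤ, k 0 = j → k 1 < M → F k = 0}
  add_mem' := by
    rintro F G ⟨⟨N, hN⟩, hF⟩ ⟨⟨N', hN'⟩, hG⟩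
    refine ⟨⟨min N N', fun k hk => ?_⟩, fun j => ?_⟩
    · rw [Pi.add_apply, hN k (by omega), hN' k (by omega), add_zero]
    · obtain ⟨M, hM⟩ := hF j
      obtain ⟨M', hM'⟩ := hG j
      exact ⟨min M M', fun k hk hk' => by
        rw [Pi.add_apply, hM k hk (by omega), hM' k hk (by omega), add_zero]⟩
  zero_mem' := ⟨⟨0, fun _ _ => rfl⟩, fun _ => ⟨0, fun _ _ _ => rfl⟩⟩
  smul_mem' := by
    rintro c F ⟨⟨N, hN⟩, hF⟩
    refine ⟨⟨N, fun k hk => ?_⟩, fun j => ?_⟩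
    · rw [Pi.smul_apply, hN k hk, smul_zero]
    · obtain ⟨M, hM⟩ := hF j
      exact ⟨M, fun k hk hk' => by rw [Pi.smul_apply, hM k hk hk', smul_zero]⟩

theorem exists_outerCoeff_eq {F : Fam (Fin 2) W} (hF : F ∈ IterLau W) :
    ∃ y : OuterMod W, outerCoeff y = F := by
  obtain ⟨⟨N, hN⟩, hF⟩ := hF
  have pwo : ∀ (N : ℤ) (s : Set ℤ), (∀ x ∈ s, N ≤ x) → s.IsPWO := fun N s h =>
    (BddBelow.isWF ⟨N, h⟩).isPWO
  let g : ℤ → InnerMod W := fun j => HahnModule.of ℂ ⟨fun t => F ![j, t], by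
    obtain ⟨M, hM⟩ := hF j
    refine pwo M _ fun t ht => ?_
    by_contra hc
    exact ht (hM _ rfl (by simpa using hc))⟩
  refine ⟨HahnModule.of LC ⟨g, ?_⟩, ?_⟩
  · refine pwo N _ fun j hj => ?_
    by_contra hc
    refine hj ?_
    apply HahnModule.ext
    funext t
    exact hN _ (by simpa using hc)
  · funext k
    change F ![k 0, k 1] = F k
    congr 1
    funext x
    fin_cases x <;> rfl

theorem outerCoeff_injective : Function.Injective (outerCoeff (W := W)) := by
  intro x y h
  apply HahnModule.ext
  funext j
  apply HahnModule.ext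
  funext t
  exact congrFun h ![j, t]

theorem outerCoeff_mem (y : OuterMod W) : outerCoeff y ∈ IterLau W := by
  refine ⟨⟨((HahnModule.of LC).symm y).order, fun k hk => ?_⟩, fun j =>
    ⟨((HahnModule.of ℂ).symm (((HahnModule.of LC).symm y).coeff j)).order, fun k hk hk' => ?_⟩⟩
  · change innerCoeff (k 1) (((HahnModule.of LC).symm y).coeff (k 0)) = 0
    rw [HahnSeries.coeff_eq_zero_of_lt_order hk, map_zero]
  · change ((HahnModule.of ℂ).symm (((HahnModule.of LC).symm y).coeff (k 0))).coeff (k 1) = 0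
    subst hk
    exact HahnSeries.coeff_eq_zero_of_lt_order hk'

theorem qK_ne_zero (α : ℂ) {p : MvPolynomial (Fin 2) ℂ} (hp : p ≠ 0) : qK p α ≠ 0 := by
  intro h0
  have hQ : polySubst α 0 1 p ≠ 0 := by
    rw [Ne, ← map_zero (polySubst α (0 : Fin 2) 1)]
    exact fun h => hp (polySubst_injective α (by decide) h)
  obtain ⟨y, hy⟩ := exists_outerCoeff_eq (W := ℂ) (F := fun k => if k = 0 then 1 else 0)
    ⟨⟨0, fun k hk => if_neg fun h => by simp [h] at hk⟩,
      fun j => ⟨0, fun k _ hk => if_neg fun h => by simp [h] at hk⟩⟩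
  have h1 := outerCoeff_aeval_smul α p y
  rw [h0, outer_zero_smul, map_zero, hy] at h1
  obtain ⟨d, hd⟩ := MvPolynomial.ne_zero_iff.1 hQ
  apply hd
  have h2 := congrFun h1 (fun v => (d v : ℤ))
  rw [act_apply, Finset.sum_eq_single d] at h2
  · rw [if_pos (by funext v; simp)] at h2
    simpa using h2.symm
  · intro e _ hed
    rw [if_neg, smul_zero]
    intro h
    apply hed
    ext v
    have := congrFun h v
    simp only [Pi.zero_apply] at this
    omega
  · intro h
    rw [MvPolynomial.notMem_support_iff.1 h, zero_smul]

theorem act_mem_IterLau (α : ℂ) (p : MvPolynomial (Fin 2) ℂ) {F : Fam (Fin 2) W}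
    (hF : F ∈ IterLau W) : act (polySubst α 0 1 p) F ∈ IterLau W := by
  obtain ⟨y, rfl⟩ := exists_outerCoeff_eq hF
  rw [← outerCoeff_aeval_smul]
  exact outerCoeff_mem _

theorem act_polySubst_injOn (α : ℂ) {p : MvPolynomial (Fin 2) ℂ} (hp : p ≠ 0)
    {F G : Fam (Fin 2) W} (hF : F ∈ IterLau W) (hG : G ∈ IterLau W)
    (h : act (polySubst α 0 1 p) F = act (polySubst α 0 1 p) G) : F = G := by
  obtain ⟨x, rfl⟩ := exists_outerCoeff_eq hF
  obtain ⟨y, rfl⟩ := exists_outerCoeff_eq hG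
  rw [← outerCoeff_aeval_smul, ← outerCoeff_aeval_smul] at h
  have h1 := congrArg (fun z => (qK p α)⁻¹ • z) (outerCoeff_injective h)
  simp only [← outer_mul_smul, K2_inv_mul_cancel (qK_ne_zero α hp), outer_one_smul] at h1
  rw [h1]

theorem subst_mem_IterLau (α : ℂ) {F : Fam (Fin 2) W} (hF : F ∈ Lau (Fin 2) W) :
    subst (kerIn α) 0 1 F ∈ IterLau W := by
  refine ⟨⟨0, fun k hk => subst_kerIn_of_neg α F hk⟩, fun j => ?_⟩
  obtain ⟨N, hN⟩ := hF
  refine ⟨N + N - j, fun k hk hk' => ?_⟩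
  rw [subst]
  refine finsum_eq_zero_of_forall_eq_zero fun m => ?_
  rw [hN, smul_zero]
  by_cases hm : m < N
  · exact ⟨0, by simpa [slide] using hm⟩
  · refine ⟨1, ?_⟩
    simp only [slide, one_ne_zero, if_false, if_true]
    omega

end TwoVariables

/-! ### The products `a(x)_{(α,n)} b(x)` -/

section Products

variable {W : Type*} [AddCommGroup W] [Module ℂ W]

theorem mf_add (a b : EW W) (w : W) (n : ℤ) : mf (a + b) w n = mf a w n + mf b w n := rfl

theorem mf_smul (c : ℂ) (a : EW W) (w : W) (n : ℤ) : mf (c • a) w n = c • mf a w n := rfl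

theorem mf_zero (w : W) (n : ℤ) : mf (0 : EW W) w n = 0 := rfl

theorem mf_add_right (a : EW W) (w w' : W) (n : ℤ) :
    mf a (w + w') n = mf a w n + mf a w' n := by
  simp [mf]

theorem mf_smul_right (a : EW W) (c : ℂ) (w : W) (n : ℤ) :
    mf a (c • w) n = c • mf a w n := by
  simp [mf]

theorem mf_zero_right (a : EW W) (n : ℤ) : mf a 0 n = 0 := by
  simp [mf]

theorem mf_ext {a b : EW W} (h : ∀ w n, mf a w n = mf b w n) : a = b :=
  Subtype.ext (LinearMap.ext fun w => funext fun n => h w n)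

theorem mf_oneE (w : W) (n : ℤ) : mf oneE w n = if n = -1 then w else 0 := rfl

/-- The coefficients of `a(x₁) b(x₂) w`. -/
def prodF (a b : EW W) (w : W) : Fam (Fin 2) W := fun k => Fab a b w (k 0) (k 1)

/-- The coefficients of `∑_j c_j(x) w x₀^j`. -/
def genF (c : ℤ → EW W) (w : W) : Fam (Fin 2) W := fun k => mf (c (k 0)) w (-(k 1) - 1)

/-- The polynomial `p` makes `p(x₁,x₂)a(x₁)b(x₂)` jointly lower truncated. -/
def Clears (p : MvPolynomial (Fin 2) ℂ) (a b : EW W) : Prop :=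
  ∀ w, act p (prodF a b w) ∈ Lau (Fin 2) W

theorem act_prodF (p : MvPolynomial (Fin 2) ℂ) (a b : EW W) (w : W) (k : Fin 2 → ℤ) :
    act p (prodF a b w) k = mulPoly p (Fab a b w) (k 0) (k 1) := by
  rw [act_apply]
  rfl

theorem clears_iff {p : MvPolynomial (Fin 2) ℂ} {a b : EW W} :
    Clears p a b ↔ ∀ w, IsLaurent2 (mulPoly p (Fab a b w)) := by
  refine forall_congr' fun w => ?_
  constructor
  · rintro ⟨N, hN⟩
    refine ⟨N, fun m t h => ?_⟩
    rw [← hN ![m, t] (h.elim (fun h => ⟨0, h⟩) fun h => ⟨1, h⟩), act_prodF]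
    rfl
  · rintro ⟨N, hN⟩
    refine ⟨N, fun k ⟨i, hi⟩ => ?_⟩
    rw [act_prodF]
    refine hN _ _ ?_
    fin_cases i
    · exact Or.inl hi
    · exact Or.inr hi

theorem qcPair_iff {a b : EW W} : QCPair a b ↔ ∃ p, p ≠ 0 ∧ Clears p a b := by
  simp only [QCPair, clears_iff]

theorem Clears.mul_left {p : MvPolynomial (Fin 2) ℂ} {a b : EW W} (h : Clears p a b)
    (q : MvPolynomial (Fin 2) ℂ) : Clears (q * p) a b := fun w => by
  rw [act_mul]
  exact act_mem_Lau _ (h w)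

theorem prodF_add_right (a b : EW W) (w w' : W) :
    prodF a b (w + w') = prodF a b w + prodF a b w' := by
  funext k
  simp only [prodF, Fab, mf_add_right, Pi.add_apply]

theorem prodF_smul_right (a b : EW W) (c : ℂ) (w : W) :
    prodF a b (c • w) = c • prodF a b w := by
  funext k
  simp only [prodF, Fab, mf_smul_right, Pi.smul_apply]

theorem prodF_add_fst (a a' b : EW W) (w : W) :
    prodF (a + a') b w = prodF a b w + prodF a' b w := rfl

theorem prodF_smul_fst (c : ℂ) (a b : EW W) (w : W) : prodF (c • a) b w = c • prodF a b w := rfl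

theorem prodF_add_snd (a b b' : EW W) (w : W) :
    prodF a (b + b') w = prodF a b w + prodF a b' w := by
  funext k
  simp only [prodF, Fab, mf_add, mf_add_right, Pi.add_apply]

theorem prodF_smul_snd (c : ℂ) (a b : EW W) (w : W) : prodF a (c • b) w = c • prodF a b w := by
  funext k
  simp only [prodF, Fab, mf_smul, mf_smul_right, Pi.smul_apply]

theorem genF_mem_IterLau {c : ℤ → EW W} (hc : ∃ N : ℤ, ∀ j < N, c j = 0) (w : W) :
    genF c w ∈ IterLau W := by
  obtain ⟨N, hN⟩ := hc
  refine ⟨⟨N, fun k hk => ?_⟩, fun j => ?_⟩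
  · rw [genF, hN _ hk, mf_zero]
  · obtain ⟨M, hM⟩ := (c j).2 w
    refine ⟨-M, fun k hk hk' => ?_⟩
    subst hk
    exact hM _ (by omega)

theorem genF_injective {c c' : ℤ → EW W} (h : ∀ w, genF c w = genF c' w) : c = c' := by
  funext j
  refine mf_ext fun w n => ?_
  have := congrFun (h w) ![j, -n - 1]
  simpa [genF] using this

/-- The expansion of `(p(x₁,x)a(x₁)b(x)w)|_{x₁ = αx + x₀}`. -/
def substF (α : ℂ) (p : MvPolynomial (Fin 2) ℂ) (a b : EW W) (w : W) : Fam (Fin 2) W :=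
  subst (kerIn α) 0 1 (act p (prodF a b w))

theorem substF_mem_IterLau (α : ℂ) {p : MvPolynomial (Fin 2) ℂ} {a b : EW W}
    (hp : Clears p a b) (w : W) : substF α p a b w ∈ IterLau W :=
  subst_mem_IterLau α (hp w)

theorem substF_mul {α : ℂ} (hα : α ≠ 0) (q : MvPolynomial (Fin 2) ℂ)
    {p : MvPolynomial (Fin 2) ℂ} {a b : EW W} (hp : Clears p a b) (w : W) :
    substF α (q * p) a b w = act (polySubst α 0 1 q) (substF α p a b w) := by
  rw [substF, act_mul]
  exact (act_mem_Adm (by decide) (kerIn_succ hα) q (Lau_le_Adm _ (by decide) (hp w))).2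

theorem substYE_eq (α : ℂ) (p : MvPolynomial (Fin 2) ℂ) (a b : EW W) (w : W) (j : ℕ) (t : ℤ) :
    substYE α p a b w j t = substF α p a b w ![(j : ℤ), t] := by
  refine finsum_congr fun m => ?_
  rw [act_prodF]
  have h1 : slide (0 : Fin 2) 1 ![(j : ℤ), t] m 0 = m := by simp [slide]
  have h2 : slide (0 : Fin 2) 1 ![(j : ℤ), t] m 1 = t + j - m := by simp [slide]
  have h3 : t - m + (j : ℤ) = t + j - m := by ring
  rw [h1, h2, h3]
  simp [kerIn]

theorem fullYE_eq (α : ℂ) {p : MvPolynomial (Fin 2) ℂ} {a b : EW W} {w : W} {y : OuterMod W}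
    (hy : outerCoeff y = substF α p a b w) (J T : ℤ) :
    fullYE α p a b w J T = outerCoeff (qInv p α • y) ![J, T] := by
  rw [outerCoeff_smul, fullYE]
  refine finsum_congr fun s => ?_
  congr 1
  rw [hy]
  split_ifs with h
  · rw [substYE_eq, Int.toNat_of_nonneg h]
  · rw [substF, subst_kerIn_of_neg]
    exact not_le.1 h

theorem act_outerCoeff_qInv (α : ℂ) {p : MvPolynomial (Fin 2) ℂ} (hp : p ≠ 0) (y : OuterMod W) :
    act (polySubst α 0 1 p) (outerCoeff (qInv p α • y)) = outerCoeff y := by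
  rw [← outerCoeff_aeval_smul, ← outer_mul_smul]
  have : qK p α * qInv p α = 1 := @mul_inv_cancel₀ K2 _ _ (qK_ne_zero α hp)
  rw [this, outer_one_smul]

theorem exists_fullYE (α : ℂ) {p : MvPolynomial (Fin 2) ℂ} (hp : p ≠ 0) {a b : EW W}
    (hab : Clears p a b) : ∃ c : ℤ → EW W, (∃ N : ℤ, ∀ j < N, c j = 0) ∧
      (∀ w, act (polySubst α 0 1 p) (genF c w) = substF α p a b w) ∧
      ∀ j w m, mf (c j) w m = fullYE α p a b w j (-m - 1) := by
  choose y hy using fun w => exists_outerCoeff_eq (substF_mem_IterLau α hab w)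
  let A : W → Fam (Fin 2) W := fun w => outerCoeff (qInv p α • y w)
  have hA : ∀ w, A w ∈ IterLau W := fun w => outerCoeff_mem _
  have hS : ∀ w, act (polySubst α 0 1 p) (A w) = substF α p a b w := fun w => by
    rw [act_outerCoeff_qInv α hp, hy]
  have hadd : ∀ w w', A (w + w') = A w + A w' := fun w w' => by
    refine act_polySubst_injOn α hp (hA _) (add_mem (hA _) (hA _)) ?_
    rw [map_add, hS, hS, hS, substF, prodF_add_right, map_add]
    exact subst_add (Lau_le_Adm _ (by decide) (hab w)) (Lau_le_Adm _ (by decide) (hab w'))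
  have hsmul : ∀ (c : ℂ) w, A (c • w) = c • A w := fun c w => by
    refine act_polySubst_injOn α hp (hA _) (Submodule.smul_mem _ _ (hA _)) ?_
    rw [map_smul, hS, hS, substF, prodF_smul_right, map_smul]
    exact subst_smul _ _
  let c : ℤ → EW W := fun j =>
    ⟨{ toFun := fun w m => A w ![j, -m - 1]
       map_add' := fun w w' => by funext m; rw [hadd]; rfl
       map_smul' := fun c w => by funext m; rw [hsmul]; rfl }, fun w => by
        obtain ⟨M, hM⟩ := (hA w).2 j
        exact ⟨-M, fun n hn => hM _ rfl (by simp; omega)⟩⟩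
  have hc : ∀ w, genF c w = A w := fun w => by
    funext k
    change A w ![k 0, -(-(k 1) - 1) - 1] = A w k
    congr 1
    funext x
    fin_cases x
    · rfl
    · simp
  refine ⟨c, ⟨HahnSeries.order (qInv p α), fun j hj => mf_ext fun w m => ?_⟩,
    fun w => by rw [hc, hS], fun j w m => ?_⟩
  · change A w ![j, -m - 1] = 0
    simp only [A]
    rw [outerCoeff_smul]
    refine finsum_eq_zero_of_forall_eq_zero fun s => ?_
    rcases lt_or_ge s.1 (HahnSeries.order (qInv p α)) with h | h
    · rw [HahnSeries.coeff_eq_zero_of_lt_order h, HahnSeries.coeff_zero, zero_smul]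
    · rw [hy, substF, subst_kerIn_of_neg, smul_zero]
      simp only [Matrix.cons_val_zero]
      omega
  · rw [fullYE_eq α (hy w)]
    rfl

theorem YEa_spec (α : ℂˣ) {a b : EW W} (h : QCPair a b) :
    (∃ N : ℤ, ∀ j < N, YEa α a b (-j - 1) = 0) ∧ ∀ p, Clears p a b → ∀ w,
      act (polySubst (α : ℂ) 0 1 p) (genF (fun j => YEa α a b (-j - 1)) w) =
        substF (α : ℂ) p a b w := by
  obtain ⟨c, hN, hc, hcf⟩ := exists_fullYE (α : ℂ) h.choose_spec.1
    (clears_iff.2 h.choose_spec.2)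
  have hYE : ∀ j, YEa α a b (-j - 1) = c j := fun j => by
    have hex : ∃ e : EW W, ∀ w m, mf e w m = rawYE (α : ℂ) a b (-j - 1) w m :=
      ⟨c j, fun w m => by
        rw [rawYE, dif_pos h, hcf]
        congr 1
        ring⟩
    rw [YEa, dif_pos hex]
    refine mf_ext fun w m => ?_
    rw [hex.choose_spec, rawYE, dif_pos h, hcf]
    congr 1
    ring
  simp only [hYE]
  refine ⟨hN, fun p hp w => ?_⟩
  refine act_polySubst_injOn (α : ℂ) h.choose_spec.1
    (act_mem_IterLau _ _ (genF_mem_IterLau hN w)) (substF_mem_IterLau _ hp w) ?_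
  rw [act_comm, hc, ← substF_mul α.ne_zero _ hp, mul_comm,
    substF_mul α.ne_zero _ (clears_iff.2 h.choose_spec.2)]

theorem YEa_eq (α : ℂˣ) {a b : EW W} {p : MvPolynomial (Fin 2) ℂ} (hp : p ≠ 0)
    (hab : Clears p a b) {c : ℤ → EW W} (hc : ∃ N : ℤ, ∀ j < N, c j = 0)
    (h : ∀ w, act (polySubst (α : ℂ) 0 1 p) (genF c w) = substF (α : ℂ) p a b w) (j : ℤ) :
    YEa α a b (-j - 1) = c j := by
  have hs := YEa_spec α (qcPair_iff.2 ⟨p, hp, hab⟩)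
  refine congrFun (genF_injective fun w => ?_ : (fun j => YEa α a b (-j - 1)) = c) j
  refine act_polySubst_injOn (α : ℂ) hp (genF_mem_IterLau hs.1 w) (genF_mem_IterLau hc w) ?_
  rw [hs.2 p hab, h]

end Products

section Bilinear

variable {W : Type*} [AddCommGroup W] [Module ℂ W]

theorem YEa_add_of_prodF (α : ℂˣ) {a b a' b' a'' b'' : EW W} (h : QCPair a b)
    (h' : QCPair a' b') (hF : ∀ w, prodF a'' b'' w = prodF a b w + prodF a' b' w) (n : ℤ) :
    YEa α a'' b'' n = YEa α a b n + YEa α a' b' n := by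
  obtain ⟨⟨N, hN⟩, hs⟩ := YEa_spec α h
  obtain ⟨⟨N', hN'⟩, hs'⟩ := YEa_spec α h'
  obtain ⟨p, hp0, hp⟩ := qcPair_iff.1 h
  obtain ⟨q, hq0, hq⟩ := qcPair_iff.1 h'
  have h1 : Clears (p * q) a b := mul_comm q p ▸ hp.mul_left q
  have h2 : Clears (p * q) a' b' := hq.mul_left p
  have key := YEa_eq α (a := a'') (b := b'') (mul_ne_zero hp0 hq0)
    (fun w => by rw [hF, map_add]; exact add_mem (h1 w) (h2 w))
    (c := fun j => YEa α a b (-j - 1) + YEa α a' b' (-j - 1))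
    ⟨min N N', fun j hj => by simp only [hN j (by omega), hN' j (by omega), add_zero]⟩
    (fun w => by
      have : genF (fun j => YEa α a b (-j - 1) + YEa α a' b' (-j - 1)) w =
        genF (fun j => YEa α a b (-j - 1)) w + genF (fun j => YEa α a' b' (-j - 1)) w := rfl
      rw [this, map_add, hs _ h1, hs' _ h2, substF, substF, substF, hF, map_add]
      exact (subst_add (Lau_le_Adm _ (by decide) (h1 w)) (Lau_le_Adm _ (by decide) (h2 w))).symm)
    (-n - 1)
  have hn : -(-n - 1) - 1 = n := by ring
  simpa only [hn] using key

theorem YEa_smul_of_prodF (α : ℂˣ) {a b a' b' : EW W} (r : ℂ) (h : QCPair a b)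
    (hF : ∀ w, prodF a' b' w = r • prodF a b w) (n : ℤ) :
    YEa α a' b' n = r • YEa α a b n := by
  obtain ⟨⟨N, hN⟩, hs⟩ := YEa_spec α h
  obtain ⟨p, hp0, hp⟩ := qcPair_iff.1 h
  have key := YEa_eq α (a := a') (b := b') hp0
    (fun w => by rw [hF, map_smul]; exact Submodule.smul_mem _ _ (hp w))
    (c := fun j => r • YEa α a b (-j - 1))
    ⟨N, fun j hj => by simp only [hN j hj, smul_zero]⟩
    (fun w => by
      have : genF (fun j => r • YEa α a b (-j - 1)) w =
        r • genF (fun j => YEa α a b (-j - 1)) w := rfl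
      rw [this, map_smul, hs _ hp, substF, substF, hF, map_smul]
      exact (subst_smul _ _).symm)
    (-n - 1)
  have hn : -(-n - 1) - 1 = n := by ring
  simpa only [hn] using key

/-- The coefficient of `x₀^j` in `a(αx + x₀)`. -/
def taylorE (α : ℂ) (a : EW W) (j : ℤ) : EW W :=
  ⟨{ toFun := fun w n => kerIn α (j - n - 1) j • mf a w (n - j)
     map_add' := fun w w' => by funext n; simp [mf_add_right]
     map_smul' := fun c w => by
      funext n
      simp only [mf_smul_right, Pi.smul_apply, RingHom.id_apply]
      exact smul_comm _ _ _ }, fun w => by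
    obtain ⟨N, hN⟩ := a.2 w
    refine ⟨N + j, fun n hn => ?_⟩
    change kerIn α (j - n - 1) j • mf a w (n - j) = 0
    rw [mf, hN _ (by omega), smul_zero]⟩

theorem taylorE_of_neg (α : ℂ) (a : EW W) {j : ℤ} (hj : j < 0) : taylorE α a j = 0 :=
  mf_ext fun w n => by
    change kerIn α (j - n - 1) j • mf a w (n - j) = 0
    rw [kerIn_of_neg _ _ hj, zero_smul]

theorem taylorE_zero (α : ℂˣ) (a : EW W) : taylorE (α : ℂ) a 0 = RaE α a :=
  mf_ext fun w n => by
    change kerIn (α : ℂ) (0 - n - 1) 0 • mf a w (n - 0) = (α : ℂ) ^ (-n - 1) • mf a w n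
    rw [kerIn_zero, zero_sub, sub_zero]

theorem RaE_one (a : EW W) : RaE 1 a = a :=
  mf_ext fun w n => by
    change ((1 : ℂˣ) : ℂ) ^ (-n - 1) • mf a w n = mf a w n
    rw [Units.val_one, one_zpow, one_smul]

theorem prodF_oneE_right (a : EW W) (w : W) (k : Fin 2 → ℤ) :
    prodF a oneE w k = if k 1 = 0 then mf a w (-(k 0) - 1) else 0 := by
  rw [prodF, Fab, mf_oneE]
  split_ifs with h1 h2 h2
  · rfl
  · omega
  · omega
  · exact mf_zero_right _ _

theorem prodF_oneE_left (b : EW W) (w : W) (k : Fin 2 → ℤ) :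
    prodF oneE b w k = if k 0 = 0 then mf b w (-(k 1) - 1) else 0 := by
  rw [prodF, Fab, mf_oneE]
  split_ifs with h1 h2 h2
  · rfl
  · omega
  · omega
  · rfl

theorem clears_one_oneE_right (a : EW W) : Clears 1 a oneE := fun w => by
  rw [map_one, Module.End.one_apply]
  obtain ⟨N, hN⟩ := a.2 w
  refine ⟨min 0 (-N), fun k ⟨i, hi⟩ => ?_⟩
  rw [prodF_oneE_right]
  fin_cases i
  · simp only [Fin.zero_eta] at hi
    rw [mf, hN _ (by omega), ite_self]
  · simp only [Fin.mk_one] at hi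
    rw [if_neg (by omega)]

theorem clears_one_oneE_left (b : EW W) : Clears 1 oneE b := fun w => by
  rw [map_one, Module.End.one_apply]
  obtain ⟨N, hN⟩ := b.2 w
  refine ⟨min 0 (-N), fun k ⟨i, hi⟩ => ?_⟩
  rw [prodF_oneE_left]
  fin_cases i
  · simp only [Fin.zero_eta] at hi
    rw [if_neg (by omega)]
  · simp only [Fin.mk_one] at hi
    rw [mf, hN _ (by omega), ite_self]

theorem YEa_oneE_right (α : ℂˣ) (a : EW W) (j : ℤ) :
    YEa α a oneE (-j - 1) = taylorE (α : ℂ) a j := by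
  refine YEa_eq α one_ne_zero (clears_one_oneE_right a)
    ⟨0, fun j hj => taylorE_of_neg _ _ hj⟩ (fun w => ?_) j
  rw [map_one, map_one, Module.End.one_apply]
  funext k
  rw [substF, map_one, Module.End.one_apply, subst, finsum_eq_single _ (k 0 + k 1)]
  · rw [prodF_oneE_right, if_pos (by simp [slide]; ring)]
    change kerIn (α : ℂ) (k 0 - (-(k 1) - 1) - 1) (k 0) • mf a w (-(k 1) - 1 - k 0) = _
    congr 2
    · ring
    · simp [slide]; ring
  · intro m hm
    rw [prodF_oneE_right, if_neg (by simp [slide]; omega), smul_zero]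

theorem YEa_oneE_left (α : ℂˣ) (b : EW W) (j : ℤ) :
    YEa α oneE b (-j - 1) = if j = 0 then b else 0 := by
  refine YEa_eq α one_ne_zero (clears_one_oneE_left b) (c := fun j => if j = 0 then b else 0)
    ⟨0, fun j hj => if_neg (by omega)⟩ (fun w => ?_) j
  rw [map_one, map_one, Module.End.one_apply]
  funext k
  rw [substF, map_one, Module.End.one_apply, subst, finsum_eq_single _ 0]
  · rw [prodF_oneE_left, if_pos (by simp [slide]), genF]
    by_cases h : k 0 = 0
    · rw [if_pos h, h, kerIn_zero]
      simp [slide, h]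
    · rw [if_neg h, mf_zero]
      have : kerIn (α : ℂ) 0 (k 0) = 0 := by
        rw [kerIn]
        split_ifs with h0
        · have h2 := binom_eq_zero (m := 0) (j := (k 0).toNat) (by omega)
          rw [Nat.cast_zero] at h2
          rw [h2, zero_mul]
        · rfl
      rw [this, zero_smul]
  · intro m hm
    rw [prodF_oneE_left, if_neg (by simp [slide]; omega), smul_zero]

end Bilinear

/-! ### Products of two-variable polynomials -/

section Good

/-- The multiplicative monoid of products of nonzero polynomials in two of the variables. -/
def Good (σ : Type*) : Submonoid (MvPolynomial σ ℂ) :=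
  Submonoid.closure {P | ∃ (i j : σ) (p : MvPolynomial (Fin 2) ℂ), i ≠ j ∧ p ≠ 0 ∧
    P = MvPolynomial.rename ![i, j] p}

variable {σ τ : Type*}

theorem vecPair_injective {i j : σ} (h : i ≠ j) : Function.Injective ![i, j] := by
  intro x y hxy
  fin_cases x <;> fin_cases y <;> simp_all

theorem rename_mem_good {i j : σ} (h : i ≠ j) {p : MvPolynomial (Fin 2) ℂ} (hp : p ≠ 0) :
    MvPolynomial.rename ![i, j] p ∈ Good σ :=
  Submonoid.subset_closure ⟨i, j, p, h, hp, rfl⟩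

theorem ne_zero_of_mem_good {P : MvPolynomial σ ℂ} (h : P ∈ Good σ) : P ≠ 0 := by
  induction h using Submonoid.closure_induction with
  | mem P hP =>
    obtain ⟨i, j, p, hij, hp, rfl⟩ := hP
    rw [Ne, ← map_zero (MvPolynomial.rename ![i, j])]
    exact fun h0 => hp (MvPolynomial.rename_injective _ (vecPair_injective hij) h0)
  | one => exact one_ne_zero
  | mul P Q _ _ hP hQ => exact mul_ne_zero hP hQ

theorem rename_mem_good_of_mem {e : σ → τ} (he : Function.Injective e) {P : MvPolynomial σ ℂ}
    (h : P ∈ Good σ) : MvPolynomial.rename e P ∈ Good τ := by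
  induction h using Submonoid.closure_induction with
  | mem P hP =>
    obtain ⟨i, j, p, hij, hp, rfl⟩ := hP
    rw [MvPolynomial.rename_rename]
    have : e ∘ ![i, j] = ![e i, e j] := by
      funext x
      fin_cases x <;> rfl
    rw [this]
    exact rename_mem_good (he.ne hij) hp
  | one => rw [map_one]; exact one_mem _
  | mul P Q _ _ hP hQ => rw [map_mul]; exact mul_mem hP hQ

theorem pairPoly_mem_good {p : MvPolynomial (Fin 2) ℂ} (hp : p ≠ 0) (r : ℕ) :
    pairPoly p r ∈ Good (Fin r) :=
  prod_mem fun _ hij => rename_mem_good (Finset.mem_filter.1 hij).2.ne hp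

theorem rename_dvd_pairPoly (p : MvPolynomial (Fin 2) ℂ) {r : ℕ} {i j : Fin r} (h : i < j) :
    MvPolynomial.rename ![i, j] p ∣ pairPoly p r := by
  have hm : ((i, j) : Fin r × Fin r) ∈
      Finset.univ.filter (fun ij : Fin r × Fin r => ij.1 < ij.2) := by simp [h]
  rw [pairPoly, ← Finset.mul_prod_erase _ _ hm]
  exact dvd_mul_right _ _

theorem exists_dvd_pairPoly {r : ℕ} {P : MvPolynomial (Fin r) ℂ} (h : P ∈ Good (Fin r)) :
    ∃ p : MvPolynomial (Fin 2) ℂ, p ≠ 0 ∧ P ∣ pairPoly p r := by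
  induction h using Submonoid.closure_induction with
  | mem P hP =>
    obtain ⟨i, j, p, hij, hp, rfl⟩ := hP
    rcases lt_or_gt_of_ne hij with h | h
    · exact ⟨p, hp, rename_dvd_pairPoly p h⟩
    · refine ⟨MvPolynomial.rename ![1, 0] p, fun h0 => hp ?_, ?_⟩
      · rw [← map_zero (MvPolynomial.rename ![1, 0])] at h0
        exact MvPolynomial.rename_injective _ (vecPair_injective (by decide)) h0
      · have : MvPolynomial.rename ![i, j] p =
            MvPolynomial.rename ![j, i] (MvPolynomial.rename ![1, 0] p) := by
          rw [MvPolynomial.rename_rename]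
          congr 2
          funext x
          fin_cases x <;> rfl
        rw [this]
        exact rename_dvd_pairPoly _ h
  | one => exact ⟨1, one_ne_zero, one_dvd _⟩
  | mul P Q _ _ hP hQ =>
    obtain ⟨p, hp, hpP⟩ := hP
    obtain ⟨q, hq, hqQ⟩ := hQ
    refine ⟨p * q, mul_ne_zero hp hq, ?_⟩
    have : pairPoly (p * q) r = pairPoly p r * pairPoly q r := by
      simp only [pairPoly, map_mul, Finset.prod_mul_distrib]
    rw [this]
    exact mul_dvd_mul hpP hqQ

end Good

/-! ### Renaming variables -/

section Rename

variable {σ τ W W' : Type*} [AddCommGroup W] [Module ℂ W] [AddCommGroup W'] [Module ℂ W']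

theorem act_rename {e : σ → τ} (he : Function.Injective e) (P : MvPolynomial σ ℂ) (F : Fam τ W)
    (k : τ → ℤ) : act (MvPolynomial.rename e P) F k =
      act P (fun m => F (Function.extend e m k)) (k ∘ e) := by
  induction P using MvPolynomial.induction_on' with
  | monomial d c =>
    rw [MvPolynomial.rename_monomial, act_monomial, act_monomial]
    congr 2
    funext v
    by_cases hv : ∃ s, e s = v
    · obtain ⟨s, rfl⟩ := hv
      rw [he.extend_apply, Finsupp.mapDomain_apply he]
      rfl
    · rw [Function.extend_apply' _ _ _ hv, Finsupp.mapDomain_of_notMem_range _ _ hv]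
      simp
  | add P Q hP hQ =>
    rw [map_add, map_add, map_add, LinearMap.add_apply, LinearMap.add_apply, Pi.add_apply,
      Pi.add_apply, hP, hQ]

theorem act_rename_comp {e : σ → τ} (he : Function.Injective e) (P : MvPolynomial σ ℂ)
    (F : Fam σ W) (k : τ → ℤ) :
    act (MvPolynomial.rename e P) (fun k => F (k ∘ e)) k = act P F (k ∘ e) := by
  rw [act_rename he]
  have : ∀ m : σ → ℤ, Function.extend e m k ∘ e = m := fun m => funext (he.extend_apply _ _)
  simp only [this]

theorem act_map (L : W →ₗ[ℂ] W') (P : MvPolynomial σ ℂ) (F : Fam σ W) (k : σ → ℤ) :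
    act P (fun m => L (F m)) k = L (act P F k) := by
  rw [act_apply, act_apply, map_sum]
  simp only [map_smul]

end Rename

/-! ### Quasi compatible sequences and words -/

section Words

variable {σ τ W : Type*} [AddCommGroup W] [Module ℂ W]

theorem qcSeq_iff {r : ℕ} {ψ : Fin r → EW W} :
    QCSeq ψ ↔ ∃ P ∈ Good (Fin r), ∀ w, act P (seqCoeff ψ w) ∈ Lau (Fin r) W := by
  have key : ∀ (P : MvPolynomial (Fin r) ℂ) (w : W),
      act P (seqCoeff ψ w) ∈ Lau (Fin r) W ↔ IsLaurentN (mulPolyN P (seqCoeff ψ w)) := by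
    intro P w
    have : act P (seqCoeff ψ w) = mulPolyN P (seqCoeff ψ w) := funext fun k => act_apply _ _ _
    rw [this]
    rfl
  constructor
  · rintro ⟨p, hp, h⟩
    exact ⟨_, pairPoly_mem_good hp r, fun w => (key _ w).2 (h w)⟩
  · rintro ⟨P, hP, h⟩
    obtain ⟨p, hp, Q, hQ⟩ := exists_dvd_pairPoly hP
    refine ⟨p, hp, fun w => (key _ w).1 ?_⟩
    rw [hQ, mul_comm, act_mul]
    exact act_mem_Lau _ (h w)

/-- The coefficients of `a₁(x_{v₁}) ⋯ a_r(x_{v_r}) w`. -/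
def wordC : List (EW W × σ) → W → Fam σ W
  | [], w, _ => w
  | (a, v) :: l, w, k => mf a (wordC l w k) (-(k v) - 1)

theorem wordC_append (l l' : List (EW W × σ)) (w : W) (k : σ → ℤ) :
    wordC (l ++ l') w k = wordC l (wordC l' w k) k := by
  induction l with
  | nil => rfl
  | cons x l ih =>
    change mf _ (wordC (l ++ l') w k) _ = mf _ (wordC l (wordC l' w k) k) _
    rw [ih]

/-- The coefficients of a word as linear operators. -/
def wordL (l : List (EW W × σ)) (k : σ → ℤ) : W →ₗ[ℂ] W where
  toFun w := wordC l w k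
  map_add' w w' := by
    induction l with
    | nil => rfl
    | cons x l ih =>
      change mf _ (wordC l (w + w') k) _ = mf _ (wordC l w k) _ + mf _ (wordC l w' k) _
      rw [ih, mf_add_right]
  map_smul' c w := by
    induction l with
    | nil => rfl
    | cons x l ih =>
      change mf _ (wordC l (c • w) k) _ = c • mf _ (wordC l w k) _
      rw [ih, RingHom.id_apply, mf_smul_right]

theorem wordC_congr (l : List (EW W × σ)) (w : W) {k k' : σ → ℤ}
    (h : ∀ v ∈ l.map Prod.snd, k v = k' v) : wordC l w k = wordC l w k' := by
  induction l with
  | nil => rfl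
  | cons x l ih =>
    change mf _ (wordC l w k) (-(k x.2) - 1) = mf _ (wordC l w k') (-(k' x.2) - 1)
    rw [ih fun v hv => h v (by simp only [List.map_cons, List.mem_cons]; exact Or.inr hv),
      h x.2 (by simp)]

theorem wordC_map (e : σ → τ) (l : List (EW W × σ)) (w : W) (k : τ → ℤ) :
    wordC (l.map (Prod.map id e)) w k = wordC l w (k ∘ e) := by
  induction l with
  | nil => rfl
  | cons x l ih =>
    change mf _ (wordC (l.map (Prod.map id e)) w k) _ = mf _ (wordC l w (k ∘ e)) _
    rw [ih]
    rfl

theorem wordC_ofFn {r : ℕ} (ψ : Fin r → EW W) (e : Fin r → σ) (w : W) (k : σ → ℤ) :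
    wordC (List.ofFn fun i => (ψ i, e i)) w k = seqCoeff ψ w (k ∘ e) := by
  induction r with
  | zero => rfl
  | succ r ih =>
    rw [List.ofFn_succ]
    change mf (ψ 0) (wordC (List.ofFn fun i : Fin r => (Fin.tail ψ i, Fin.tail e i)) w k) _ = _
    rw [ih]
    rfl

/-- Quasi compatibility of a word. -/
def QCW (l : List (EW W × σ)) : Prop :=
  ∃ P ∈ Good σ, ∀ w, act P (wordC l w) ∈ Lau σ W

theorem qcSeq_iff_qcw {r : ℕ} (ψ : Fin r → EW W) (e : Fin r ≃ σ) :
    QCSeq ψ ↔ QCW (List.ofFn fun i => (ψ i, e i)) := by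
  have hw : ∀ w, wordC (List.ofFn fun i => (ψ i, e i)) w = fun k => seqCoeff ψ w (k ∘ e) :=
    fun w => funext fun k => wordC_ofFn _ _ _ _
  have key : ∀ (P : MvPolynomial (Fin r) ℂ) (w : W), act P (seqCoeff ψ w) ∈ Lau (Fin r) W ↔
      act (MvPolynomial.rename e P) (wordC (List.ofFn fun i => (ψ i, e i)) w) ∈ Lau σ W := by
    intro P w
    rw [hw]
    constructor
    · rintro ⟨N, hN⟩
      refine ⟨N, fun k ⟨i, hi⟩ => ?_⟩
      rw [act_rename_comp e.injective]
      exact hN _ ⟨e.symm i, by simpa using hi⟩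
    · rintro ⟨N, hN⟩
      refine ⟨N, fun k ⟨i, hi⟩ => ?_⟩
      have := hN (k ∘ e.symm) ⟨e i, by simpa using hi⟩
      rw [act_rename_comp e.injective] at this
      have hk : (k ∘ e.symm) ∘ e = k := funext fun i => by simp
      rwa [hk] at this
  rw [qcSeq_iff]
  constructor
  · rintro ⟨P, hP, h⟩
    exact ⟨_, rename_mem_good_of_mem e.injective hP, fun w => (key P w).1 (h w)⟩
  · rintro ⟨P, hP, h⟩
    refine ⟨_, rename_mem_good_of_mem e.symm.injective hP, fun w => (key _ w).2 ?_⟩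
    rw [MvPolynomial.rename_rename, Equiv.self_comp_symm, MvPolynomial.rename_id_apply]
    exact h w

/-- Quasi compatibility of a list in `ℰ(W)`. -/
def QCL (l : List (EW W)) : Prop := QCSeq l.get

theorem qcl_iff_qcw (l : List (EW W × σ)) (hnd : (l.map Prod.snd).Nodup)
    (hcov : ∀ v, v ∈ l.map Prod.snd) : QCL (l.map Prod.fst) ↔ QCW l := by
  have hl : ∀ i : Fin (l.map Prod.fst).length, (i : ℕ) < (l.map Prod.snd).length := fun i => by
    simpa using i.2
  let f : Fin (l.map Prod.fst).length → σ := fun i => (l.map Prod.snd)[(i : ℕ)]'(hl i)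
  have hf : Function.Bijective f := by
    constructor
    · intro i j hij
      exact Fin.ext ((hnd.getElem_inj_iff).1 hij)
    · intro v
      obtain ⟨i, hi, h⟩ := List.mem_iff_getElem.1 (hcov v)
      exact ⟨⟨i, by simpa using hi⟩, h⟩
  rw [QCL, qcSeq_iff_qcw _ (Equiv.ofBijective f hf)]
  have : (List.ofFn fun i => ((l.map Prod.fst).get i, Equiv.ofBijective f hf i)) = l := by
    refine List.ext_getElem (by simp) fun i h1 h2 => ?_
    simp [f]
  rw [this]

theorem qcl_ofFn {r : ℕ} (ψ : Fin r → EW W) : QCL (List.ofFn ψ) ↔ QCSeq ψ := by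
  rw [qcSeq_iff_qcw ψ (Equiv.refl _), ← qcl_iff_qcw]
  · simp [Function.comp_def]
  · rw [List.map_ofFn, List.nodup_ofFn]
    exact fun _ _ h => h
  · simp

theorem qcSet_iff {S : Set (EW W)} : QCSet S ↔ ∀ l : List (EW W), (∀ a ∈ l, a ∈ S) → QCL l := by
  constructor
  · intro h l hl
    exact h _ _ fun i => hl _ (l.get_mem i)
  · intro h r ψ hψ
    rw [← qcl_ofFn]
    refine h _ fun a ha => ?_
    obtain ⟨i, rfl⟩ := (List.mem_ofFn' _ _).1 ha
    exact hψ i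

theorem QCSet.qcPair {S : Set (EW W)} (h : QCSet S) {a b : EW W} (ha : a ∈ S) (hb : b ∈ S) :
    QCPair a b := by
  obtain ⟨P, hP, hw⟩ := qcSeq_iff.1 (h 2 ![a, b] fun i => by fin_cases i <;> assumption)
  refine qcPair_iff.2 ⟨P, ne_zero_of_mem_good hP, fun w => ?_⟩
  exact hw w

end Words

/-! ### Eliminating one variable -/

section Slices

variable {τ W : Type*} [AddCommGroup W] [Module ℂ W]

/-- The coefficient of `x_none^n`. -/
def slice (F : Fam (Option τ) W) (n : ℤ) : Fam τ W := fun k => F fun o => o.elim n k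

theorem slice_act (R : MvPolynomial (Option τ) ℂ) (F : Fam (Option τ) W) (n : ℤ) :
    slice (act R F) n = (MvPolynomial.optionEquivLeft ℂ τ R).sum
      fun i q => act q (slice F (n - i)) := by
  induction R using MvPolynomial.induction_on' with
  | monomial d c =>
    rw [MvPolynomial.optionEquivLeft_monomial, Polynomial.sum_monomial_index _ _ (by simp)]
    funext k
    rw [slice, act_monomial, act_monomial, slice]
    congr 2
    funext o
    cases o <;> rfl
  | add P Q hP hQ =>
    rw [map_add act, map_add (MvPolynomial.optionEquivLeft ℂ τ),
      Polynomial.sum_add_index _ _ _ (by simp) (by simp), ← hP, ← hQ]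
    rfl

theorem exists_pow_trailingCoeff_mem_Lau {Q : Polynomial (MvPolynomial τ ℂ)} (hQ : Q ≠ 0)
    {A : ℤ → Fam τ W} {N : ℤ} (hA : ∀ j < N, A j = 0)
    (hS : ∀ n : ℤ, (Q.sum fun i q => act q (A (n - i))) ∈ Lau τ W) (m : ℕ) :
    ∀ n < N + m, act (Q.trailingCoeff ^ m) (A n) ∈ Lau τ W := by
  induction m with
  | zero =>
    intro n hn
    rw [hA n (by simpa using hn), map_zero]
    exact zero_mem _
  | succ m ih =>
    intro n hn
    have h := hS (n + Q.natTrailingDegree)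
    have hmem : Q.natTrailingDegree ∈ Q.support :=
      Polynomial.natTrailingDegree_mem_support_of_nonzero hQ
    rw [Polynomial.sum, ← Finset.add_sum_erase _ _ hmem] at h
    have h2 := act_mem_Lau (Q.trailingCoeff ^ m) h
    rw [map_add, add_sub_cancel_right, ← act_mul] at h2
    rw [pow_succ]
    refine (Submodule.add_mem_iff_left _ ?_).1 h2
    rw [map_sum]
    refine sum_mem fun i hi => ?_
    rw [Finset.mem_erase] at hi
    have hi2 : Q.natTrailingDegree < i :=
      lt_of_le_of_ne (Polynomial.natTrailingDegree_le_of_mem_supp _ hi.2) hi.1.symm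
    rw [act_comm]
    refine act_mem_Lau _ (ih _ ?_)
    push_cast at hn
    omega

theorem coeff_optionEquivLeft_mem_supported (α : ℂ) (y : τ) (s : Set τ) {i j : Option τ}
    (hi : i.elim y id ∈ s) (hj : j.elim y id ∈ s) (hy : i = none ∨ j = none → y ∈ s)
    (p : MvPolynomial (Fin 2) ℂ) (n : ℕ) :
    (MvPolynomial.optionEquivLeft ℂ τ (polySubst α none (some y)
      (MvPolynomial.rename ![i, j] p))).coeff n ∈ MvPolynomial.supported ℂ s := by
  have hX : ∀ (x : Option τ), x.elim y id ∈ s → (x = none → y ∈ s) →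
      ∀ Q : Polynomial (MvPolynomial τ ℂ), (∀ n, Q.coeff n ∈ MvPolynomial.supported ℂ s) →
      ∀ n, (Q * MvPolynomial.optionEquivLeft ℂ τ (polySubst α none (some y)
        (MvPolynomial.X x))).coeff n ∈ MvPolynomial.supported ℂ s := by
    intro x hx hxy Q hQ n
    rcases x with _ | v
    · rw [polySubst_X_self, map_add, map_mul, MvPolynomial.optionEquivLeft_X_none,
        MvPolynomial.optionEquivLeft_C, MvPolynomial.optionEquivLeft_X_some, mul_add,
        Polynomial.coeff_add, ← map_mul, Polynomial.coeff_mul_C]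
      refine add_mem ?_ (mul_mem (hQ _) (mul_mem ?_ ?_))
      · cases n with
        | zero => rw [Polynomial.coeff_mul_X_zero]; exact zero_mem _
        | succ n => rw [Polynomial.coeff_mul_X]; exact hQ _
      · exact Subalgebra.algebraMap_mem _ α
      · exact (MvPolynomial.X_mem_supported).2 (hxy rfl)
    · rw [polySubst_X_of_ne _ _ (by simp), MvPolynomial.optionEquivLeft_X_some,
        Polynomial.coeff_mul_C]
      exact mul_mem (hQ _) ((MvPolynomial.X_mem_supported).2 hx)
  induction p using MvPolynomial.induction_on generalizing n with
  | C c =>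
    have : polySubst α (none : Option τ) (some y) (MvPolynomial.C c) = MvPolynomial.C c :=
      (polySubst α none (some y)).commutes c
    rw [MvPolynomial.rename_C, this, MvPolynomial.optionEquivLeft_C, Polynomial.coeff_C]
    split_ifs
    · exact Subalgebra.algebraMap_mem _ c
    · exact zero_mem _
  | add p q hp hq =>
    rw [map_add, map_add, map_add, Polynomial.coeff_add]
    exact add_mem (hp n) (hq n)
  | mul_X p v hp =>
    rw [map_mul, map_mul, map_mul, MvPolynomial.rename_X]
    refine hX _ ?_ ?_ _ hp n
    · fin_cases v
      · exact hi
      · exact hj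
    · intro h
      fin_cases v
      · exact hy (Or.inl h)
      · exact hy (Or.inr h)

theorem mem_good_of_mem_supported {i j : τ} (h : i ≠ j) {P : MvPolynomial τ ℂ} (hP : P ≠ 0)
    (hs : P ∈ MvPolynomial.supported ℂ {i, j}) : P ∈ Good τ := by
  rw [MvPolynomial.mem_supported] at hs
  obtain ⟨q, rfl⟩ := MvPolynomial.exists_rename_eq_of_vars_subset_range P ![i, j]
    (vecPair_injective h) (hs.trans (by
      rintro x (rfl | hx)
      · exact ⟨0, rfl⟩
      · exact ⟨1, (Set.mem_singleton_iff.1 hx).symm⟩))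
  refine rename_mem_good h fun h0 => hP ?_
  rw [h0, map_zero]

theorem trailingCoeff_mem_good [Nontrivial τ] (α : ℂ) (y : τ) {P : MvPolynomial (Option τ) ℂ}
    (hP : P ∈ Good (Option τ)) : (MvPolynomial.optionEquivLeft ℂ τ
      (polySubst α none (some y) P)).trailingCoeff ∈ Good τ := by
  induction hP using Submonoid.closure_induction with
  | mem P hP =>
    obtain ⟨i, j, p, hij, hp, rfl⟩ := hP
    have h0 : (MvPolynomial.optionEquivLeft ℂ τ (polySubst α none (some y)
        (MvPolynomial.rename ![i, j] p))).trailingCoeff ≠ 0 := by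
      rw [Ne, Polynomial.trailingCoeff_eq_zero, EmbeddingLike.map_eq_zero_iff,
        ← map_zero (polySubst α none (some y)),
        (polySubst_injective α (by simp : (none : Option τ) ≠ some y)).eq_iff]
      exact ne_zero_of_mem_good (rename_mem_good hij hp)
    obtain ⟨i', j', hij', h1, h2, h3⟩ : ∃ i' j' : τ, i' ≠ j' ∧
        i.elim y id ∈ ({i', j'} : Set τ) ∧ j.elim y id ∈ ({i', j'} : Set τ) ∧
        (i = none ∨ j = none → y ∈ ({i', j'} : Set τ)) := by
      by_cases h : i.elim y id = j.elim y id
      · obtain ⟨z, hz⟩ := exists_ne (i.elim y id)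
        refine ⟨i.elim y id, z, hz.symm, Or.inl rfl, Or.inl h.symm, ?_⟩
        rintro (rfl | rfl)
        · exact Or.inl rfl
        · exact Or.inl h.symm
      · refine ⟨i.elim y id, j.elim y id, h, Or.inl rfl, Or.inr rfl, ?_⟩
        rintro (rfl | rfl)
        · exact Or.inl rfl
        · exact Or.inr rfl
    exact mem_good_of_mem_supported hij' h0
      (coeff_optionEquivLeft_mem_supported α y _ h1 h2 h3 p _)
  | one => rw [map_one, map_one]; simp [Polynomial.trailingCoeff]
  | mul P Q _ _ hP hQ =>
    rw [map_mul, map_mul, Polynomial.trailingCoeff_mul]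
    exact mul_mem hP hQ

end Slices

/-! ### Enlarging quasi compatible sequences -/

section Enlarge

variable {τ W : Type*} [AddCommGroup W] [Module ℂ W]

theorem exists_labelling (l : List (EW W)) : ∃ (n : ℕ) (L : List (EW W × Fin n)),
    L.map Prod.fst = l ∧ (L.map Prod.snd).Nodup ∧ ∀ v, v ∈ L.map Prod.snd := by
  refine ⟨l.length, l.zip (List.finRange l.length), ?_, ?_, ?_⟩
  · exact List.map_fst_zip (by simp)
  · rw [List.map_snd_zip (by simp)]
    exact List.nodup_finRange _
  · rw [List.map_snd_zip (by simp)]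
    exact List.mem_finRange

/-- Rename the labels of a word to make room for a new one. -/
abbrev someW (l : List (EW W × τ)) : List (EW W × Option τ) := l.map (Prod.map id some)

theorem map_fst_someW (l : List (EW W × τ)) : (someW l).map Prod.fst = l.map Prod.fst := by
  simp [Function.comp_def]

theorem map_snd_someW (l : List (EW W × τ)) :
    (someW l).map Prod.snd = (l.map Prod.snd).map some := by
  simp [Function.comp_def]

theorem nodup_insert_none {l l' : List (EW W × τ)} (h : ((l ++ l').map Prod.snd).Nodup)
    (a : EW W) : ((someW l ++ (a, none) :: someW l').map Prod.snd).Nodup := by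
  have h2 : ((someW l ++ (a, none) :: someW l').map Prod.snd).Perm
      (none :: ((l ++ l').map Prod.snd).map some) := by
    rw [List.map_append, List.map_cons, map_snd_someW, map_snd_someW, List.map_append,
      List.map_append]
    exact List.perm_middle
  rw [h2.nodup_iff, List.nodup_cons]
  exact ⟨by simp, h.map (Option.some_injective _)⟩

theorem mem_insert_none {l l' : List (EW W × τ)} (h : ∀ v, v ∈ (l ++ l').map Prod.snd)
    (a : EW W) : ∀ v, v ∈ (someW l ++ (a, none) :: someW l').map Prod.snd := by
  intro v
  rw [List.map_append, List.map_cons, map_snd_someW, map_snd_someW, List.mem_append,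
    List.mem_cons]
  rcases v with _ | v
  · exact Or.inr (Or.inl rfl)
  · have := h v
    rw [List.map_append, List.mem_append] at this
    exact this.imp (List.mem_map_of_mem) fun h => Or.inr (List.mem_map_of_mem h)

theorem qcl_insert_iff {l l' : List (EW W × τ)} (hnd : ((l ++ l').map Prod.snd).Nodup)
    (hcov : ∀ v, v ∈ (l ++ l').map Prod.snd) (a : EW W) :
    QCL (l.map Prod.fst ++ a :: l'.map Prod.fst) ↔ QCW (someW l ++ (a, none) :: someW l') := by
  rw [← qcl_iff_qcw _ (nodup_insert_none hnd a) (mem_insert_none hcov a), List.map_append,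
    List.map_cons, map_fst_someW, map_fst_someW]

theorem QCL.insert_oneE {l l' : List (EW W)} (h : QCL (l ++ l')) : QCL (l ++ oneE :: l') := by
  obtain ⟨n, L, hL, hnd, hcov⟩ := exists_labelling (l ++ l')
  obtain ⟨L1, L2, rfl, rfl, rfl⟩ := List.map_eq_append_iff.1 hL
  rw [qcl_insert_iff hnd hcov]
  rw [← hL, qcl_iff_qcw _ hnd hcov] at h
  obtain ⟨P, hP, hw⟩ := h
  refine ⟨_, rename_mem_good_of_mem (Option.some_injective _) hP, fun w => ?_⟩
  obtain ⟨N, hN⟩ := hw w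
  have hF : wordC (someW L1 ++ (oneE, none) :: someW L2) w =
      fun k => if k none = 0 then wordC (L1 ++ L2) w (k ∘ some) else 0 := by
    funext k
    rw [wordC_append, wordC_map, wordC_append]
    change wordL L1 (k ∘ some) (if -(k none) - 1 = -1 then wordC (someW L2) w k else 0) = _
    rw [wordC_map]
    split_ifs with h1 h2 h2
    · rfl
    · omega
    · omega
    · exact map_zero _
  refine ⟨min 0 N, fun k ⟨i, hi⟩ => ?_⟩
  rw [hF, act_rename (Option.some_injective _)]
  have h1 : ∀ m : Fin n → ℤ,
      Function.extend some m k none = k none := fun m =>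
    Function.extend_apply' _ _ _ (by simp)
  have h2 : ∀ m : Fin n → ℤ,
      Function.extend some m k ∘ some = m := fun m =>
    funext ((Option.some_injective _).extend_apply _ _)
  simp only [h1, h2]
  split_ifs with h0
  · cases i with
    | none => omega
    | some i => exact hN _ ⟨i, lt_of_lt_of_le hi (min_le_right _ _)⟩
  · have : act P (0 : Fam _ W) = 0 := map_zero _
    exact congrFun this _

theorem QCL.add_smul {l l' : List (EW W)} {u v : EW W} (hu : QCL (l ++ u :: l'))
    (hv : QCL (l ++ v :: l')) (r : ℂ) : QCL (l ++ (u + r • v) :: l') := by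
  obtain ⟨n, L, hL, hnd, hcov⟩ := exists_labelling (l ++ u :: l')
  obtain ⟨L1, L2, rfl, rfl, h2⟩ := List.map_eq_append_iff.1 hL
  obtain ⟨⟨u, y⟩, L2, rfl, rfl, rfl⟩ := List.map_eq_cons_iff.1 h2
  have key : ∀ x : EW W, QCL (L1.map Prod.fst ++ x :: L2.map Prod.fst) ↔
      QCW (L1 ++ (x, y) :: L2) := fun x => by
    rw [← qcl_iff_qcw]
    · simp
    · simpa using hnd
    · simpa using hcov
  rw [key] at hv ⊢
  have hu' := (key _).1 hu
  obtain ⟨P, hP, hPw⟩ := hu'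
  obtain ⟨Q, hQ, hQw⟩ := hv
  refine ⟨P * Q, mul_mem hP hQ, fun w => ?_⟩
  have : wordC (L1 ++ (u + r • v, y) :: L2) w = wordC (L1 ++ (u, y) :: L2) w +
      r • wordC (L1 ++ (v, y) :: L2) w := by
    funext k
    rw [Pi.add_apply, Pi.smul_apply, wordC_append, wordC_append, wordC_append]
    change wordL L1 k (wordC ((u, y) :: L2) w k + r • wordC ((v, y) :: L2) w k) =
      wordL L1 k (wordC ((u, y) :: L2) w k) + r • wordL L1 k (wordC ((v, y) :: L2) w k)
    rw [map_add, map_smul]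
  rw [this, map_add, map_smul]
  refine add_mem ?_ (Submodule.smul_mem _ _ ?_)
  · rw [mul_comm, act_mul]
    exact act_mem_Lau _ (hPw w)
  · rw [act_mul]
    exact act_mem_Lau _ (hQw w)

theorem qcl_singleton (c : EW W) : QCL [c] := by
  have h : QCW [(c, ())] := by
    refine ⟨1, one_mem _, fun w => ?_⟩
    obtain ⟨N, hN⟩ := c.2 w
    rw [map_one]
    refine ⟨-N, fun k ⟨i, hi⟩ => hN _ ?_⟩
    have : k i = k () := rfl
    change N ≤ -(k ()) - 1
    omega
  exact (qcl_iff_qcw [(c, ())] (by simp) (by simp)).2 h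

theorem mem_of_maximal {V : Submodule ℂ (EW W)} (hqc : QCSet (V : Set (EW W)))
    (hmax : ∀ V' : Submodule ℂ (EW W), QCSet (V' : Set (EW W)) → V ≤ V' → V = V')
    {c : EW W} {ins : List (EW W)} (hins : ∀ a ∈ ins, a ∈ V)
    (h : ∀ l l' : List (EW W), QCL (l ++ ins ++ l') → QCL (l ++ c :: l')) : c ∈ V := by
  rw [qcSet_iff] at hqc
  have h1 : ∀ l' l : List (EW W), (∀ x ∈ l', x ∈ V ∨ x = c) → (∀ x ∈ l, x ∈ V) →
      QCL (l ++ l') := by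
    intro l'
    induction l' with
    | nil =>
      intro l _ hl
      rw [List.append_nil]
      exact hqc l hl
    | cons x l' ih =>
      intro l hl' hl
      rw [List.forall_mem_cons] at hl'
      rcases hl'.1 with hx | rfl
      · have := ih (l ++ [x]) hl'.2 (by
          simp only [List.mem_append, List.mem_singleton]
          rintro z (hz | rfl)
          exacts [hl z hz, hx])
        simpa using this
      · refine h l l' (ih (l ++ ins) hl'.2 ?_)
        simp only [List.mem_append]
        rintro z (hz | hz)
        exacts [hl z hz, hins z hz]
  have h2 : ∀ l' l : List (EW W), (∀ x ∈ l', x ∈ V ⊔ Submodule.span ℂ {c}) →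
      (∀ x ∈ l, x ∈ V ∨ x = c) → QCL (l ++ l') := by
    intro l'
    induction l' with
    | nil =>
      intro l _ hl
      rw [List.append_nil]
      exact h1 l [] hl (by simp)
    | cons x l' ih =>
      intro l hl' hl
      rw [List.forall_mem_cons] at hl'
      obtain ⟨v, hv, z, hz, rfl⟩ := Submodule.mem_sup.1 hl'.1
      obtain ⟨r, rfl⟩ := Submodule.mem_span_singleton.1 hz
      have hh : ∀ x, (x ∈ V ∨ x = c) → QCL (l ++ x :: l') := fun x hx => by
        have := ih (l ++ [x]) hl'.2 (by
          simp only [List.mem_append, List.mem_singleton]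
          rintro z (hz | rfl)
          exacts [hl z hz, hx])
        simpa using this
      exact (hh v (Or.inl hv)).add_smul (hh c (Or.inr rfl)) r
  have h3 := hmax (V ⊔ Submodule.span ℂ {c})
    (qcSet_iff.2 fun l hl => h2 l [] hl (by simp)) le_sup_left
  rw [h3]
  exact Submodule.mem_sup_right (Submodule.mem_span_singleton_self c)

theorem oneE_mem_of_maximal {V : Submodule ℂ (EW W)} (hqc : QCSet (V : Set (EW W)))
    (hmax : ∀ V' : Submodule ℂ (EW W), QCSet (V' : Set (EW W)) → V ≤ V' → V = V') :
    oneE ∈ V :=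
  mem_of_maximal hqc hmax (ins := []) (by simp) fun l l' h => by
    rw [List.append_nil] at h
    exact h.insert_oneE

end Enlarge

/-! ### Substituting inside a word -/

section PairSubst

variable {σ W : Type*} [AddCommGroup W] [Module ℂ W]

theorem polySubst_rename {τ : Type*} (α : ℂ) {e : τ → σ} (he : Function.Injective e) (i j : τ)
    (p : MvPolynomial τ ℂ) : polySubst α (e i) (e j) (MvPolynomial.rename e p) =
      MvPolynomial.rename e (polySubst α i j p) := by
  have : (polySubst α (e i) (e j)).comp (MvPolynomial.rename e) =
      (MvPolynomial.rename e).comp (polySubst α i j) := by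
    ext v : 1
    simp only [AlgHom.comp_apply, MvPolynomial.rename_X]
    by_cases h : v = i
    · subst h
      simp [polySubst_X_self]
    · rw [polySubst_X_of_ne _ _ h, polySubst_X_of_ne _ _ (he.ne h), MvPolynomial.rename_X]
  exact DFunLike.congr_fun this p

/-- The two-variable family in `x_u, x_y` obtained by fixing the exponents of the other
variables to be those of `k`. -/
def sl (u y : σ) (F : Fam σ W) (k : σ → ℤ) : Fam (Fin 2) W :=
  fun m => F (Function.extend ![u, y] m k)

variable {u y : σ}

theorem extend_pair_of_ne (m : Fin 2 → ℤ) (k : σ → ℤ) {z : σ} (h1 : z ≠ u) (h2 : z ≠ y) :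
    Function.extend ![u, y] m k z = k z := by
  refine Function.extend_apply' _ _ _ ?_
  rintro ⟨i, hi⟩
  fin_cases i <;> simp_all

theorem extend_pair_fst (huy : u ≠ y) (m : Fin 2 → ℤ) (k : σ → ℤ) :
    Function.extend ![u, y] m k u = m 0 := (vecPair_injective huy).extend_apply m k 0

theorem extend_pair_snd (huy : u ≠ y) (m : Fin 2 → ℤ) (k : σ → ℤ) :
    Function.extend ![u, y] m k y = m 1 := (vecPair_injective huy).extend_apply m k 1

theorem extend_pair_extend (huy : u ≠ y) (m m' : Fin 2 → ℤ) (k : σ → ℤ) :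
    Function.extend ![u, y] m (Function.extend ![u, y] m' k) = Function.extend ![u, y] m k := by
  funext z
  by_cases h1 : z = u
  · subst h1
    simp only [extend_pair_fst huy]
  by_cases h2 : z = y
  · subst h2
    simp only [extend_pair_snd huy]
  simp only [extend_pair_of_ne _ _ h1 h2]

theorem extend_pair_self (huy : u ≠ y) (k : σ → ℤ) :
    Function.extend ![u, y] ![k u, k y] k = k := by
  funext z
  by_cases h1 : z = u
  · subst h1
    exact extend_pair_fst huy _ _
  by_cases h2 : z = y
  · subst h2
    exact extend_pair_snd huy _ _
  exact extend_pair_of_ne _ _ h1 h2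

theorem ext_sl {X : Type*} (huy : u ≠ y) {F G : Fam σ X} (h : ∀ k, sl u y F k = sl u y G k) :
    F = G := by
  funext k
  have := congrFun (h k) ![k u, k y]
  rwa [sl, sl, extend_pair_self huy] at this

theorem sl_act_rename (huy : u ≠ y) (q : MvPolynomial (Fin 2) ℂ) (F : Fam σ W) (k : σ → ℤ) :
    sl u y (act (MvPolynomial.rename ![u, y] q) F) k = act q (sl u y F k) := by
  funext m
  have he := vecPair_injective huy
  rw [sl, act_rename he]
  simp only [extend_pair_extend huy]
  rw [show Function.extend ![u, y] m k ∘ ![u, y] = m from funext (he.extend_apply _ _)]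
  rfl

theorem extend_pair_slide (huy : u ≠ y) (k : σ → ℤ) (m : Fin 2 → ℤ) (n : ℤ) :
    Function.extend ![u, y] (slide 0 1 m n) k = slide u y (Function.extend ![u, y] m k) n := by
  funext z
  by_cases h1 : z = u
  · subst h1
    rw [extend_pair_fst huy]
    simp [slide]
  by_cases h2 : z = y
  · subst h2
    rw [extend_pair_snd huy]
    simp [slide, huy.symm, extend_pair_fst huy, extend_pair_snd huy]
  rw [extend_pair_of_ne _ _ h1 h2]
  simp [slide, h1, h2, extend_pair_of_ne _ _ h1 h2]

theorem sl_subst (huy : u ≠ y) (κ : ℤ → ℤ → ℂ) (F : Fam σ W) (k : σ → ℤ) :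
    sl u y (subst κ u y F) k = subst κ 0 1 (sl u y F k) := by
  funext m
  refine finsum_congr fun n => ?_
  rw [sl, extend_pair_slide huy, extend_pair_fst huy]

theorem mem_Adm_of_sl (huy : u ≠ y) {κ : ℤ → ℤ → ℂ} {F : Fam σ W}
    (h : ∀ k, sl u y F k ∈ Adm κ 0 1 W) : F ∈ Adm κ u y W := by
  intro k
  have := h k ![k u, k y]
  simp only [sl, extend_pair_slide huy] at this
  rwa [extend_pair_self huy] at this

theorem act_subst_of_sl {α : ℂ} (hα : α ≠ 0) (huy : u ≠ y) {F A : Fam σ W}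
    {q : MvPolynomial (Fin 2) ℂ} (hq : ∀ k, act q (sl u y F k) ∈ Lau (Fin 2) W)
    (h : ∀ k, act (polySubst α 0 1 q) (sl u y A k) =
      subst (kerIn α) 0 1 (act q (sl u y F k))) (P : MvPolynomial σ ℂ) :
    act (polySubst α u y (P * MvPolynomial.rename ![u, y] q)) A =
      subst (kerIn α) u y (act (P * MvPolynomial.rename ![u, y] q) F) := by
  have hr : polySubst α u y (MvPolynomial.rename ![u, y] q) =
      MvPolynomial.rename ![u, y] (polySubst α 0 1 q) :=
    polySubst_rename α (vecPair_injective huy) 0 1 q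
  have hAdm : act (MvPolynomial.rename ![u, y] q) F ∈ Adm (kerIn α) u y W :=
    mem_Adm_of_sl huy fun k => by
      rw [sl_act_rename huy]
      exact Lau_le_Adm _ (by decide) (hq k)
  rw [act_mul, (act_mem_Adm huy (kerIn_succ hα) P hAdm).2, map_mul, act_mul, hr]
  congr 1
  refine ext_sl huy fun k => ?_
  rw [sl_act_rename huy, sl_subst huy, sl_act_rename huy, h]

/-- The defining property of `Y_ℰ^{(α)}` inside a word. -/
theorem act_pairSubst (α : ℂˣ) (huy : u ≠ y) {a b : EW W} {p : MvPolynomial (Fin 2) ℂ}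
    (hp0 : p ≠ 0) (hp : Clears p a b) {L : (σ → ℤ) → W →ₗ[ℂ] W} {v : (σ → ℤ) → W}
    (hL : ∀ k k', (∀ z, z ≠ u → z ≠ y → k z = k' z) → L k = L k')
    (hv : ∀ k k', (∀ z, z ≠ u → z ≠ y → k z = k' z) → v k = v k') (P : MvPolynomial σ ℂ) :
    act (polySubst (α : ℂ) u y (P * MvPolynomial.rename ![u, y] p))
        (fun k => L k (mf (YEa α a b (-(k u) - 1)) (v k) (-(k y) - 1))) =
      subst (kerIn (α : ℂ)) u y (act (P * MvPolynomial.rename ![u, y] p)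
        (fun k => L k (mf a (mf b (v k) (-(k y) - 1)) (-(k u) - 1)))) := by
  have hs := (YEa_spec α (qcPair_iff.2 ⟨p, hp0, hp⟩)).2 p hp
  have h1 : ∀ k, sl u y (fun k => L k (mf a (mf b (v k) (-(k y) - 1)) (-(k u) - 1))) k =
      fun m => L k (prodF a b (v k) m) := fun k => funext fun m => by
    simp only [sl, extend_pair_fst huy, extend_pair_snd huy]
    rw [hL _ k fun z => extend_pair_of_ne m k, hv _ k fun z => extend_pair_of_ne m k]
    rfl
  have h2 : ∀ k, sl u y (fun k => L k (mf (YEa α a b (-(k u) - 1)) (v k) (-(k y) - 1))) k =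
      fun m => L k (genF (fun j => YEa α a b (-j - 1)) (v k) m) := fun k => funext fun m => by
    simp only [sl, extend_pair_fst huy, extend_pair_snd huy]
    rw [hL _ k fun z => extend_pair_of_ne m k, hv _ k fun z => extend_pair_of_ne m k]
    rfl
  have h3 : ∀ k, act p (sl u y (fun k => L k (mf a (mf b (v k) (-(k y) - 1)) (-(k u) - 1))) k) =
      fun m => L k (act p (prodF a b (v k)) m) := fun k => by
    rw [h1]
    exact funext fun m => act_map _ _ _ _
  refine act_subst_of_sl α.ne_zero huy (fun k => ?_) (fun k => ?_) P
  · rw [h3]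
    obtain ⟨N, hN⟩ := hp (v k)
    exact ⟨N, fun m hm => (congrArg (L k) (hN m hm)).trans (map_zero _)⟩
  · rw [h2, h3]
    funext m
    rw [act_map, hs, substF, subst, subst]
    refine (map_finsum (L k) (Lau_le_Adm (kerIn (α : ℂ)) (by decide) (hp (v k)) m)).trans ?_
    exact finsum_congr fun n => map_smul _ _ _

end PairSubst

/-! ### Closure of quasi compatible sequences under the products -/

section Closure

variable {τ W : Type*} [AddCommGroup W] [Module ℂ W]

theorem slice_subst_mem_Lau (α : ℂ) (y : τ) {F : Fam (Option τ) W} (hF : F ∈ Lau (Option τ) W)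
    (n : ℤ) : slice (subst (kerIn α) none (some y) F) n ∈ Lau τ W := by
  obtain ⟨N, hN⟩ := hF
  refine ⟨min N (2 * N - n), fun k ⟨i, hi⟩ => ?_⟩
  rw [slice, subst]
  refine finsum_eq_zero_of_forall_eq_zero fun m => ?_
  by_cases hm : m < N
  · rw [hN _ ⟨none, by simpa [slide] using hm⟩, smul_zero]
  · rw [hN _ ⟨some i, ?_⟩, smul_zero]
    by_cases h : i = y
    · subst h
      simp [slide]
      omega
    · simp [slide, h]
      omega

theorem QCW.replace (α : ℂˣ) {l l' : List (EW W × τ)} {y : τ} {a b : EW W} [Nontrivial τ]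
    (hy : y ∉ l.map Prod.snd) (hy' : y ∉ l'.map Prod.snd) (hab : QCPair a b)
    (h : QCW (someW l ++ (a, none) :: (b, some y) :: someW l')) (n : ℤ) :
    QCW (l ++ (YEa α a b n, y) :: l') := by
  obtain ⟨p, hp0, hp⟩ := qcPair_iff.1 hab
  obtain ⟨P, hP, hPw⟩ := h
  obtain ⟨N, hN⟩ := (YEa_spec α hab).1
  have huy : (none : Option τ) ≠ some y := by simp
  set R := P * MvPolynomial.rename ![none, some y] p
  have hR : R ∈ Good (Option τ) := mul_mem hP (rename_mem_good huy hp0)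
  have hne : MvPolynomial.optionEquivLeft ℂ τ (polySubst (α : ℂ) none (some y) R) ≠ 0 := by
    rw [Ne, EmbeddingLike.map_eq_zero_iff]
    intro h0
    exact ne_zero_of_mem_good hR (polySubst_injective (α : ℂ) huy (h0.trans (map_zero _).symm))
  set j := -n - 1 with hj
  have hn : n = -j - 1 := by omega
  refine ⟨_, pow_mem (trailingCoeff_mem_good (α : ℂ) y hR) (j - N + 1).toNat, fun w => ?_⟩
  set A : Fam (Option τ) W := fun k => wordL l (k ∘ some)
    (mf (YEa α a b (-(k none) - 1)) (wordC l' w (k ∘ some)) (-(k (some y)) - 1)) with hA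
  have hL : ∀ k k' : Option τ → ℤ, (∀ z, z ≠ none → z ≠ some y → k z = k' z) →
      wordL (W := W) l (k ∘ some) = wordL l (k' ∘ some) := fun k k' hk => LinearMap.ext fun w =>
    wordC_congr l w fun v hv => hk _ (by simp) (by simp; rintro rfl; exact hy hv)
  have hv : ∀ k k' : Option τ → ℤ, (∀ z, z ≠ none → z ≠ some y → k z = k' z) →
      wordC l' w (k ∘ some) = wordC l' w (k' ∘ some) := fun k k' hk =>
    wordC_congr l' w fun v hv => hk _ (by simp) (by simp; rintro rfl; exact hy' hv)
  have hact : act (polySubst (α : ℂ) none (some y) R) A = _ :=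
    act_pairSubst α huy hp0 hp hL hv P
  have hF : (fun k : Option τ → ℤ => wordL l (k ∘ some) (mf a (mf b (wordC l' w (k ∘ some))
      (-(k (some y)) - 1)) (-(k none) - 1))) =
      wordC (someW l ++ (a, none) :: (b, some y) :: someW l') w := by
    funext k
    rw [wordC_append, wordC_map]
    change _ = wordC l (mf a (mf b (wordC (someW l') w k) _) _) _
    rw [wordC_map]
    rfl
  rw [hF] at hact
  have hmem : act R (wordC (someW l ++ (a, none) :: (b, some y) :: someW l') w) ∈
      Lau (Option τ) W := by
    rw [show R = MvPolynomial.rename ![none, some y] p * P from mul_comm _ _, act_mul]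
    exact act_mem_Lau _ (hPw w)
  have key := exists_pow_trailingCoeff_mem_Lau (W := W) hne (A := slice A) (N := N) (fun i hi => by
    funext k
    change wordL l k (mf (YEa α a b (-i - 1)) _ _) = 0
    rw [hN i hi, mf_zero, map_zero]) (fun i => by
      rw [← slice_act, hact]
      exact slice_subst_mem_Lau (α : ℂ) y hmem i) (j - N + 1).toNat j (by omega)
  have hs : slice A j = wordC (l ++ (YEa α a b n, y) :: l') w := by
    funext k
    rw [wordC_append, hn]
    rfl
  rwa [hs] at key

theorem QCL.replace (α : ℂˣ) {l l' : List (EW W)} {a b : EW W} (hab : QCPair a b)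
    (h : QCL (l ++ [a, b] ++ l')) (n : ℤ) : QCL (l ++ YEa α a b n :: l') := by
  obtain ⟨r, L, hL, hnd, hcov⟩ := exists_labelling (l ++ b :: l')
  obtain ⟨L1, L2, rfl, rfl, h2⟩ := List.map_eq_append_iff.1 hL
  obtain ⟨⟨b, y⟩, L2, rfl, rfl, rfl⟩ := List.map_eq_cons_iff.1 h2
  by_cases hr : Nontrivial (Fin r)
  · have h1 := (qcl_insert_iff hnd hcov a).1 (by simpa using h)
    have hnd' := hnd
    rw [List.map_append, List.map_cons, List.nodup_middle, List.nodup_cons, List.mem_append,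
      not_or] at hnd'
    have := h1.replace α hnd'.1.1 hnd'.1.2 hab n
    have h3 := (qcl_iff_qcw (L1 ++ (YEa α a b n, y) :: L2) (by simpa using hnd)
      (by simpa using hcov)).2 this
    simpa using h3
  · rw [not_nontrivial_iff_subsingleton] at hr
    have hlen : (List.map Prod.snd (L1 ++ (b, y) :: L2)).length ≤ 1 := by
      have h1 := hnd.length_le_card
      have h2 : Fintype.card (Fin r) ≤ 1 := Fintype.card_le_one_iff_subsingleton.2 hr
      exact h1.trans h2
    rw [List.length_map, List.length_append, List.length_cons] at hlen
    have e1 : L1 = [] := List.length_eq_zero_iff.1 (by omega)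
    have e2 : L2 = [] := List.length_eq_zero_iff.1 (by omega)
    subst e1 e2
    exact qcl_singleton _

theorem YEa_mem_of_maximal {V : Submodule ℂ (EW W)} (hqc : QCSet (V : Set (EW W)))
    (hmax : ∀ V' : Submodule ℂ (EW W), QCSet (V' : Set (EW W)) → V ≤ V' → V = V')
    {a b : EW W} (ha : a ∈ V) (hb : b ∈ V) (α : ℂˣ) (n : ℤ) : YEa α a b n ∈ V :=
  mem_of_maximal hqc hmax (ins := [a, b]) (by simp [ha, hb]) fun _ _ h =>
    h.replace α (hqc.qcPair ha hb) n

theorem RaE_mem_of_maximal {V : Submodule ℂ (EW W)} (hqc : QCSet (V : Set (EW W)))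
    (hmax : ∀ V' : Submodule ℂ (EW W), QCSet (V' : Set (EW W)) → V ≤ V' → V = V')
    {a : EW W} (ha : a ∈ V) (α : ℂˣ) : RaE α a ∈ V := by
  rw [← taylorE_zero, ← YEa_oneE_right]
  exact YEa_mem_of_maximal hqc hmax ha (oneE_mem_of_maximal hqc hmax) α _

end Closure

/-! ### The products of families of pairs -/

section FamilySubst

variable {σ W : Type*} [AddCommGroup W] [Module ℂ W] {u y z : σ}

theorem act_mem_IterLau' (p : MvPolynomial (Fin 2) ℂ) {F : Fam (Fin 2) W}
    (hF : F ∈ IterLau W) : act p F ∈ IterLau W := by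
  have : polySubst (0 : ℂ) (0 : Fin 2) 1 = AlgHom.id ℂ _ := by
    ext v : 1
    by_cases h : v = 0
    · subst h
      simp [polySubst_X_self]
    · simp [polySubst_X_of_ne _ _ h]
  simpa [this] using act_mem_IterLau 0 p hF

theorem sl_act_mem_IterLau (huy : u ≠ y) (Q : MvPolynomial σ ℂ) {F : Fam σ W}
    (hF : ∀ k, sl u y F k ∈ IterLau W) (k : σ → ℤ) : sl u y (act Q F) k ∈ IterLau W := by
  induction Q using MvPolynomial.induction_on' with
  | monomial d c =>
    have : sl u y (act (MvPolynomial.monomial d c) F) k =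
        act (MvPolynomial.monomial (Finsupp.single 0 (d u) + Finsupp.single 1 (d y)) c)
          (sl u y F fun v => k v - d v) := by
      funext m
      rw [sl, act_monomial, act_monomial, sl]
      congr 2
      funext v
      by_cases h1 : v = u
      · subst h1
        simp [extend_pair_fst huy]
      by_cases h2 : v = y
      · subst h2
        simp [extend_pair_snd huy]
      simp only [extend_pair_of_ne _ _ h1 h2]
    rw [this]
    exact act_mem_IterLau' _ (hF _)
  | add P Q hP hQ =>
    rw [map_add]
    exact add_mem hP hQ

/-- The coefficients of `∑ f_n(x_u) g_n(x_y) w x_z^n`. -/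
def famProd (u y z : σ) (f g : ℤ → EW W) (w : W) : Fam σ W := fun k =>
  mf (f (k z)) (mf (g (k z)) w (-(k y) - 1)) (-(k u) - 1)

/-- The coefficients of `∑ (Y_ℰ^{(α)}(f_n, x_u) g_n)(x_y) w x_z^n`. -/
def famY (α : ℂˣ) (u y z : σ) (f g : ℤ → EW W) (w : W) : Fam σ W := fun k =>
  mf (YEa α (f (k z)) (g (k z)) (-(k u) - 1)) w (-(k y) - 1)

theorem sl_act_famY_of_clears (α : ℂˣ) (huy : u ≠ y) (hzu : z ≠ u) (hzy : z ≠ y)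
    {f g : ℤ → EW W} {q : MvPolynomial (Fin 2) ℂ} (hq0 : q ≠ 0)
    (hq : ∀ n, Clears q (f n) (g n)) (w : W) {R : MvPolynomial σ ℂ} {k : σ → ℤ}
    (hR : sl u y (act R (famProd u y z f g w)) k ∈ Lau (Fin 2) W) :
    sl u y (act (polySubst (α : ℂ) u y R) (famY α u y z f g w)) k =
      sl u y (subst (kerIn (α : ℂ)) u y (act R (famProd u y z f g w))) k := by
  have hs : ∀ n, _ := fun n => YEa_spec α (qcPair_iff.2 ⟨q, hq0, hq n⟩)
  have h1 : ∀ k, sl u y (famProd u y z f g w) k = prodF (f (k z)) (g (k z)) w := fun k =>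
    funext fun m => by
      simp only [sl, famProd, extend_pair_fst huy, extend_pair_snd huy,
        extend_pair_of_ne m k hzu hzy]
      rfl
  have h2 : ∀ k, sl u y (famY α u y z f g w) k =
      genF (fun j => YEa α (f (k z)) (g (k z)) (-j - 1)) w := fun k => funext fun m => by
    simp only [sl, famY, extend_pair_fst huy, extend_pair_snd huy, extend_pair_of_ne m k hzu hzy]
    rfl
  have key := act_subst_of_sl α.ne_zero huy (F := famProd u y z f g w) (A := famY α u y z f g w)
    (q := q) (fun k => by rw [h1]; exact hq _ w) (fun k => by
      rw [h1, h2]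
      exact (hs (k z)).2 q (hq _) w) R
  have hr : polySubst (α : ℂ) u y (MvPolynomial.rename ![u, y] q) =
      MvPolynomial.rename ![u, y] (polySubst (α : ℂ) 0 1 q) :=
    polySubst_rename (α : ℂ) (vecPair_injective huy) 0 1 q
  rw [mul_comm, map_mul, act_mul, act_mul, hr] at key
  have key' := congrArg (fun F => sl u y F k) key
  rw [sl_act_rename huy, sl_subst huy, sl_act_rename huy,
    (act_mem_Adm (by decide) (kerIn_succ α.ne_zero) q (Lau_le_Adm _ (by decide) hR)).2] at key'
  rw [sl_subst huy]
  exact act_polySubst_injOn (α : ℂ) hq0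
    (sl_act_mem_IterLau huy _ (fun k => by
      rw [h2]
      exact genF_mem_IterLau (hs (k z)).1 w) k) (subst_mem_IterLau _ hR) key'

theorem clears_zero_left (p : MvPolynomial (Fin 2) ℂ) (b : EW W) : Clears p 0 b := fun w => by
  have : prodF 0 b w = 0 := rfl
  rw [this, map_zero]
  exact zero_mem _

theorem clears_zero_right (p : MvPolynomial (Fin 2) ℂ) (a : EW W) : Clears p a 0 := fun w => by
  have : prodF a 0 w = 0 := funext fun k => mf_zero_right _ _
  rw [this, map_zero]
  exact zero_mem _

theorem act_famY (α : ℂˣ) (huy : u ≠ y) (hzu : z ≠ u) (hzy : z ≠ y) {f g : ℤ → EW W}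
    (hfg : ∀ n, QCPair (f n) (g n)) {N : ℤ} (hN : ∀ n < N, f n = 0 ∨ g n = 0) (w : W)
    {R : MvPolynomial σ ℂ} (hR : ∀ k, sl u y (act R (famProd u y z f g w)) k ∈ Lau (Fin 2) W) :
    act (polySubst (α : ℂ) u y R) (famY α u y z f g w) =
      subst (kerIn (α : ℂ)) u y (act R (famProd u y z f g w)) := by
  choose q hq0 hq using fun n => qcPair_iff.1 (hfg n)
  refine ext_sl huy fun k => ?_
  set n := k z with hn
  set f' : ℤ → EW W := fun i => if i ≤ n then f i else 0 with hf'
  have hf'1 : ∀ i ≤ n, f' i = f i := fun i hi => if_pos hi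
  have hcl : ∀ i, Clears (∏ i ∈ Finset.Icc N n, q i) (f' i) (g i) := by
    intro i
    by_cases h1 : i ≤ n
    · rw [hf'1 i h1]
      by_cases h2 : i < N
      · rcases hN i h2 with h | h <;> rw [h]
        · exact clears_zero_left _ _
        · exact clears_zero_right _ _
      · rw [← Finset.prod_erase_mul _ _ (Finset.mem_Icc.2 ⟨not_lt.1 h2, h1⟩)]
        exact (hq i).mul_left _
    · simp only [hf', if_neg h1]
      exact clears_zero_left _ _
  let Z : Set (σ → ℤ) := {k | k z ≤ n}
  have hZ1 : ∀ (P : MvPolynomial σ ℂ), ∀ k ∈ Z, ∀ d ∈ P.support,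
      (fun v => k v - (d v : ℤ)) ∈ Z := fun P k hk d _ => by
    change k z - (d z : ℤ) ≤ n
    have : k z ≤ n := hk
    omega
  have hZ2 : ∀ k ∈ Z, ∀ m, slide u y k m ∈ Z := fun k hk m => by
    change slide u y k m z ≤ n
    rw [slide, if_neg hzu, if_neg hzy]
    exact hk
  have hP : ∀ (P : MvPolynomial σ ℂ), ∀ k ∈ Z, act P (famProd u y z f' g w) k =
      act P (famProd u y z f g w) k := fun P => act_congr (hZ1 P) fun k hk => by
    rw [famProd, famProd, hf'1 _ hk]
  have hY : ∀ (P : MvPolynomial σ ℂ), ∀ k ∈ Z, act P (famY α u y z f' g w) k =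
      act P (famY α u y z f g w) k := fun P => act_congr (hZ1 P) fun k hk => by
    rw [famY, famY, hf'1 _ hk]
  have hsl : ∀ {F G : Fam σ W}, (∀ k ∈ Z, F k = G k) → sl u y F k = sl u y G k := fun h =>
    funext fun m => h _ (by
      change _ ≤ n
      rw [extend_pair_of_ne m k hzu hzy])
  rw [← hsl (hY _), ← hsl (subst_congr hZ2 (hP R))]
  refine sl_act_famY_of_clears α huy hzu hzy (Finset.prod_ne_zero_iff.2 fun i _ => hq0 i) hcl w ?_
  rw [hsl (hP R)]
  exact hR k

end FamilySubst

/-! ### Composition of substitutions -/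

section Compose

variable {W : Type*} [AddCommGroup W] [Module ℂ W]

theorem slide_one_two (k : Fin 3 → ℤ) (m : ℤ) : slide 1 2 k m = ![k 0, m, k 2 + k 1 - m] := by
  funext i
  fin_cases i <;> simp [slide]

theorem slide_zero_two (k : Fin 3 → ℤ) (m : ℤ) : slide 0 2 k m = ![m, k 1, k 2 + k 0 - m] := by
  funext i
  fin_cases i <;> simp [slide]

theorem slide_zero_one (k : Fin 3 → ℤ) (m : ℤ) : slide 0 1 k m = ![m, k 1 + k 0 - m, k 2] := by
  funext i
  fin_cases i <;> simp [slide]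

/-- Substituting `x₀ ↦ x₀ + x₂, x₁ ↦ x₁ + x₂` and then `x₀ ↦ x₀ + x₁` is the same as
substituting `x₀ ↦ x₀ + x₁` and then `x₁ ↦ x₁ + x₂`, with the respective expansions. -/
theorem subst_subst_subst {H : Fam (Fin 3) W} (hH : H ∈ Lau (Fin 3) W) :
    subst kerOut 0 1 (subst (kerIn 1) 0 2 (subst (kerIn 1) 1 2 H)) =
      subst (kerIn 1) 1 2 (subst (kerIn 1) 0 1 H) := by
  obtain ⟨N, hN⟩ := hH
  funext k
  set D := k 0 + k 1 + k 2 with hD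
  set S := Finset.Icc N (D - 2 * N) with hS
  set h : ℤ → ℤ → W := fun m1 m2 => H ![m1, m2, D - m1 - m2] with hh
  have hz : ∀ m1 m2, ¬(m1 ∈ S ∧ m2 ∈ S) → h m1 m2 = 0 := by
    intro m1 m2 hm
    by_contra hc
    have h0 : N ≤ m1 := not_lt.1 fun hlt => hc (hN _ ⟨0, hlt⟩)
    have h1 : N ≤ m2 := not_lt.1 fun hlt => hc (hN _ ⟨1, hlt⟩)
    have h2 : N ≤ D - m1 - m2 := not_lt.1 fun hlt => hc (hN _ ⟨2, hlt⟩)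
    exact hm ⟨Finset.mem_Icc.2 ⟨h0, by omega⟩, Finset.mem_Icc.2 ⟨h1, by omega⟩⟩
  have hfin : ∀ (f : ℤ → W) (T : Finset ℤ), (∀ m, m ∉ T → f m = 0) → ∑ᶠ m, f m = ∑ m ∈ T, f m :=
    fun f T hf => finsum_eq_sum_of_support_subset _ fun m hm => by
      by_contra hc
      exact hm (hf m hc)
  have e1 : ∀ m', subst (kerIn 1) 0 2 (subst (kerIn 1) 1 2 H) (slide 0 1 k m') =
      ∑ m1 ∈ S, ∑ m2 ∈ S, (kerIn 1 m1 m' * kerIn 1 m2 (k 0 + k 1 - m')) • h m1 m2 := by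
    intro m'
    have e2 : ∀ m1, subst (kerIn 1) 1 2 H (slide 0 2 (slide 0 1 k m') m1) =
        ∑ m2 ∈ S, kerIn 1 m2 (k 0 + k 1 - m') • h m1 m2 := by
      intro m1
      have e3 : ∀ m2, H (slide 1 2 (slide 0 2 (slide 0 1 k m') m1) m2) = h m1 m2 := by
        intro m2
        rw [slide_one_two, slide_zero_two, slide_zero_one]
        simp only [hh]
        congr 1
        funext i
        fin_cases i <;> simp
        omega
      rw [subst, hfin _ S]
      · refine Finset.sum_congr rfl fun m2 _ => ?_
        rw [e3, slide_zero_two, slide_zero_one]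
        simp only [Matrix.cons_val_one, Matrix.cons_val_zero]
        rw [add_comm (k 1)]
      · intro m2 hm2
        rw [e3, hz _ _ fun hc => hm2 hc.2, smul_zero]
    rw [subst, hfin _ S]
    · refine Finset.sum_congr rfl fun m1 _ => ?_
      rw [e2, Finset.smul_sum]
      refine Finset.sum_congr rfl fun m2 _ => ?_
      rw [mul_smul, slide_zero_one]
      rfl
    · intro m1 hm1
      rw [e2, Finset.sum_eq_zero, smul_zero]
      intro m2 _
      rw [hz _ _ fun hc => hm1 hc.1, smul_zero]
  have l1 : subst kerOut 0 1 (subst (kerIn 1) 0 2 (subst (kerIn 1) 1 2 H)) k =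
      ∑ m1 ∈ S, ∑ m2 ∈ S, (kerIn 1 m1 (k 0) * kerIn 1 (m1 + m2 - k 0) (k 1)) • h m1 m2 := by
    rw [subst, hfin _ (Finset.Icc 0 (k 0 + k 1))]
    · simp only [e1, Finset.smul_sum, smul_smul]
      rw [Finset.sum_comm]
      refine Finset.sum_congr rfl fun m1 _ => ?_
      rw [Finset.sum_comm]
      refine Finset.sum_congr rfl fun m2 _ => ?_
      rw [← Finset.sum_smul, ← sum_kerOut_mul_kerIn]
      simp only [mul_assoc]
    · intro m' hm'
      rw [e1, Finset.sum_eq_zero, smul_zero]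
      intro m1 _
      refine Finset.sum_eq_zero fun m2 _ => ?_
      rw [Finset.mem_Icc, not_and_or, not_le, not_le] at hm'
      rcases hm' with hm' | hm'
      · rw [kerIn_of_neg _ _ hm', zero_mul, zero_smul]
      · rw [kerIn_of_neg _ m2 (by omega), mul_zero, zero_smul]
  have e4 : ∀ m, subst (kerIn 1) 0 1 H (slide 1 2 k m) =
      ∑ m1 ∈ S, kerIn 1 m1 (k 0) • h m1 (m + k 0 - m1) := by
    intro m
    have e5 : ∀ m1, H (slide 0 1 (slide 1 2 k m) m1) = h m1 (m + k 0 - m1) := by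
      intro m1
      rw [slide_one_two, slide_zero_one]
      simp only [hh]
      congr 1
      funext i
      fin_cases i <;> simp
      omega
    rw [subst, hfin _ S]
    · refine Finset.sum_congr rfl fun m1 _ => ?_
      rw [e5, slide_one_two]
      rfl
    · intro m1 hm1
      rw [e5, hz _ _ fun hc => hm1 hc.1, smul_zero]
  have l2 : subst (kerIn 1) 1 2 (subst (kerIn 1) 0 1 H) k =
      ∑ m1 ∈ S, ∑ m2 ∈ S, (kerIn 1 m1 (k 0) * kerIn 1 (m1 + m2 - k 0) (k 1)) • h m1 m2 := by
    rw [subst, hfin _ (Finset.Icc (2 * N - k 0) (2 * (D - 2 * N) - k 0))]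
    · simp only [e4, Finset.smul_sum, smul_smul]
      rw [Finset.sum_comm]
      refine Finset.sum_congr rfl fun m1 hm1 => ?_
      have hm1' := Finset.mem_Icc.1 hm1
      rw [← hfin (fun m => (kerIn 1 m (k 1) * kerIn 1 m1 (k 0)) • h m1 (m + k 0 - m1)),
        ← hfin (fun m2 => (kerIn 1 m1 (k 0) * kerIn 1 (m1 + m2 - k 0) (k 1)) • h m1 m2),
        ← finsum_comp_equiv (Equiv.addRight (m1 - k 0))]
      · refine finsum_congr fun m => ?_
        simp only [Equiv.coe_addRight]
        rw [mul_comm, show m + (m1 - k 0) = m1 + m - k 0 by ring,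
          show m1 + m - k 0 + k 0 - m1 = m by ring]
      · intro m2 hm2
        rw [hz _ _ fun hc => hm2 hc.2, smul_zero]
      · intro m hm
        rw [hz _ _ fun hc => hm ?_, smul_zero]
        have := Finset.mem_Icc.1 hc.2
        rw [Finset.mem_Icc]
        omega
    · intro m hm
      rw [e4, Finset.sum_eq_zero, smul_zero]
      intro m1 hm1
      rw [hz _ _ fun hc => hm ?_, smul_zero]
      have h1 := Finset.mem_Icc.1 hc.2
      have h2 := Finset.mem_Icc.1 hm1
      rw [Finset.mem_Icc]
      omega
  rw [l1, l2]

theorem sl_subst_one_two_mem_Lau (κ : ℤ → ℤ → ℂ) {H : Fam (Fin 3) W} (hH : H ∈ Lau (Fin 3) W)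
    (k : Fin 3 → ℤ) : sl 0 2 (subst κ 1 2 H) k ∈ Lau (Fin 2) W := by
  obtain ⟨N, hN⟩ := hH
  refine ⟨min N (2 * N - k 1), fun m hm => ?_⟩
  rw [sl, subst]
  refine finsum_eq_zero_of_forall_eq_zero fun n => ?_
  have h0 : Function.extend ![0, 2] m k 0 = m 0 := extend_pair_fst (by decide) m k
  have h1 : Function.extend ![0, 2] m k 1 = k 1 := extend_pair_of_ne m k (by decide) (by decide)
  have h2 : Function.extend ![0, 2] m k 2 = m 1 := extend_pair_snd (by decide) m k
  rw [slide_one_two, h0, h1, h2]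
  by_contra hc
  have hN' : ∀ i, N ≤ (![m 0, n, m 1 + k 1 - n] : Fin 3 → ℤ) i := fun i => by
    by_contra hlt
    exact hc (by rw [hN _ ⟨i, not_le.1 hlt⟩, smul_zero])
  have i0 : N ≤ m 0 := hN' 0
  have i1 : N ≤ n := hN' 1
  have i2 : N ≤ m 1 + k 1 - n := hN' 2
  obtain ⟨i, hi⟩ := hm
  fin_cases i <;> simp only [Fin.zero_eta, Fin.mk_one] at hi <;> omega

theorem sl_subst_zero_one_mem_Lau (κ : ℤ → ℤ → ℂ) {H : Fam (Fin 3) W} (hH : H ∈ Lau (Fin 3) W)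
    (k : Fin 3 → ℤ) : sl 1 2 (subst κ 0 1 H) k ∈ Lau (Fin 2) W := by
  obtain ⟨N, hN⟩ := hH
  refine ⟨min N (2 * N - k 0), fun m hm => ?_⟩
  rw [sl, subst]
  refine finsum_eq_zero_of_forall_eq_zero fun n => ?_
  have h0 : Function.extend ![1, 2] m k 0 = k 0 := extend_pair_of_ne m k (by decide) (by decide)
  have h1 : Function.extend ![1, 2] m k 1 = m 0 := extend_pair_fst (by decide) m k
  have h2 : Function.extend ![1, 2] m k 2 = m 1 := extend_pair_snd (by decide) m k
  rw [slide_zero_one, h0, h1, h2]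
  by_contra hc
  have hN' : ∀ i, N ≤ (![n, m 0 + k 0 - n, m 1] : Fin 3 → ℤ) i := fun i => by
    by_contra hlt
    exact hc (by rw [hN _ ⟨i, not_le.1 hlt⟩, smul_zero])
  have i0 : N ≤ n := hN' 0
  have i1 : N ≤ m 0 + k 0 - n := hN' 1
  have i2 : N ≤ m 1 := hN' 2
  obtain ⟨i, hi⟩ := hm
  fin_cases i <;> simp only [Fin.zero_eta, Fin.mk_one] at hi <;> omega

theorem polySubst_polySubst_polySubst (P : MvPolynomial (Fin 3) ℂ) :
    polySubst 1 0 1 (polySubst 1 0 2 (polySubst 1 1 2 P)) =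
      polySubst 1 1 2 (polySubst 1 0 1 P) := by
  have : ((polySubst 1 0 1).comp ((polySubst 1 0 2).comp (polySubst 1 1 2)) :
      MvPolynomial (Fin 3) ℂ →ₐ[ℂ] MvPolynomial (Fin 3) ℂ) =
      (polySubst 1 1 2).comp (polySubst 1 0 1) := by
    ext v : 1
    fin_cases v <;> simp [polySubst, add_assoc]
  exact DFunLike.congr_fun this P

end Compose

/-! ### The two iterated products -/

section Triple

variable {W : Type*} [AddCommGroup W] [Module ℂ W]

/-- The coefficients of `(Y_ℰ(a, x₀) Y_ℰ(b, x₁) c)(x₂) w`. -/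
def prodTriple (a b c : EW W) (w : W) : Fam (Fin 3) W := fun k =>
  mf (YEa 1 a (YEa 1 b c (-(k 1) - 1)) (-(k 0) - 1)) w (-(k 2) - 1)

/-- The coefficients of `(Y_ℰ(Y_ℰ(a, x₀) b, x₁) c)(x₂) w`. -/
def iterTriple (a b c : EW W) (w : W) : Fam (Fin 3) W := fun k =>
  mf (YEa 1 (YEa 1 a b (-(k 0) - 1)) c (-(k 1) - 1)) w (-(k 2) - 1)

theorem YEa_zero_right (α : ℂˣ) (a : EW W) (n : ℤ) : YEa α a 0 n = 0 := by
  have h : QCPair a 0 := qcPair_iff.2 ⟨1, one_ne_zero, clears_zero_right 1 a⟩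
  have := YEa_smul_of_prodF α (a' := a) (b' := 0) 0 h (fun w => by
    rw [zero_smul]
    exact funext fun k => mf_zero_right _ _) n
  rwa [zero_smul] at this

theorem YEa_zero_left (α : ℂˣ) (b : EW W) (n : ℤ) : YEa α 0 b n = 0 := by
  have h : QCPair 0 b := qcPair_iff.2 ⟨1, one_ne_zero, clears_zero_left 1 b⟩
  have := YEa_smul_of_prodF α (a' := 0) (b' := b) 0 h (fun w => by
    rw [zero_smul]
    rfl) n
  rwa [zero_smul] at this

/-- Multiplied by a suitable polynomial, the two iterated products are obtained from one and the
same element of `W((x₀, x₁, x₂))`. -/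
theorem exists_act_triple {S : Set (EW W)} (hS : QCSet S)
    (hcl : ∀ a ∈ S, ∀ b ∈ S, ∀ n, YEa 1 a b n ∈ S) {a b c : EW W} (ha : a ∈ S) (hb : b ∈ S)
    (hc : c ∈ S) : ∃ P ∈ Good (Fin 3), ∀ w, ∃ H ∈ Lau (Fin 3) W,
      act (polySubst 1 0 2 (polySubst 1 1 2 P)) (prodTriple a b c w) =
        subst (kerIn 1) 0 2 (subst (kerIn 1) 1 2 H) ∧
      act (polySubst 1 1 2 (polySubst 1 0 1 P)) (iterTriple a b c w) =
        subst (kerIn 1) 1 2 (subst (kerIn 1) 0 1 H) := by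
  obtain ⟨P, hP, hPF⟩ := qcSeq_iff.1 (hS 3 ![a, b, c] fun i => by fin_cases i <;> assumption)
  obtain ⟨p, hp0, hp⟩ := qcPair_iff.1 (hS.qcPair ha hb)
  obtain ⟨q, hq0, hq⟩ := qcPair_iff.1 (hS.qcPair hb hc)
  set Q := P * MvPolynomial.rename ![0, 1] p * MvPolynomial.rename ![1, 2] q with hQ
  have hQ' : Q = P * MvPolynomial.rename ![1, 2] q * MvPolynomial.rename ![0, 1] p := by
    rw [hQ]
    ring
  have hV : ((1 : ℂˣ) : ℂ) = 1 := Units.val_one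
  refine ⟨Q, mul_mem (mul_mem hP (rename_mem_good (by decide) hp0))
    (rename_mem_good (by decide) hq0), fun w => ⟨act Q (seqCoeff ![a, b, c] w), ?_, ?_, ?_⟩⟩
  · rw [hQ, mul_assoc, mul_comm, act_mul]
    exact act_mem_Lau _ (hPF w)
  · have hH : act Q (seqCoeff ![a, b, c] w) ∈ Lau (Fin 3) W := by
      rw [hQ, mul_assoc, mul_comm, act_mul]
      exact act_mem_Lau _ (hPF w)
    have h1 := act_pairSubst (σ := Fin 3) (u := 1) (y := 2) 1 (by decide) hq0 hq
      (L := fun k => ((LinearMap.proj (-(k 0) - 1)).comp (a : W →ₗ[ℂ] (ℤ → W)) : W →ₗ[ℂ] W))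
      (v := fun _ => w)
      (fun k k' h => by simp only [h 0 (by decide) (by decide)]) (fun _ _ _ => rfl)
      (P * MvPolynomial.rename ![0, 1] p)
    rw [← hQ, hV] at h1
    change act (polySubst 1 1 2 Q) (famProd 0 2 1 (fun _ => a) (fun n => YEa 1 b c (-n - 1)) w) =
      subst (kerIn 1) 1 2 (act Q (seqCoeff ![a, b, c] w)) at h1
    obtain ⟨N, hN⟩ := (YEa_spec 1 (hS.qcPair hb hc)).1
    have h2 := act_famY (σ := Fin 3) (u := 0) (y := 2) (z := 1) 1 (by decide) (by decide)
      (by decide) (f := fun _ => a) (g := fun n => YEa 1 b c (-n - 1))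
      (fun n => hS.qcPair ha (hcl b hb c hc _)) (N := N) (fun n hn => Or.inr (hN n hn)) w
      (R := polySubst 1 1 2 Q) (fun k => by
        rw [h1]
        exact sl_subst_one_two_mem_Lau _ hH k)
    rw [h1, hV] at h2
    exact h2
  · have hH : act Q (seqCoeff ![a, b, c] w) ∈ Lau (Fin 3) W := by
      rw [hQ, mul_assoc, mul_comm, act_mul]
      exact act_mem_Lau _ (hPF w)
    have h1 := act_pairSubst (σ := Fin 3) (u := 0) (y := 1) 1 (by decide) hp0 hp
      (L := fun _ => LinearMap.id) (v := fun k => mf c w (-(k 2) - 1))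
      (fun _ _ _ => rfl) (fun k k' h => by simp only [h 2 (by decide) (by decide)])
      (P * MvPolynomial.rename ![1, 2] q)
    rw [← hQ', hV] at h1
    change act (polySubst 1 0 1 Q) (famProd 1 2 0 (fun n => YEa 1 a b (-n - 1)) (fun _ => c) w) =
      subst (kerIn 1) 0 1 (act Q (seqCoeff ![a, b, c] w)) at h1
    obtain ⟨N, hN⟩ := (YEa_spec 1 (hS.qcPair ha hb)).1
    have h2 := act_famY (σ := Fin 3) (u := 1) (y := 2) (z := 0) 1 (by decide) (by decide)
      (by decide) (f := fun n => YEa 1 a b (-n - 1)) (g := fun _ => c)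
      (fun n => hS.qcPair (hcl a ha b hb _) hc) (N := N) (fun n hn => Or.inl (hN n hn)) w
      (R := polySubst 1 0 1 Q) (fun k => by
        rw [h1]
        exact sl_subst_zero_one_mem_Lau _ hH k)
    rw [h1, hV] at h2
    exact h2

/-- `(x₀, x₁) ↦ (x₀ + x₁, x₁)` turns the first iterated product into the second one, up to a
polynomial. -/
theorem exists_act_subst_prodTriple {S : Set (EW W)} (hS : QCSet S)
    (hcl : ∀ a ∈ S, ∀ b ∈ S, ∀ n, YEa 1 a b n ∈ S) {a b c : EW W} (ha : a ∈ S) (hb : b ∈ S)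
    (hc : c ∈ S) : ∃ P ∈ Good (Fin 3), ∀ w,
      act (polySubst 1 1 2 (polySubst 1 0 1 P)) (subst kerOut 0 1 (prodTriple a b c w)) =
        act (polySubst 1 1 2 (polySubst 1 0 1 P)) (iterTriple a b c w) ∧
      ∀ k, k 0 < 0 ∨ k 1 < 0 →
        act (polySubst 1 1 2 (polySubst 1 0 1 P)) (iterTriple a b c w) k = 0 := by
  obtain ⟨P, hP, h⟩ := exists_act_triple hS hcl ha hb hc
  refine ⟨P, hP, fun w => ?_⟩
  obtain ⟨H, hH, h1, h2⟩ := h w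
  constructor
  · obtain ⟨N, hN⟩ := (YEa_spec 1 (hS.qcPair hb hc)).1
    have hA : prodTriple a b c w ∈ Adm kerOut 0 1 W := mem_Adm_kerOut fun k =>
      ⟨N, fun m hm n => by
        simp [prodTriple, hN m hm, YEa_zero_right, mf_zero]⟩
    rw [← polySubst_polySubst_polySubst, ← (act_mem_Adm (by decide) kerOut_succ _ hA).2, h1,
      polySubst_polySubst_polySubst, h2, subst_subst_subst hH]
  · rw [h2]
    rintro k (hk | hk)
    · refine finsum_eq_zero_of_forall_eq_zero fun m => ?_
      rw [slide_one_two, subst_kerIn_of_neg, smul_zero]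
      exact hk
    · exact subst_kerIn_of_neg _ _ hk

end Triple

/-! ### Factorisation of the denominators -/

section Factor

open MvPolynomial

/-- Restriction to the diagonal. -/
def diag (σ : Type*) : MvPolynomial σ ℂ →ₐ[ℂ] Polynomial ℂ := aeval fun _ => Polynomial.X

theorem exists_eq_pow_mul_diag_ne_zero {p : MvPolynomial (Fin 2) ℂ} (hp : p ≠ 0) :
    ∃ (s : ℕ) (g : MvPolynomial (Fin 2) ℂ), p = (X 0 - X 1) ^ s * g ∧ diag _ g ≠ 0 := by
  have hu : ¬ IsUnit (X 0 - X 1 : MvPolynomial (Fin 2) ℂ) := fun h => by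
    have := h.map (diag (Fin 2))
    simp [diag] at this
  obtain ⟨g, hg, hd⟩ := (FiniteMultiplicity.of_not_isUnit hu hp).exists_eq_pow_mul_and_not_dvd
  refine ⟨_, g, hg, fun h => hd ?_⟩
  have h1 : aeval (fun _ => X 1) g = (0 : MvPolynomial (Fin 2) ℂ) := by
    have : (aeval (fun _ => X 1) : MvPolynomial (Fin 2) ℂ →ₐ[ℂ] MvPolynomial (Fin 2) ℂ) =
        (Polynomial.aeval (X 1)).comp (diag (Fin 2)) := by
      ext v : 1
      simp [diag]
    rw [this, AlgHom.comp_apply, h, map_zero]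
  rw [← Ideal.mem_span_singleton, ← Ideal.Quotient.eq_zero_iff_mem]
  have h2 : (Ideal.Quotient.mkₐ ℂ (Ideal.span {(X 0 - X 1 : MvPolynomial (Fin 2) ℂ)})).comp
      (aeval fun _ => X 1) = Ideal.Quotient.mkₐ ℂ (Ideal.span {(X 0 - X 1)}) := by
    ext v : 1
    fin_cases v
    · simp only [AlgHom.comp_apply, Fin.zero_eta, aeval_X, Ideal.Quotient.mkₐ_eq_mk]
      rw [eq_comm, Ideal.Quotient.eq]
      exact Ideal.mem_span_singleton_self _
    · simp
  have h3 := DFunLike.congr_fun h2 g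
  rw [AlgHom.comp_apply, h1, map_zero] at h3
  exact h3.symm

/-- Evaluation at `x₀ = x₁ = 0`. -/
def evalZero : MvPolynomial (Fin 3) ℂ →ₐ[ℂ] Polynomial ℂ := aeval ![0, 0, Polynomial.X]

theorem exists_factor_of_mem_good {P : MvPolynomial (Fin 3) ℂ} (hP : P ∈ Good (Fin 3)) :
    ∃ (s0 s1 s2 : ℕ) (U : MvPolynomial (Fin 3) ℂ),
      polySubst 1 1 2 (polySubst 1 0 1 P) =
        U * (X 0 ^ s0 * (X 1 ^ s1 * (X 0 + X 1) ^ s2)) ∧ evalZero U ≠ 0 := by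
  induction hP using Submonoid.closure_induction with
  | mem P hP =>
    obtain ⟨i, j, p, hij, hp, rfl⟩ := hP
    obtain ⟨s, g, rfl, hg⟩ := exists_eq_pow_mul_diag_ne_zero hp
    have h0 : ((polySubst 1 1 2).comp (polySubst 1 0 1)) (X (0 : Fin 3)) =
        X 0 + (X 1 + X 2) := by simp [polySubst]
    have h1 : ((polySubst 1 1 2).comp (polySubst 1 0 1)) (X (1 : Fin 3)) = X 1 + X 2 := by
      simp [polySubst]
    have h2 : ((polySubst 1 1 2).comp (polySubst 1 0 1)) (X (2 : Fin 3)) = X 2 := by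
      simp [polySubst]
    set φ := ((polySubst 1 1 2).comp (polySubst 1 0 1) : MvPolynomial (Fin 3) ℂ →ₐ[ℂ] _) with hφ
    have hφd : evalZero.comp φ = diag (Fin 3) := by
      ext v : 1
      fin_cases v <;> simp [h0, h1, h2, evalZero, diag]
    have hU : evalZero (φ (rename ![i, j] g)) ≠ 0 := by
      have h3 : (diag (Fin 3)).comp (rename ![i, j]) = diag (Fin 2) := by
        ext v : 1
        simp [diag]
      rwa [← AlgHom.comp_apply, hφd, ← AlgHom.comp_apply, h3]
    rw [← AlgHom.comp_apply, ← hφ, map_mul, map_mul, map_pow, map_pow, map_sub, map_sub,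
      rename_X, rename_X]
    simp only [Matrix.cons_val_zero, Matrix.cons_val_one]
    have hU' : evalZero ((-1) ^ s * φ (rename ![i, j] g)) ≠ 0 := by
      rw [map_mul, map_pow, map_neg, map_one]
      exact mul_ne_zero (pow_ne_zero _ (by simp)) hU
    have hcase : φ (X i) - φ (X j) = X 0 ∨ φ (X i) - φ (X j) = -X 0 ∨ φ (X i) - φ (X j) = X 1 ∨
        φ (X i) - φ (X j) = -X 1 ∨ φ (X i) - φ (X j) = X 0 + X 1 ∨
        φ (X i) - φ (X j) = -(X 0 + X 1) := by
      fin_cases i <;> fin_cases j <;>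
        simp only [Fin.zero_eta, Fin.mk_one, Fin.reduceFinMk, h0, h1, h2]
      · exact absurd rfl hij
      · exact Or.inl (by ring)
      · exact Or.inr (Or.inr (Or.inr (Or.inr (Or.inl (by ring)))))
      · exact Or.inr (Or.inl (by ring))
      · exact absurd rfl hij
      · exact Or.inr (Or.inr (Or.inl (by ring)))
      · exact Or.inr (Or.inr (Or.inr (Or.inr (Or.inr (by ring)))))
      · exact Or.inr (Or.inr (Or.inr (Or.inl (by ring))))
      · exact absurd rfl hij
    rcases hcase with h | h | h | h | h | h <;> rw [h]
    · exact ⟨s, 0, 0, _, by ring, hU⟩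
    · exact ⟨s, 0, 0, _, by rw [neg_pow]; ring, hU'⟩
    · exact ⟨0, s, 0, _, by ring, hU⟩
    · exact ⟨0, s, 0, _, by rw [neg_pow]; ring, hU'⟩
    · exact ⟨0, 0, s, _, by ring, hU⟩
    · exact ⟨0, 0, s, _, by rw [neg_pow (X 0 + X 1)]; ring, hU'⟩
  | one => exact ⟨0, 0, 0, 1, by simp, by simp⟩
  | mul P Q _ _ hP hQ =>
    obtain ⟨s0, s1, s2, U, hU, hU'⟩ := hP
    obtain ⟨t0, t1, t2, V, hV, hV'⟩ := hQ
    refine ⟨s0 + t0, s1 + t1, s2 + t2, U * V, ?_, ?_⟩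
    · rw [map_mul, map_mul, hU, hV]
      ring
    · rw [map_mul]
      exact mul_ne_zero hU' hV'

theorem coeff_evalZero (U : MvPolynomial (Fin 3) ℂ) (n : ℕ) :
    (evalZero U).coeff n = U.coeff (Finsupp.single 2 n) := by
  induction U using MvPolynomial.induction_on' with
  | monomial d c =>
    rw [evalZero, aeval_monomial, coeff_monomial, Finsupp.prod_fintype _ _ (fun i => pow_zero _)]
    simp only [Fin.prod_univ_three, Matrix.cons_val_zero, Matrix.cons_val_one, Matrix.cons_val,
      Polynomial.algebraMap_eq, Polynomial.coeff_C_mul]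
    by_cases h0 : d 0 = 0
    · by_cases h1 : d 1 = 0
      · rw [h0, h1, pow_zero, one_mul, one_mul, Polynomial.coeff_X_pow, mul_ite, mul_one, mul_zero]
        refine if_congr ⟨fun h => ?_, fun h => ?_⟩ rfl rfl
        · ext i
          fin_cases i <;> simp [h0, h1, h]
        · rw [h, Finsupp.single_eq_same]
      · rw [zero_pow h1, mul_zero, zero_mul, Polynomial.coeff_zero, mul_zero, if_neg]
        rintro rfl
        simp at h1
    · rw [zero_pow h0, zero_mul, zero_mul, Polynomial.coeff_zero, mul_zero, if_neg]
      rintro rfl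
      simp at h0
  | add P Q hP hQ => rw [map_add, Polynomial.coeff_add, hP, hQ, coeff_add]

end Factor

/-! ### Iteratedly truncated families in three variables -/

section Truncated

variable {W : Type*} [AddCommGroup W] [Module ℂ W]

/-- `W((x_2))((x_j))((x_i))` inside all formal families in `x_0, x_1, x_2`. -/
def Trunc (i j : Fin 3) (W : Type*) [AddCommGroup W] [Module ℂ W] :
    Submodule ℂ (Fam (Fin 3) W) where
  carrier := {F | (∃ N, ∀ k : Fin 3 → ℤ, k i < N → F k = 0) ∧
    (∀ n, ∃ N, ∀ k : Fin 3 → ℤ, k i = n → k j < N → F k = 0) ∧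
    ∀ n n', ∃ N, ∀ k : Fin 3 → ℤ, k i = n → k j = n' → k 2 < N → F k = 0}
  add_mem' := by
    rintro F G ⟨⟨N, hN⟩, hF1, hF2⟩ ⟨⟨M, hM⟩, hG1, hG2⟩
    refine ⟨⟨min N M, fun k hk => ?_⟩, fun n => ?_, fun n n' => ?_⟩
    · rw [Pi.add_apply, hN k (hk.trans_le (min_le_left _ _)),
        hM k (hk.trans_le (min_le_right _ _)), add_zero]
    · obtain ⟨N, hN⟩ := hF1 n
      obtain ⟨M, hM⟩ := hG1 n
      refine ⟨min N M, fun k h1 hk => ?_⟩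
      rw [Pi.add_apply, hN k h1 (hk.trans_le (min_le_left _ _)),
        hM k h1 (hk.trans_le (min_le_right _ _)), add_zero]
    · obtain ⟨N, hN⟩ := hF2 n n'
      obtain ⟨M, hM⟩ := hG2 n n'
      refine ⟨min N M, fun k h1 h2 hk => ?_⟩
      rw [Pi.add_apply, hN k h1 h2 (hk.trans_le (min_le_left _ _)),
        hM k h1 h2 (hk.trans_le (min_le_right _ _)), add_zero]
  zero_mem' := ⟨⟨0, fun _ _ => rfl⟩, fun _ => ⟨0, fun _ _ _ => rfl⟩,
    fun _ _ => ⟨0, fun _ _ _ _ => rfl⟩⟩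
  smul_mem' := by
    rintro c F ⟨⟨N, hN⟩, hF1, hF2⟩
    refine ⟨⟨N, fun k hk => ?_⟩, fun n => ?_, fun n n' => ?_⟩
    · rw [Pi.smul_apply, hN k hk, smul_zero]
    · obtain ⟨N, hN⟩ := hF1 n
      exact ⟨N, fun k h1 hk => by rw [Pi.smul_apply, hN k h1 hk, smul_zero]⟩
    · obtain ⟨N, hN⟩ := hF2 n n'
      exact ⟨N, fun k h1 h2 hk => by rw [Pi.smul_apply, hN k h1 h2 hk, smul_zero]⟩

variable {i j : Fin 3}

theorem act_mem_Trunc (P : MvPolynomial (Fin 3) ℂ) {F : Fam (Fin 3) W} (hF : F ∈ Trunc i j W) :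
    act P F ∈ Trunc i j W := by
  induction P using MvPolynomial.induction_on' with
  | monomial d c =>
    obtain ⟨⟨N, hN⟩, hF1, hF2⟩ := hF
    refine ⟨⟨N, fun k hk => ?_⟩, fun n => ?_, fun n n' => ?_⟩
    · rw [act_monomial, hN _ (by omega), smul_zero]
    · obtain ⟨N, hN⟩ := hF1 (n - d i)
      exact ⟨N, fun k h1 hk => by rw [act_monomial, hN _ (by omega) (by omega), smul_zero]⟩
    · obtain ⟨N, hN⟩ := hF2 (n - d i) (n' - d j)
      exact ⟨N, fun k h1 h2 hk => by
        rw [act_monomial, hN _ (by omega) (by omega) (by omega), smul_zero]⟩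
  | add P Q hP hQ =>
    rw [map_add]
    exact add_mem hP hQ

/-- The lexicographic order on exponents. -/
def lexRel (i j : Fin 3) (k k' : Fin 3 → ℤ) : Prop :=
  k i < k' i ∨ k i = k' i ∧ (k j < k' j ∨ k j = k' j ∧ k 2 < k' 2)

theorem exists_min_image {X : Type*} (f : X → ℤ) {s : Set X} (hs : s.Nonempty)
    (hb : ∃ N, ∀ x ∈ s, N ≤ f x) : ∃ x ∈ s, ∀ y ∈ s, f x ≤ f y := by
  obtain ⟨N, hN⟩ := hb
  obtain ⟨x0, hx0⟩ := hs
  obtain ⟨z, ⟨x, hx, rfl⟩, hz⟩ := Int.exists_least_of_bdd (P := fun z => ∃ x ∈ s, f x = z)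
    ⟨N, by rintro z ⟨x, hx, rfl⟩; exact hN x hx⟩ ⟨_, x0, hx0, rfl⟩
  exact ⟨x, hx, fun y hy => hz _ ⟨y, hy, rfl⟩⟩

theorem wellFoundedOn_of_mem_Trunc {F : Fam (Fin 3) W} (hF : F ∈ Trunc i j W) :
    Set.WellFoundedOn {k | F k ≠ 0} (lexRel i j) := by
  obtain ⟨⟨N, hN⟩, hF1, hF2⟩ := hF
  refine WellFounded.wellFounded_iff_has_min.2 fun s hs => ?_
  obtain ⟨x, hx, hxm⟩ := exists_min_image (fun x => x.1 i) hs
    ⟨N, fun x _ => not_lt.1 fun h => x.2 (hN _ h)⟩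
  obtain ⟨y, ⟨hy, hyx⟩, hym⟩ := exists_min_image (fun x => x.1 j)
    (s := {y | y ∈ s ∧ y.1 i = x.1 i}) ⟨x, hx, rfl⟩ (by
      obtain ⟨N, hN⟩ := hF1 (x.1 i)
      exact ⟨N, fun y hy => not_lt.1 fun h => y.2 (hN _ hy.2 h)⟩)
  obtain ⟨z, ⟨hz, hzx, hzy⟩, hzm⟩ := exists_min_image (fun x => x.1 2)
    (s := {z | z ∈ s ∧ z.1 i = x.1 i ∧ z.1 j = y.1 j}) ⟨y, hy, hyx, rfl⟩ (by
      obtain ⟨N, hN⟩ := hF2 (x.1 i) (y.1 j)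
      exact ⟨N, fun z hz => not_lt.1 fun h => z.2 (hN _ hz.2.1 hz.2.2 h)⟩)
  refine ⟨z, hz, fun u hu hlt => ?_⟩
  rcases hlt with h | ⟨h1, h | ⟨h2, h⟩⟩
  · have := hxm u hu
    exact absurd (h.trans_eq hzx) (not_lt.2 this)
  · have := hym u ⟨hu, h1.trans hzx⟩
    exact absurd (h.trans_eq hzy) (not_lt.2 this)
  · have := hzm u ⟨hu, h1.trans hzx, h2.trans hzy⟩
    exact absurd h (not_lt.2 this)

theorem eq_zero_of_act_eq_zero_of_mem_Trunc (hij : i = 0 ∧ j = 1 ∨ i = 1 ∧ j = 0)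
    {U : MvPolynomial (Fin 3) ℂ} (hU : evalZero U ≠ 0) {F : Fam (Fin 3) W}
    (hF : F ∈ Trunc i j W) (Z : Set (Fin 3 → ℤ))
    (hZ : ∀ k ∈ Z, ∀ k', k' 0 ≤ k 0 → k' 1 ≤ k 1 → k' ∈ Z)
    (h : ∀ k ∈ Z, act U F k = 0) : ∀ k ∈ Z, F k = 0 := by
  have hex : ∃ n, U.coeff (Finsupp.single 2 n) ≠ 0 := by
    by_contra! hc
    exact hU (Polynomial.ext fun n => by rw [coeff_evalZero, hc, Polynomial.coeff_zero])
  set n := Nat.find hex with hn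
  have e0 : (Finsupp.single (2 : Fin 3) n) 0 = 0 := by simp
  have e1 : (Finsupp.single (2 : Fin 3) n) 1 = 0 := by simp
  have e2 : (Finsupp.single (2 : Fin 3) n) 2 = n := by simp
  refine eq_zero_of_act_eq_zero (lexRel i j) (wellFoundedOn_of_mem_Trunc hF)
    (Finsupp.single 2 n) (MvPolynomial.mem_support_iff.2 (Nat.find_spec hex)) ?_ Z ?_ ?_
  · intro k d hd hde
    have h2 : d 0 = 0 → d 1 = 0 → n < d 2 := fun h0 h1 => by
      have hds : d = Finsupp.single 2 (d 2) := by
        ext v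
        fin_cases v <;> simp [h0, h1]
      refine lt_of_le_of_ne (Nat.find_min' hex ?_) fun hc => hde (by rw [hds, ← hc])
      rw [← hds]
      exact MvPolynomial.mem_support_iff.1 hd
    rcases hij with ⟨rfl, rfl⟩ | ⟨rfl, rfl⟩ <;> simp only [lexRel, e0, e1, e2] <;> omega
  · intro k hk d _
    exact hZ k hk _ (by simp only [e0]; omega) (by simp only [e1]; omega)
  · intro k hk
    exact h _ (hZ k hk _ (by simp only [e0]; omega) (by simp only [e1]; omega))

theorem act_X_pow_injective {σ : Type*} (v : σ) (n : ℕ) {F G : Fam σ W}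
    (h : act (MvPolynomial.X v ^ n) F = act (MvPolynomial.X v ^ n) G) : F = G := by
  funext k
  have := congrFun h fun x => k x + if v = x then n else 0
  rw [act_X_pow, act_X_pow] at this
  simpa using this

/-- Cancellation for two families expanded in different orders. -/
theorem eq_of_act_eq_of_mem_Trunc {U : MvPolynomial (Fin 3) ℂ} (hU : evalZero U ≠ 0)
    {F G : Fam (Fin 3) W} (hF : F ∈ Trunc 1 0 W) (hG : G ∈ Trunc 0 1 W)
    (hFG : act U F = act U G) (h0 : ∀ k, k 0 < 0 ∨ k 1 < 0 → act U G k = 0) : F = G := by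
  let Z : Set (Fin 3 → ℤ) := {k | k 0 < 0 ∨ k 1 < 0}
  have hZ : ∀ k ∈ Z, ∀ k', k' 0 ≤ k 0 → k' 1 ≤ k 1 → k' ∈ Z := by
    rintro k (hk | hk) k' h1 h2
    · exact Or.inl (h1.trans_lt hk)
    · exact Or.inr (h2.trans_lt hk)
  have hF0 := eq_zero_of_act_eq_zero_of_mem_Trunc (Or.inr ⟨rfl, rfl⟩) hU hF Z hZ
    fun k hk => by rw [hFG, h0 k hk]
  have hG0 := eq_zero_of_act_eq_zero_of_mem_Trunc (Or.inl ⟨rfl, rfl⟩) hU hG Z hZ h0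
  have hD : F - G ∈ Trunc 0 1 W := by
    refine ⟨⟨0, fun k hk => ?_⟩, fun n => ⟨0, fun k _ hk => ?_⟩, fun n n' => ?_⟩
    · rw [Pi.sub_apply, hF0 k (Or.inl hk), hG0 k (Or.inl hk), sub_zero]
    · rw [Pi.sub_apply, hF0 k (Or.inr hk), hG0 k (Or.inr hk), sub_zero]
    · obtain ⟨N, hN⟩ := hF.2.2 n' n
      obtain ⟨M, hM⟩ := hG.2.2 n n'
      exact ⟨min N M, fun k h1 h2 hk => by
        rw [Pi.sub_apply, hN k h2 h1 (hk.trans_le (min_le_left _ _)),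
          hM k h1 h2 (hk.trans_le (min_le_right _ _)), sub_zero]⟩
  have := eq_zero_of_act_eq_zero_of_mem_Trunc (Or.inl ⟨rfl, rfl⟩) hU hD Set.univ
    (fun _ _ _ _ _ => trivial) fun k _ => by rw [map_sub, hFG, sub_self, Pi.zero_apply]
  exact funext fun k => sub_eq_zero.1 (this k trivial)

end Truncated

/-! ### Weak associativity -/

section WeakAssoc

variable {W : Type*} [AddCommGroup W] [Module ℂ W]

theorem iterTriple_mem_Trunc {a b c : EW W} (hab : QCPair a b)
    (h : ∀ n, QCPair (YEa 1 a b n) c) (w : W) : iterTriple a b c w ∈ Trunc 0 1 W := by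
  refine ⟨?_, fun n => ?_, fun n n' => ?_⟩
  · obtain ⟨N, hN⟩ := (YEa_spec 1 hab).1
    exact ⟨N, fun k hk => by rw [iterTriple, hN _ hk, YEa_zero_left, mf_zero]⟩
  · obtain ⟨N, hN⟩ := (YEa_spec 1 (h (-n - 1))).1
    exact ⟨N, fun k h1 hk => by rw [iterTriple, h1, hN _ hk, mf_zero]⟩
  · obtain ⟨N, hN⟩ := (YEa 1 (YEa 1 a b (-n - 1)) c (-n' - 1)).2 w
    exact ⟨-N, fun k h1 h2 hk => by
      rw [iterTriple, h1, h2]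
      exact hN _ (by omega)⟩

theorem exists_common_bound {p : ℤ → ℤ → Prop} (hp : ∀ n, ∃ N, ∀ m < N, p n m) (a b : ℤ) :
    ∃ N, ∀ n, a ≤ n → n ≤ b → ∀ m < N, p n m := by
  choose f hf using hp
  obtain ⟨N, hN⟩ := ((Finset.Icc a b).finite_toSet.image f).bddBelow
  exact ⟨N, fun n h1 h2 m hm => hf n m
    (hm.trans_le (hN ⟨n, Finset.mem_coe.2 (Finset.mem_Icc.2 ⟨h1, h2⟩), rfl⟩))⟩

theorem subst_prodTriple_mem_Trunc {a b c : EW W} (hbc : QCPair b c)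
    (h : ∀ n, QCPair a (YEa 1 b c n)) (w : W) :
    subst kerOut 0 1 (prodTriple a b c w) ∈ Trunc 1 0 W := by
  obtain ⟨N, hN⟩ := (YEa_spec 1 hbc).1
  have h0 : ∀ k : Fin 3 → ℤ, k 1 < N → prodTriple a b c w k = 0 := fun k hk => by
    rw [prodTriple, hN _ hk, YEa_zero_right, mf_zero]
  have key : ∀ k : Fin 3 → ℤ, (∀ m, k 0 ≤ m → m ≤ k 0 + k 1 - N →
      prodTriple a b c w ![m, k 1 + k 0 - m, k 2] = 0) →
      subst kerOut 0 1 (prodTriple a b c w) k = 0 := fun k hk => by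
    refine finsum_eq_zero_of_forall_eq_zero fun m => ?_
    rw [slide_zero_one]
    by_cases h1 : m < k 0
    · rw [kerOut_of_lt h1, zero_smul]
    · by_cases h2 : m ≤ k 0 + k 1 - N
      · rw [hk m (not_lt.1 h1) h2, smul_zero]
      · rw [h0 _ (by
          change k 1 + k 0 - m < N
          omega), smul_zero]
  refine ⟨⟨N, fun k hk => key k fun m h1 h2 => by omega⟩, fun n => ?_, fun n n' => ?_⟩
  · obtain ⟨M, hM⟩ := exists_common_bound
      (p := fun n m => YEa 1 a (YEa 1 b c (-n - 1)) (-m - 1) = 0)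
      (fun n => (YEa_spec 1 (h (-n - 1))).1) N n
    refine ⟨M - (n - N), fun k h1 hk => key k fun m h2 h3 => ?_⟩
    change mf (YEa 1 a (YEa 1 b c (-(k 1 + k 0 - m) - 1)) (-m - 1)) w (-(k 2) - 1) = 0
    rw [hM _ (by omega) (by omega) _ (by omega), mf_zero]
  · obtain ⟨M, hM⟩ := exists_common_bound
      (p := fun m t => mf (YEa 1 a (YEa 1 b c (-(n + n' - m) - 1)) (-m - 1)) w (-t - 1) = 0)
      (fun m => by
        obtain ⟨N, hN⟩ := (YEa 1 a (YEa 1 b c (-(n + n' - m) - 1)) (-m - 1)).2 w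
        exact ⟨-N, fun t ht => hN _ (by omega)⟩) n' (n' + n - N)
    refine ⟨M, fun k h1 h2 hk => key k fun m h3 h4 => ?_⟩
    change mf (YEa 1 a (YEa 1 b c (-(k 1 + k 0 - m) - 1)) (-m - 1)) w (-(k 2) - 1) = 0
    rw [h1, h2]
    exact hM m (by omega) (by omega) _ hk

theorem exists_weakAssoc {S : Set (EW W)} (hS : QCSet S)
    (hcl : ∀ a ∈ S, ∀ b ∈ S, ∀ n, YEa 1 a b n ∈ S) {a b c : EW W} (ha : a ∈ S) (hb : b ∈ S)
    (hc : c ∈ S) : ∃ l : ℕ, ∀ w,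
      act ((MvPolynomial.X 0 + MvPolynomial.X 1) ^ l) (subst kerOut 0 1 (prodTriple a b c w)) =
        act ((MvPolynomial.X 0 + MvPolynomial.X 1) ^ l) (iterTriple a b c w) := by
  obtain ⟨P, hP, h⟩ := exists_act_subst_prodTriple hS hcl ha hb hc
  obtain ⟨s0, s1, s2, U, hU, hU'⟩ := exists_factor_of_mem_good hP
  refine ⟨s2, fun w => ?_⟩
  obtain ⟨h1, h2⟩ := h w
  rw [hU, act_mul U, act_mul U] at h1
  rw [hU, act_mul U] at h2
  have h3 := eq_of_act_eq_of_mem_Trunc hU'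
    (act_mem_Trunc _ (subst_prodTriple_mem_Trunc (hS.qcPair hb hc)
      (fun n => hS.qcPair ha (hcl b hb c hc n)) w))
    (act_mem_Trunc _ (iterTriple_mem_Trunc (hS.qcPair ha hb)
      (fun n => hS.qcPair (hcl a ha b hb n) hc) w)) h1 h2
  rw [act_mul, act_mul, act_mul, act_mul] at h3
  exact act_X_pow_injective _ _ (act_X_pow_injective _ _ h3)

end WeakAssoc

/-! ### The structures -/

section Structures

variable {W : Type*} [AddCommGroup W] [Module ℂ W]

theorem mulSubPoly_eq (f : MvPolynomial (Fin 2) ℂ) (A : Fam (Fin 2) W) (a b : ℤ) :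
    mulSubPoly f (fun a b => A ![a, b]) a b = act (polySubst 1 0 1 f) A ![a, b] := by
  have h : polySubst 1 0 1 f = ∑ d ∈ f.support, ∑ i ∈ Finset.range (d 0 + 1),
      MvPolynomial.monomial (Finsupp.single 0 (d 0 - i) + Finsupp.single 1 (i + d 1))
        (f.coeff d * ((d 0).choose i : ℂ)) := by
    rw [polySubst, MvPolynomial.aeval_def, MvPolynomial.eval₂_eq']
    refine Finset.sum_congr rfl fun d _ => ?_
    rw [Fin.prod_univ_two, if_pos rfl, if_neg (by decide), map_one, one_mul, add_comm, add_pow,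
      Finset.sum_mul, Finset.mul_sum]
    refine Finset.sum_congr rfl fun i _ => ?_
    rw [MvPolynomial.monomial_add_single, ← MvPolynomial.C_mul_X_pow_eq_monomial, pow_add, map_mul,
      map_natCast, MvPolynomial.algebraMap_eq]
    ring
  rw [h, map_sum, LinearMap.sum_apply, Finset.sum_apply, mulSubPoly]
  refine Finset.sum_congr rfl fun d _ => ?_
  rw [map_sum, LinearMap.sum_apply, Finset.sum_apply]
  refine Finset.sum_congr rfl fun i hi => ?_
  rw [act_monomial]
  have := Finset.mem_range.1 hi
  congr 2
  funext v
  fin_cases v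
  · simp
    omega
  · simp
    omega

theorem prodCE_eq {V : Type*} (Yo Yi : V → W → ℤ → W) (u v : V) (w : W) :
    prodCE Yo Yi u v w = fun a b =>
      subst kerOut 0 1 (fun k : Fin 2 → ℤ => Yo u (Yi v w (-(k 1) - 1)) (-(k 0) - 1)) ![a, b] := by
  funext a b
  rw [prodCE, subst]
  refine finsum_congr fun m => ?_
  have h0 : slide 0 1 ![a, b] m 0 = m := by simp [slide]
  have h1 : slide 0 1 ![a, b] m 1 = b - (m - a) := by
    simp [slide]
    ring
  rw [h0, h1, Matrix.cons_val_zero, kerOut]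
  split_ifs
  · rfl
  · rw [zero_smul]

theorem prodF_mem_Adm (a b : EW W) (w : W) : prodF a b w ∈ Adm kerOut 0 1 W :=
  mem_Adm_kerOut fun k => by
    obtain ⟨N, hN⟩ := b.2 w
    refine ⟨-N, fun m hm n => ?_⟩
    have : mf b w (-m - 1) = 0 := hN _ (by omega)
    simp [prodF, Fab, this, mf_zero_right]

theorem map_subst {W' : Type*} [AddCommGroup W'] [Module ℂ W'] {σ : Type*} {u y : σ}
    {κ : ℤ → ℤ → ℂ} (L : W →ₗ[ℂ] W') {F : Fam σ W} (hF : F ∈ Adm κ u y W) (k : σ → ℤ) :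
    L (subst κ u y F k) = subst κ u y (fun k => L (F k)) k :=
  (map_finsum L (hF k)).trans (finsum_congr fun _ => map_smul _ _ _)

theorem subst_kerIn_eq_subst_kerOut {F : Fam (Fin 2) W} (hF : ∀ k, k 0 < 0 → F k = 0) :
    subst (kerIn 1) 0 1 F = subst kerOut 0 1 F := by
  funext k
  refine finsum_congr fun m => ?_
  by_cases hm : 0 ≤ m
  · rw [kerIn_eq_kerOut hm]
  · rw [hF _ (by
      simp only [slide, if_true]
      omega), smul_zero, smul_zero]

/-- The associativity of the canonical action on `W`. -/
theorem exists_quasiAssoc {a b : EW W} (hab : QCPair a b) (w : W) :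
    ∃ f : MvPolynomial (Fin 2) ℂ, f ≠ 0 ∧
      act (polySubst 1 0 1 f) (subst kerOut 0 1 (prodF a b w)) =
        act (polySubst 1 0 1 f) (genF (fun j => YEa 1 a b (-j - 1)) w) := by
  obtain ⟨p, hp0, hp⟩ := qcPair_iff.1 hab
  obtain ⟨N, hN⟩ := hp w
  refine ⟨MvPolynomial.X 0 ^ (-N).toNat * p,
    mul_ne_zero (pow_ne_zero _ (MvPolynomial.X_ne_zero _)) hp0,
    ?_⟩
  have h := (YEa_spec 1 hab).2 _ (hp.mul_left (MvPolynomial.X 0 ^ (-N).toNat)) w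
  rw [Units.val_one, substF] at h
  rw [h, ← (act_mem_Adm (by decide) kerOut_succ _ (prodF_mem_Adm a b w)).2,
    subst_kerIn_eq_subst_kerOut]
  intro k hk
  rw [act_mul, act_X_pow]
  refine hN _ ⟨0, ?_⟩
  simp only [if_true]
  omega

variable {V : Submodule ℂ (EW W)}

/-- The vertex operator map on a closed quasi compatible space. -/
def vertexOp (hqc : QCSet (V : Set (EW W))) (hcl : ∀ a ∈ V, ∀ b ∈ V, ∀ n, YEa 1 a b n ∈ V) :
    ↥V →ₗ[ℂ] EW ↥V where
  toFun a :=
    ⟨{ toFun := fun b n => ⟨YEa 1 a b n, hcl a a.2 b b.2 n⟩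
       map_add' := fun b b' => funext fun n => Subtype.ext
        (YEa_add_of_prodF 1 (hqc.qcPair a.2 b.2) (hqc.qcPair a.2 b'.2)
          (fun w => prodF_add_snd _ _ _ w) n)
       map_smul' := fun c b => funext fun n => Subtype.ext
        (YEa_smul_of_prodF 1 c (hqc.qcPair a.2 b.2) (fun w => prodF_smul_snd _ _ _ w) n) },
      fun b => by
        obtain ⟨N, hN⟩ := (YEa_spec 1 (hqc.qcPair a.2 b.2)).1
        refine ⟨-N, fun n hn => Subtype.ext ?_⟩
        have := hN (-n - 1) (by omega)
        rwa [show -(-n - 1) - 1 = n by ring] at this⟩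
  map_add' a a' := mf_ext fun b n => Subtype.ext
    (YEa_add_of_prodF 1 (hqc.qcPair a.2 b.2) (hqc.qcPair a'.2 b.2)
      (fun w => prodF_add_fst _ _ _ w) n)
  map_smul' c a := mf_ext fun b n => Subtype.ext
    (YEa_smul_of_prodF 1 c (hqc.qcPair a.2 b.2) (fun w => prodF_smul_fst _ _ _ w) n)

theorem coe_mf_vertexOp (hqc : QCSet (V : Set (EW W)))
    (hcl : ∀ a ∈ V, ∀ b ∈ V, ∀ n, YEa 1 a b n ∈ V) (a b : ↥V) (n : ℤ) :
    ((mf (vertexOp hqc hcl a) b n : ↥V) : EW W) = YEa 1 a b n := rfl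

/-- The mode of an element of `V`, applied to a vector. -/
def modeMap (V : Submodule ℂ (EW W)) (w : W) (n : ℤ) : ↥V →ₗ[ℂ] W where
  toFun a := mf (a : EW W) w n
  map_add' _ _ := rfl
  map_smul' _ _ := rfl

theorem vertexOp_weakAssoc (hqc : QCSet (V : Set (EW W)))
    (hcl : ∀ a ∈ V, ∀ b ∈ V, ∀ n, YEa 1 a b n ∈ V) (u v x : ↥V) : ∃ l : ℕ, ∀ a b : ℤ,
    mulSubPoly (MvPolynomial.X 0 ^ l)
      (prodCE (fun x => mf (vertexOp hqc hcl x)) (fun x => mf (vertexOp hqc hcl x)) u v x) a b =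
    mulSubPoly (MvPolynomial.X 0 ^ l)
      (assocCE (fun x y n => mf (vertexOp hqc hcl x) y n) (fun x => mf (vertexOp hqc hcl x))
        u v x) a b := by
  obtain ⟨l, hl⟩ := exists_weakAssoc hqc hcl u.2 v.2 x.2
  refine ⟨l, fun a b => ?_⟩
  set Y := vertexOp hqc hcl with hY
  have e1 : prodCE (fun x => mf (Y x)) (fun x => mf (Y x)) u v x = fun a b =>
      subst kerOut 0 1 (prodF (Y u) (Y v) x) ![a, b] := prodCE_eq _ _ _ _ _
  have e2 : assocCE (fun x y n => mf (Y x) y n) (fun x => mf (Y x)) u v x = fun a b =>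
      (fun k : Fin 2 → ℤ => mf (Y (mf (Y u) v (-(k 0) - 1))) x (-(k 1) - 1)) ![a, b] := rfl
  rw [e1, e2]
  refine (mulSubPoly_eq _ _ _ _).trans (Eq.trans ?_ (mulSubPoly_eq (MvPolynomial.X 0 ^ l)
    (fun k : Fin 2 → ℤ => mf (Y (mf (Y u) v (-(k 0) - 1))) x (-(k 1) - 1)) a b).symm)
  refine Subtype.ext (mf_ext fun w n => ?_)
  change modeMap V w n _ = modeMap V w n _
  rw [← act_map, ← act_map]
  simp only [map_subst (modeMap V w n) (prodF_mem_Adm _ _ _)]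
  have h := congrArg (fun F => sl 0 1 F (fun _ => -n - 1)) (hl w)
  have hr : (MvPolynomial.X 0 + MvPolynomial.X 1) ^ l =
      MvPolynomial.rename (![0, 1] : Fin 2 → Fin 3)
        (polySubst 1 0 1 (MvPolynomial.X 0 ^ l : MvPolynomial (Fin 2) ℂ)) := by
    simp [polySubst]
  rw [hr, sl_act_rename (by decide), sl_act_rename (by decide), sl_subst (by decide)] at h
  have h3 : sl 0 1 (prodTriple u.1 v.1 x.1 w) (fun _ => -n - 1) =
      fun k => modeMap V w n (prodF (Y u) (Y v) x k) := by
    funext k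
    simp only [sl, prodTriple, extend_pair_fst (show (0 : Fin 3) ≠ 1 by decide),
      extend_pair_snd (show (0 : Fin 3) ≠ 1 by decide),
      extend_pair_of_ne k _ (show (2 : Fin 3) ≠ 0 by decide) (show (2 : Fin 3) ≠ 1 by decide)]
    rw [show -(-n - 1) - 1 = n by ring]
    rfl
  have h4 : sl 0 1 (iterTriple u.1 v.1 x.1 w) (fun _ => -n - 1) =
      fun k => modeMap V w n (mf (Y (mf (Y u) v (-(k 0) - 1))) x (-(k 1) - 1)) := by
    funext k
    simp only [sl, iterTriple, extend_pair_fst (show (0 : Fin 3) ≠ 1 by decide),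
      extend_pair_snd (show (0 : Fin 3) ≠ 1 by decide),
      extend_pair_of_ne k _ (show (2 : Fin 3) ≠ 0 by decide) (show (2 : Fin 3) ≠ 1 by decide)]
    rw [show -(-n - 1) - 1 = n by ring]
    rfl
  rw [h3, h4] at h
  exact congrFun h _

/-- The nonlocal vertex algebra structure of a closed quasi compatible space containing `1_W`. -/
def closedNLVA (hqc : QCSet (V : Set (EW W))) (hcl : ∀ a ∈ V, ∀ b ∈ V, ∀ n, YEa 1 a b n ∈ V)
    (h1 : oneE ∈ V) : NLVA ↥V where
  Y := vertexOp hqc hcl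
  one := ⟨oneE, h1⟩
  vac v n := Subtype.ext (by
    rw [coe_mf_vertexOp, show n = -(-n - 1) - 1 by ring, YEa_oneE_left]
    by_cases h : -n - 1 = 0
    · rw [if_pos h, if_pos (by omega)]
    · rw [if_neg h, if_neg (by omega)]
      rfl)
  creation0 v n hn := Subtype.ext (by
    rw [coe_mf_vertexOp, show n = -(-n - 1) - 1 by ring, YEa_oneE_right,
      taylorE_of_neg _ _ (by omega)]
    rfl)
  creation1 v := Subtype.ext (by
    rw [coe_mf_vertexOp, show (-1 : ℤ) = -0 - 1 by ring, YEa_oneE_right, taylorE_zero, RaE_one])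
  wassoc := vertexOp_weakAssoc hqc hcl

theorem isQuasiModule_closedNLVA (hqc : QCSet (V : Set (EW W)))
    (hcl : ∀ a ∈ V, ∀ b ∈ V, ∀ n, YEa 1 a b n ∈ V) (h1 : oneE ∈ V) :
    IsQuasiModule (closedNLVA hqc hcl h1) V.subtype := by
  refine ⟨fun w n => mf_oneE w n, fun u v w => ?_⟩
  obtain ⟨f, hf0, hf⟩ := exists_quasiAssoc (hqc.qcPair u.2 v.2) w
  refine ⟨f, hf0, fun a b => ?_⟩
  have e1 : prodCE (YWf V.subtype) (YWf V.subtype) u v w = fun a b =>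
      subst kerOut 0 1 (prodF u.1 v.1 w) ![a, b] := prodCE_eq _ _ _ _ _
  have e2 : assocCE (Yf (closedNLVA hqc hcl h1)) (YWf V.subtype) u v w = fun a b =>
      genF (fun j => YEa 1 u.1 v.1 (-j - 1)) w ![a, b] := rfl
  rw [e1, e2, mulSubPoly_eq, mulSubPoly_eq, hf]

end Structures

/-- cf. Theorem 2.12.  Let `W` be a vector space over `ℂ` and let
`V` be a maximal quasi compatible subspace of `ℰ(W)`.  Then `V` contains `1_W`, `V`
is closed, `(V, Y_ℰ, 1_W)` carries the structure of a nonlocal vertex algebra with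
`W` as a faithful quasi module via `Y_W(ψ(x), x₀) = ψ(x₀)`, and moreover
`R_α a(x) = a(αx) ∈ V` and `a(x)_{(α,n)} b(x) ∈ V` for all `a(x), b(x) ∈ V`,
`α ∈ ℂˣ`, `n ∈ ℤ`. -/
theorem statement1 {W : Type*} [AddCommGroup W] [Module ℂ W]
    (V : Submodule ℂ (EW W))
    (hqc : QCSet (V : Set (EW W)))
    (hmax : ∀ V' : Submodule ℂ (EW W), QCSet (V' : Set (EW W)) → V ≤ V' → V = V') :
    oneE ∈ V ∧
    (∀ a ∈ V, ∀ b ∈ V, ∀ n : ℤ, YE a b n ∈ V) ∧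
    (∃ A : NLVA ↥V, (A.one : EW W) = oneE ∧
      (∀ (a b : ↥V) (n : ℤ), ((Yf A a b n : ↥V) : EW W) = YE (a : EW W) (b : EW W) n) ∧
      IsQuasiModule A V.subtype ∧ Function.Injective V.subtype) ∧
    (∀ a ∈ V, ∀ α : ℂˣ, RaE α a ∈ V) ∧
    (∀ a ∈ V, ∀ b ∈ V, ∀ (α : ℂˣ) (n : ℤ), YEa α a b n ∈ V) := by
  have h1 := oneE_mem_of_maximal hqc hmax
  have hcl : ∀ a ∈ V, ∀ b ∈ V, ∀ (α : ℂˣ) (n : ℤ), YEa α a b n ∈ V := fun a ha b hb α n =>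
    YEa_mem_of_maximal hqc hmax ha hb α n
  have hcl1 : ∀ a ∈ V, ∀ b ∈ V, ∀ n, YEa 1 a b n ∈ V := fun a ha b hb n => hcl a ha b hb 1 n
  exact ⟨h1, hcl1, ⟨closedNLVA hqc hcl1 h1, rfl, fun _ _ _ => rfl,
    isQuasiModule_closedNLVA hqc hcl1 h1, V.subtype_injective⟩,
    fun a ha α => RaE_mem_of_maximal hqc hmax ha α, hcl⟩

end NVA
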